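/- Let ε > 0 and γ ∈ (0,1) be arbitrary. There exists a constant C > 0 such that for all α ∈ (0,1) there is d₀ ∈ ℕ with the following property. Let d ≥ d₀, n ∈ ℕ, and let k and q ≥ s satisfy 1 ≤ k ≤ d^{2αγ}, q = 4(1+γ+ε)d / log(d^α/√k), and s ≥ d^α + C√(log n). Let ℋ = (L,H) be a q-fold correspondence cover of an n-vertex graph G such that (i) H is k-locally-sparse and (ii) Δ(H) ≤ d. Suppose for each vertex v ∈ V(G), a set S(v) ⊆ L(v) of size s is sampled independently and uniformly at random. Then with probability at least 1 − 1/n, G has a proper ℋ-coloring φ with φ(v) ∈ S(v) for all v ∈ V(G). -/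

import Mathlib

open Finset

attribute [local instance] Classical.propDecidable

noncomputable section

/-- The number of ordered pairs of adjacent vertices inside `S`; this is exactly twice the
number of edges of the subgraph induced on `S`. -/
def pairsWithin {V : Type} [Fintype V] (G : SimpleGraph V) (S : Finset V) : ℕ :=
  ((S ×ˢ S).filter fun p => G.Adj p.1 p.2).card

/-- `G` is `k`-locally-sparse: each neighborhood induces at most `k` edges. -/
def LocallySparse {V : Type} [Fintype V] (G : SimpleGraph V) (k : ℝ) : Prop :=
  ∀ v : V, (pairsWithin G (G.neighborFinset v) : ℝ) ≤ 2 * k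

/-- `(L, H)` is a correspondence cover of `G`. -/
structure IsCorrespondenceCover {V C : Type} (G : SimpleGraph V) (H : SimpleGraph C)
    (L : V → Finset C) : Prop where
  partition : ∀ c : C, ∃! v : V, c ∈ L v
  indep : ∀ v : V, ∀ c ∈ L v, ∀ c' ∈ L v, ¬H.Adj c c'
  matching : ∀ u v : V, ∀ c ∈ L u, ∀ c₁ ∈ L v, ∀ c₂ ∈ L v,
    H.Adj c c₁ → H.Adj c c₂ → c₁ = c₂
  not_adj : ∀ u v : V, ¬G.Adj u v → ∀ c ∈ L u, ∀ c' ∈ L v, ¬H.Adj c c'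

set_option linter.unusedSectionVars false
set_option linter.unusedSimpArgs false

/-- Expectation over a random subset of `S` (independent Bernoulli). -/
def Ex {ι : Type*} (q : ι → ℝ) (S : Finset ι) (f : Finset ι → ℝ) : ℝ :=
  ∑ A ∈ S.powerset, ((∏ w ∈ A, q w) * ∏ w ∈ S \ A, (1 - q w)) * f A

lemma Ex_empty {ι : Type*} (q : ι → ℝ) (f : Finset ι → ℝ) : Ex q ∅ f = f ∅ := by
  simp [Ex]

lemma Ex_insert {ι : Type*} (q : ι → ℝ) (S : Finset ι) (w : ι) (hw : w ∉ S) (f : Finset ι → ℝ) :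
    Ex q (insert w S) f = (1 - q w) * Ex q S f + q w * Ex q S (fun A => f (insert w A)) := by
  unfold Ex
  rw [Finset.sum_powerset_insert hw, Finset.mul_sum, Finset.mul_sum]
  congr 1
  · refine Finset.sum_congr rfl fun A hA => ?_
    have hA' : w ∉ A := fun h => hw (Finset.mem_powerset.1 hA h)
    rw [Finset.insert_sdiff_of_notMem _ hA', Finset.prod_insert (by simp [hw])]
    ring
  · refine Finset.sum_congr rfl fun A hA => ?_
    have hA' : w ∉ A := fun h => hw (Finset.mem_powerset.1 hA h)
    have : insert w S \ insert w A = S \ A := by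
      ext x; simp only [Finset.mem_sdiff, Finset.mem_insert]
      constructor
      · rintro ⟨h1 | h1, h2⟩
        · exact absurd (Or.inl h1) h2
        · exact ⟨h1, fun h => h2 (Or.inr h)⟩
      · rintro ⟨h1, h2⟩
        exact ⟨Or.inr h1, fun h => h.elim (fun h => hw (h ▸ h1)) h2⟩
    rw [this, Finset.prod_insert hA']
    ring

lemma Ex_mono {ι : Type*} (q : ι → ℝ) (S : Finset ι) (f g : Finset ι → ℝ)
    (h0 : ∀ w ∈ S, 0 ≤ q w) (h1 : ∀ w ∈ S, q w ≤ 1) (h : ∀ A ⊆ S, f A ≤ g A) :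
    Ex q S f ≤ Ex q S g := by
  unfold Ex
  refine Finset.sum_le_sum fun A hA => ?_
  have hA := Finset.mem_powerset.1 hA
  refine mul_le_mul_of_nonneg_left (h A hA) (mul_nonneg ?_ ?_)
  · exact Finset.prod_nonneg fun w hw => h0 w (hA hw)
  · exact Finset.prod_nonneg fun w hw => sub_nonneg.2 (h1 w (Finset.mem_sdiff.1 hw).1)

lemma Ex_const {ι : Type*} (q : ι → ℝ) (S : Finset ι) (a : ℝ) : Ex q S (fun _ => a) = a := by
  induction S using Finset.induction_on with
  | empty => simp [Ex_empty]
  | insert w S hw ih => rw [Ex_insert q S w hw, ih]; ring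

lemma Ex_add {ι : Type*} (q : ι → ℝ) (S : Finset ι) (f g : Finset ι → ℝ) :
    Ex q S (fun A => f A + g A) = Ex q S f + Ex q S g := by
  unfold Ex; rw [← Finset.sum_add_distrib]; exact Finset.sum_congr rfl fun _ _ => by ring

lemma Ex_mul {ι : Type*} (q : ι → ℝ) (S : Finset ι) (a : ℝ) (f : Finset ι → ℝ) :
    Ex q S (fun A => a * f A) = a * Ex q S f := by
  unfold Ex; rw [Finset.mul_sum]; exact Finset.sum_congr rfl fun _ _ => by ring

lemma Ex_sum {ι κ : Type*} (q : ι → ℝ) (S : Finset ι) (T : Finset κ) (f : κ → Finset ι → ℝ) :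
    Ex q S (fun A => ∑ i ∈ T, f i A) = ∑ i ∈ T, Ex q S (f i) := by
  induction T using Finset.induction_on with
  | empty => simp [Ex_const]
  | insert i T hi ih => simp only [Finset.sum_insert hi]; rw [Ex_add, ih]

lemma Ex_nonneg {ι : Type*} (q : ι → ℝ) (S : Finset ι) (f : Finset ι → ℝ)
    (h0 : ∀ w ∈ S, 0 ≤ q w) (h1 : ∀ w ∈ S, q w ≤ 1) (h : ∀ A ⊆ S, 0 ≤ f A) : 0 ≤ Ex q S f := by
  have := Ex_mono q S (fun _ => 0) f h0 h1 h
  rwa [Ex_const] at this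

/-- independence -/
lemma Ex_indep {ι : Type*} (q : ι → ℝ) (S S1 S2 : Finset ι) (hd : Disjoint S1 S2)
    (f g : Finset ι → ℝ) (hf : ∀ A, f A = f (A ∩ S1)) (hg : ∀ A, g A = g (A ∩ S2)) :
    Ex q S (fun A => f A * g A) = Ex q S f * Ex q S g := by
  induction S using Finset.induction_on generalizing f g with
  | empty => simp [Ex_empty]
  | insert w S hw ih =>
    have hf' : ∀ A, f (insert w A) = f (insert w (A ∩ S1)) := fun A => by
      rw [hf, hf (insert w (A ∩ S1))]; congr 1; ext x; simp; tauto
    have hg' : ∀ A, g (insert w A) = g (insert w (A ∩ S2)) := fun A => by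
      rw [hg, hg (insert w (A ∩ S2))]; congr 1; ext x; simp; tauto
    rw [Ex_insert q S w hw, Ex_insert q S w hw, Ex_insert q S w hw, ih f g hf hg,
      ih (fun A => f (insert w A)) (fun A => g (insert w A)) hf' hg']
    by_cases h : w ∈ S1
    · have h2 : w ∉ S2 := fun h2 => (Finset.disjoint_left.1 hd) h h2
      have : (fun A => g (insert w A)) = g := by
        funext A; rw [hg, hg A, Finset.insert_inter_of_notMem h2]
      rw [this]; ring
    · have : (fun A => f (insert w A)) = f := by
        funext A; rw [hf, hf A, Finset.insert_inter_of_notMem h]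
      rw [this]; ring

/-- indicator -/
def ind (P : Prop) : ℝ := if P then 1 else 0

lemma ind_nonneg (P : Prop) : 0 ≤ ind P := by unfold ind; split_ifs <;> norm_num
lemma ind_le_one (P : Prop) : ind P ≤ 1 := by unfold ind; split_ifs <;> norm_num
lemma ind_true {P : Prop} (h : P) : ind P = 1 := by simp [ind, h]
lemma ind_false {P : Prop} (h : ¬ P) : ind P = 0 := by simp [ind, h]
lemma ind_mono {P Q : Prop} (h : P → Q) : ind P ≤ ind Q := by
  by_cases hP : P
  · rw [ind_true hP, ind_true (h hP)]
  · rw [ind_false hP]; exact ind_nonneg _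

/-- Lovász local lemma. -/
lemma LLL {ι κ : Type*} [Fintype κ] (q : ι → ℝ) (S : Finset ι)
    (h0 : ∀ w ∈ S, 0 ≤ q w) (h1 : ∀ w ∈ S, q w ≤ 1)
    (E : κ → Finset ι → Prop) (sc : κ → Finset ι) (hE : ∀ i A, E i A ↔ E i (A ∩ sc i))
    (Γ : κ → Finset κ) (hΓ : ∀ i j, j ∉ Γ i → Disjoint (sc i) (sc j)) (hii : ∀ i, i ∈ Γ i)
    (hP : ∀ i, ∑ j ∈ Γ i, Ex q S (fun A => ind (E j A)) ≤ 1 / 4) :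
    ∃ A ⊆ S, ∀ i, ¬ E i A := by
  set P : κ → ℝ := fun j => Ex q S (fun A => ind (E j A)) with hPdef
  have hP0 : ∀ j, 0 ≤ P j := fun j => Ex_nonneg q S _ h0 h1 fun A _ => ind_nonneg _
  let Q : Finset κ → ℝ := fun I => Ex q S (fun A => ind (∀ j ∈ I, ¬ E j A))
  have hQ0 : ∀ I, 0 ≤ Q I := fun I => Ex_nonneg q S _ h0 h1 fun A _ => ind_nonneg _
  -- key
  have key : ∀ n : ℕ, ∀ I : Finset κ, I.card = n → ∀ i,
      Ex q S (fun A => ind (E i A ∧ ∀ j ∈ I, ¬ E j A)) ≤ 2 * P i * Q I := by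
    intro n
    induction n using Nat.strong_induction_on with
    | _ n ih =>
      intro I hI i
      set I1 := I ∩ Γ i
      set I2 := I \ Γ i
      have hstep1 : Ex q S (fun A => ind (E i A ∧ ∀ j ∈ I, ¬ E j A)) ≤ P i * Q I2 := by
        have hsc : Disjoint (sc i) (I2.biUnion sc) := by
          rw [Finset.disjoint_biUnion_right]
          intro j hj
          exact hΓ i j (Finset.mem_sdiff.1 hj).2
        have := Ex_indep q S (sc i) (I2.biUnion sc) hsc (fun A => ind (E i A))
          (fun A => ind (∀ j ∈ I2, ¬ E j A)) (fun A => by rw [hE i A])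
          (fun A => by
            congr 1; apply propext
            refine forall_congr' fun j => forall_congr' fun hj => not_congr ?_
            have : A ∩ I2.biUnion sc ∩ sc j = A ∩ sc j := by
              ext x; simp only [Finset.mem_inter, Finset.mem_biUnion]
              constructor
              · rintro ⟨⟨a, _⟩, b⟩; exact ⟨a, b⟩
              · rintro ⟨a, b⟩; exact ⟨⟨a, j, hj, b⟩, b⟩
            rw [hE j A, hE j (A ∩ I2.biUnion sc), this])
        rw [hPdef]; simp only [Q]; rw [← this]
        refine Ex_mono q S _ _ h0 h1 fun A _ => ?_
        by_cases h : E i A ∧ ∀ j ∈ I, ¬ E j A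
        · rw [ind_true h, ind_true h.1, ind_true (fun j hj => h.2 j (Finset.mem_sdiff.1 hj).1)]
          norm_num
        · rw [ind_false h]; exact mul_nonneg (ind_nonneg _) (ind_nonneg _)
      have hstep2 : Q I2 ≤ 2 * Q I := by
        rcases Finset.eq_empty_or_nonempty I1 with he | hne
        · have : I2 = I := by
            simp only [I2]; rw [Finset.sdiff_eq_self_iff_disjoint, Finset.disjoint_iff_inter_eq_empty]
            exact he
          rw [this]; linarith [hQ0 I]
        · have hlt : I2.card < n := by
            rw [← hI]; apply Finset.card_lt_card
            refine ⟨Finset.sdiff_subset, fun h => ?_⟩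
            obtain ⟨x, hx⟩ := hne
            have hx := Finset.mem_inter.1 hx
            exact (Finset.mem_sdiff.1 (h hx.1)).2 hx.2
          have hsum : Q I2 ≤ Q I + ∑ j ∈ I1, Ex q S (fun A => ind (E j A ∧ ∀ j ∈ I2, ¬ E j A)) := by
            simp only [Q]
            rw [← Ex_sum, ← Ex_add]
            refine Ex_mono q S _ _ h0 h1 fun A _ => ?_
            by_cases h2 : ∀ j ∈ I2, ¬ E j A
            · by_cases h : ∀ j ∈ I, ¬ E j A
              · rw [ind_true h2, ind_true h]
                linarith [Finset.sum_nonneg (s := I1) (f := fun j => ind (E j A ∧ ∀ j ∈ I2, ¬ E j A))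
                  fun j _ => ind_nonneg _]
              · rw [ind_true h2, ind_false h]
                push Not at h
                obtain ⟨j, hj, hjE⟩ := h
                have hj1 : j ∈ I1 := by
                  by_contra hc
                  exact h2 j (Finset.mem_sdiff.2 ⟨hj, fun hg => hc (Finset.mem_inter.2 ⟨hj, hg⟩)⟩) hjE
                have := Finset.single_le_sum (s := I1) (f := fun j => ind (E j A ∧ ∀ j ∈ I2, ¬ E j A))
                  (fun j _ => ind_nonneg _) hj1
                skip
                rw [ind_true ⟨hjE, h2⟩] at this
                linarith
            · rw [ind_false h2]
              exact add_nonneg (ind_nonneg _) (Finset.sum_nonneg fun j _ => ind_nonneg _)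
          have hsum2 : ∑ j ∈ I1, Ex q S (fun A => ind (E j A ∧ ∀ j ∈ I2, ¬ E j A)) ≤
              ∑ j ∈ I1, 2 * P j * Q I2 := Finset.sum_le_sum fun j _ => ih _ hlt I2 rfl j
          rw [← Finset.sum_mul, ← Finset.mul_sum] at hsum2
          have hsub : ∑ j ∈ I1, P j ≤ 1 / 4 := le_trans
            (Finset.sum_le_sum_of_subset_of_nonneg Finset.inter_subset_right fun j _ _ => hP0 j) (hP i)
          nlinarith [hQ0 I2]
      nlinarith [hP0 i, hQ0 I2]
  have hpos : ∀ I : Finset κ, 0 < Q I := by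
    intro I
    induction I using Finset.induction_on with
    | empty => simp [Q, ind, Ex_const]
    | insert i I hi ih =>
      have h2 : Q I ≤ Q (insert i I) + Ex q S (fun A => ind (E i A ∧ ∀ j ∈ I, ¬ E j A)) := by
        simp only [Q]
        rw [← Ex_add]
        refine Ex_mono q S _ _ h0 h1 fun A _ => ?_
        by_cases hA : E i A <;> by_cases hB : ∀ j ∈ I, ¬ E j A <;> simp [ind, hA, hB]
        · split_ifs <;> norm_num
        · split_ifs <;> norm_num
      have h3 := key _ I rfl i
      have h4 : P i ≤ 1 / 4 := le_trans
        (Finset.single_le_sum (f := P) (fun j _ => hP0 j) (hii i)) (hP i)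
      nlinarith
  by_contra hcon
  push Not at hcon
  have h5 := hpos Finset.univ
  have h6 : Q Finset.univ ≤ 0 := by
    have := Ex_mono q S (fun A => ind (∀ j ∈ Finset.univ, ¬ E j A)) (fun _ => 0) h0 h1
      (fun A hA => by
        obtain ⟨i, hi⟩ := hcon A hA
        rw [ind_false]; intro h; exact h i (Finset.mem_univ _) hi)
    rwa [Ex_const] at this
  linarith


lemma exp_quad {y : ℝ} (h0 : 0 ≤ y) (h1 : y ≤ 1) : Real.exp y ≤ 1 + y + y ^ 2 := by
  have := Real.exp_bound' h0 h1 (n := 2) (by norm_num)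
  simp [Finset.sum_range_succ] at this
  nlinarith

lemma exp_neg_quad {y : ℝ} (h0 : 0 ≤ y) : Real.exp (-y) ≤ 1 - y + y ^ 2 / 2 := by
  have h := Real.quadratic_le_exp_of_nonneg h0
  rw [Real.exp_neg]
  rw [inv_le_comm₀ (Real.exp_pos _) (by nlinarith)]
  refine le_trans ?_ h
  rw [inv_le_iff_one_le_mul₀ (by nlinarith)]
  nlinarith [sq_nonneg y, mul_nonneg h0 (sq_nonneg y), sq_nonneg (y^2)]

lemma ind_insert {ι : Type*} (w : ι) (A N : Finset ι) :
    ind (Disjoint (insert w A) N) = (if w ∈ N then 0 else 1) * ind (Disjoint A N) := by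
  unfold ind
  rw [Finset.disjoint_insert_left]
  by_cases h : w ∈ N <;> simp [h]

lemma MGF_neg {ι κ : Type*} (q : ι → ℝ) (S : Finset ι) (β : ℝ) (hβ0 : 0 ≤ β) (hβ1 : β ≤ 1)
    (h0 : ∀ w ∈ S, 0 ≤ q w) (h1 : ∀ w ∈ S, (1 + β) * q w ≤ 1)
    (J : Finset κ) (N : κ → Finset ι) (d : κ → ℝ) (hd : ∀ j ∈ J, 0 ≤ d j)
    (hs : ∀ w ∈ S, ∑ j ∈ J with w ∈ N j, d j ≤ β) :
    Ex q S (fun A => Real.exp (- ∑ j ∈ J, d j * ind (Disjoint A (N j)))) ≤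
      Real.exp (- ∑ j ∈ J, d j * ∏ w ∈ S with w ∈ N j, (1 - (1 + β) * q w)) := by
  induction S using Finset.induction_on generalizing d with
  | empty => simp [Ex_empty, ind]
  | insert w S hw ih =>
    have ih1 := ih (fun x hx => h0 x (mem_insert_of_mem hx)) (fun x hx => h1 x (mem_insert_of_mem hx))
      d hd (fun x hx => hs x (mem_insert_of_mem hx))
    have ih2 := ih (fun x hx => h0 x (mem_insert_of_mem hx)) (fun x hx => h1 x (mem_insert_of_mem hx))
      (fun j => d j * (if w ∈ N j then 0 else 1)) (fun j hj => mul_nonneg (hd j hj) (by split_ifs <;> norm_num))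
      (fun x hx => le_trans (Finset.sum_le_sum fun j hj => by
        have := hd j (mem_filter.1 hj).1
        split_ifs <;> nlinarith) (hs x (mem_insert_of_mem hx)))
    rw [Ex_insert q S w hw]
    have hq0 := h0 w (mem_insert_self _ _)
    have hq1 := h1 w (mem_insert_self _ _)
    have hq1' : q w ≤ 1 := by nlinarith
    simp only [ind_insert, ← mul_assoc]
    set π : κ → ℝ := fun j => ∏ w ∈ S with w ∈ N j, (1 - (1 + β) * q w) with hπ
    have hπ0 : ∀ j, 0 ≤ π j := fun j => Finset.prod_nonneg fun x hx => by
      have := h1 x (mem_insert_of_mem (mem_filter.1 hx).1); linarith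
    have hπ1 : ∀ j, π j ≤ 1 := fun j => Finset.prod_le_one (fun x hx => by
      have := h1 x (mem_insert_of_mem (mem_filter.1 hx).1); linarith) (fun x hx => by
      have := h0 x (mem_insert_of_mem (mem_filter.1 hx).1); nlinarith)
    set y := ∑ j ∈ J with w ∈ N j, d j * π j with hy
    have hy0 : 0 ≤ y := Finset.sum_nonneg fun j hj => mul_nonneg (hd j (mem_filter.1 hj).1) (hπ0 j)
    have hyβ : y ≤ β := le_trans (Finset.sum_le_sum fun j hj => by
      have := hd j (mem_filter.1 hj).1; nlinarith [hπ1 j]) (hs w (mem_insert_self _ _))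
    have e1 : ∑ j ∈ J, d j * (if w ∈ N j then 0 else 1) * π j = ∑ j ∈ J, d j * π j - y := by
      rw [hy, Finset.sum_filter, ← Finset.sum_sub_distrib]
      refine Finset.sum_congr rfl fun j _ => ?_
      split_ifs <;> ring
    have e2 : ∑ j ∈ J, d j * ∏ x ∈ insert w S with x ∈ N j, (1 - (1 + β) * q x) =
        ∑ j ∈ J, d j * π j - (1 + β) * q w * y := by
      rw [hy, Finset.sum_filter, Finset.mul_sum, ← Finset.sum_sub_distrib]
      refine Finset.sum_congr rfl fun j _ => ?_
      rw [Finset.filter_insert]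
      split_ifs with h
      · rw [Finset.prod_insert (by simp [hw])]; simp only [hπ]; ring
      · simp only [hπ]; ring
    rw [e2]
    rw [e1] at ih2
    set Y := ∑ j ∈ J, d j * π j
    have e3 : Real.exp (-(Y - y)) = Real.exp (-Y) * Real.exp y := by rw [← Real.exp_add]; ring_nf
    have e4 : Real.exp (-(Y - (1 + β) * q w * y)) = Real.exp (-Y) * Real.exp ((1 + β) * q w * y) := by
      rw [← Real.exp_add]; ring_nf
    rw [e3] at ih2
    rw [e4]
    have h5 : 1 + q w * (Real.exp y - 1) ≤ Real.exp ((1 + β) * q w * y) := by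
      have a1 := exp_quad hy0 (hyβ.trans hβ1)
      have a2 := Real.add_one_le_exp ((1 + β) * q w * y)
      have a3 : q w * (Real.exp y - 1) ≤ q w * (y + y * β) := by
        apply mul_le_mul_of_nonneg_left _ hq0; nlinarith
      nlinarith
    have hp := Real.exp_pos (-Y)
    calc _ ≤ (1 - q w) * Real.exp (-Y) + q w * (Real.exp (-Y) * Real.exp y) := by
          refine add_le_add (mul_le_mul_of_nonneg_left ih1 (by linarith)) (mul_le_mul_of_nonneg_left ih2 hq0)
      _ = Real.exp (-Y) * (1 + q w * (Real.exp y - 1)) := by ring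
      _ ≤ _ := mul_le_mul_of_nonneg_left h5 hp.le

lemma MGF_pos {ι κ : Type*} (q : ι → ℝ) (S : Finset ι) (β : ℝ) (hβ1 : β ≤ 1)
    (h0 : ∀ w ∈ S, 0 ≤ q w) (h1 : ∀ w ∈ S, q w ≤ 1)
    (J : Finset κ) (N : κ → Finset ι) (d : κ → ℝ) (hd : ∀ j ∈ J, 0 ≤ d j)
    (hs : ∀ w ∈ S, ∑ j ∈ J with w ∈ N j, d j ≤ 2 * β) :
    Ex q S (fun A => Real.exp (∑ j ∈ J, d j * ind (Disjoint A (N j)))) ≤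
      Real.exp (∑ j ∈ J, d j * Real.exp (-((1 - β) * ∑ w ∈ S with w ∈ N j, q w))) := by
  induction S using Finset.induction_on generalizing d with
  | empty => simp [Ex_empty, ind]
  | insert w S hw ih =>
    have ih1 := ih (fun x hx => h0 x (mem_insert_of_mem hx)) (fun x hx => h1 x (mem_insert_of_mem hx))
      d hd (fun x hx => hs x (mem_insert_of_mem hx))
    have ih2 := ih (fun x hx => h0 x (mem_insert_of_mem hx)) (fun x hx => h1 x (mem_insert_of_mem hx))
      (fun j => d j * (if w ∈ N j then 0 else 1)) (fun j hj => mul_nonneg (hd j hj) (by split_ifs <;> norm_num))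
      (fun x hx => le_trans (Finset.sum_le_sum fun j hj => by
        have := hd j (mem_filter.1 hj).1
        split_ifs <;> nlinarith) (hs x (mem_insert_of_mem hx)))
    rw [Ex_insert q S w hw]
    have hq0 := h0 w (mem_insert_self _ _)
    have hq1 := h1 w (mem_insert_self _ _)
    simp only [ind_insert, ← mul_assoc]
    set π : κ → ℝ := fun j => Real.exp (-((1 - β) * ∑ w ∈ S with w ∈ N j, q w)) with hπ
    have hπ0 : ∀ j, 0 ≤ π j := fun j => (Real.exp_pos _).le
    have hπ1 : ∀ j, π j ≤ 1 := fun j => Real.exp_le_one_iff.2 (by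
      have : 0 ≤ ∑ w ∈ S with w ∈ N j, q w := Finset.sum_nonneg fun x hx =>
        h0 x (mem_insert_of_mem (mem_filter.1 hx).1)
      nlinarith)
    set y := ∑ j ∈ J with w ∈ N j, d j * π j with hy
    have hy0 : 0 ≤ y := Finset.sum_nonneg fun j hj => mul_nonneg (hd j (mem_filter.1 hj).1) (hπ0 j)
    have hyβ : y ≤ 2 * β := le_trans (Finset.sum_le_sum fun j hj => by
      have := hd j (mem_filter.1 hj).1; nlinarith [hπ1 j]) (hs w (mem_insert_self _ _))
    have e1 : ∑ j ∈ J, d j * (if w ∈ N j then 0 else 1) * π j = ∑ j ∈ J, d j * π j - y := by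
      rw [hy, Finset.sum_filter, ← Finset.sum_sub_distrib]
      refine Finset.sum_congr rfl fun j _ => ?_
      split_ifs <;> ring
    have e2 : ∑ j ∈ J, d j * Real.exp (-((1 - β) * ∑ x ∈ insert w S with x ∈ N j, q x)) =
        ∑ j ∈ J, d j * π j - (1 - Real.exp (-((1 - β) * q w))) * y := by
      rw [hy, Finset.sum_filter, Finset.mul_sum, ← Finset.sum_sub_distrib]
      refine Finset.sum_congr rfl fun j _ => ?_
      rw [Finset.filter_insert]
      split_ifs with h
      · rw [Finset.sum_insert (by simp [hw])]; simp only [hπ]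
        rw [mul_add, neg_add, Real.exp_add]; ring
      · simp only [hπ]; ring
    rw [e2]
    rw [e1] at ih2
    set Y := ∑ j ∈ J, d j * π j
    have e3 : Real.exp (Y - y) = Real.exp Y * Real.exp (-y) := by rw [← Real.exp_add]; ring_nf
    have e4 : Real.exp (Y - (1 - Real.exp (-((1 - β) * q w))) * y) =
        Real.exp Y * Real.exp (-(1 - Real.exp (-((1 - β) * q w))) * y) := by
      rw [← Real.exp_add]; ring_nf
    rw [e3] at ih2
    rw [e4]
    have h5 : 1 + q w * (Real.exp (-y) - 1) ≤ Real.exp (-(1 - Real.exp (-((1 - β) * q w))) * y) := by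
      have a1 := exp_neg_quad hy0
      have a2 := Real.add_one_le_exp (q w * (Real.exp (-y) - 1))
      have a3 : q w * (Real.exp (-y) - 1) ≤ q w * (-y * (1 - β)) := by
        apply mul_le_mul_of_nonneg_left _ hq0; nlinarith
      have a4 := Real.add_one_le_exp (-((1 - β) * q w))
      have a5 : q w * (-y * (1 - β)) ≤ -(1 - Real.exp (-((1 - β) * q w))) * y := by nlinarith
      have a6 := Real.exp_le_exp.2 (a3.trans a5)
      linarith
    have hp := Real.exp_pos Y
    calc _ ≤ (1 - q w) * Real.exp Y + q w * (Real.exp Y * Real.exp (-y)) := by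
          refine add_le_add (mul_le_mul_of_nonneg_left ih1 (by linarith)) (mul_le_mul_of_nonneg_left ih2 hq0)
      _ = Real.exp Y * (1 + q w * (Real.exp (-y) - 1)) := by ring
      _ ≤ _ := mul_le_mul_of_nonneg_left h5 hp.le

lemma MGF_lin {ι : Type*} (q : ι → ℝ) (S : Finset ι) (h0 : ∀ w ∈ S, 0 ≤ q w)
    (h1 : ∀ w ∈ S, q w ≤ 1)
    (g : ι → ℝ) (hg0 : ∀ w ∈ S, 0 ≤ g w) (hg1 : ∀ w ∈ S, g w ≤ 1) :
    Ex q S (fun A => Real.exp (∑ w ∈ A, g w)) ≤ Real.exp (2 * ∑ w ∈ S, q w * g w) := by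
  induction S using Finset.induction_on with
  | empty => simp [Ex_empty]
  | insert w S hw ih =>
    have ih1 := ih (fun x hx => h0 x (mem_insert_of_mem hx)) (fun x hx => h1 x (mem_insert_of_mem hx))
      (fun x hx => hg0 x (mem_insert_of_mem hx)) (fun x hx => hg1 x (mem_insert_of_mem hx))
    rw [Ex_insert q S w hw, Finset.sum_insert hw, mul_add, Real.exp_add]
    have hq0 := h0 w (mem_insert_self _ _)
    have hq1 := h1 w (mem_insert_self _ _)
    have a0 := hg0 w (mem_insert_self _ _)
    have a1 := hg1 w (mem_insert_self _ _)
    have e : Ex q S (fun A => Real.exp (∑ x ∈ insert w A, g x)) ≤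
        Real.exp (g w) * Ex q S (fun A => Real.exp (∑ x ∈ A, g x)) := by
      rw [← Ex_mul]
      refine Ex_mono q S _ _ (fun x hx => h0 x (mem_insert_of_mem hx))
        (fun x hx => h1 x (mem_insert_of_mem hx)) fun A hA => ?_
      rw [Finset.sum_insert (fun h => hw (hA h)), Real.exp_add]
    set I := Ex q S (fun A => Real.exp (∑ x ∈ A, g x))
    have hI : 0 ≤ I := Ex_nonneg q S _ (fun x hx => h0 x (mem_insert_of_mem hx))
        (fun x hx => h1 x (mem_insert_of_mem hx)) fun A hA => (Real.exp_pos _).le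
    have h5 : 1 + q w * (Real.exp (g w) - 1) ≤ Real.exp (2 * (q w * g w)) := by
      have b1 := exp_quad a0 a1
      have b2 := Real.add_one_le_exp (2 * (q w * g w))
      have : q w * (Real.exp (g w) - 1) ≤ q w * (2 * g w) := by
        apply mul_le_mul_of_nonneg_left _ hq0; nlinarith
      linarith
    calc _ ≤ (1 - q w) * I + q w * (Real.exp (g w) * I) := by gcongr
      _ = (1 + q w * (Real.exp (g w) - 1)) * I := by ring
      _ ≤ Real.exp (2 * (q w * g w)) * Real.exp (2 * ∑ x ∈ S, q x * g x) :=
        mul_le_mul h5 ih1 hI (Real.exp_pos _).le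

lemma exp_four {a b c d : ℝ} (h : a + d ≤ b + c) (hab : a ≤ b) (hdb : d ≤ b) :
    Real.exp a + Real.exp d ≤ Real.exp b + Real.exp c := by
  have h1 : Real.exp (a + d - b) ≤ Real.exp c := Real.exp_le_exp.2 (by linarith)
  have h2 : Real.exp (a + d - b) * Real.exp b = Real.exp a * Real.exp d := by
    rw [← Real.exp_add, ← Real.exp_add]; ring_nf
  have ha := Real.exp_le_exp.2 hab
  have hd := Real.exp_le_exp.2 hdb
  have hb := Real.exp_pos b
  have h3 : 0 ≤ (Real.exp b - Real.exp a) * (Real.exp b - Real.exp d) :=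
    mul_nonneg (by linarith) (by linarith)
  have h4 : (Real.exp a + Real.exp d) * Real.exp b ≤ (Real.exp b + Real.exp c) * Real.exp b := by
    nlinarith
  exact le_of_mul_le_mul_right h4 hb

lemma decouple {ι : Type*} (q : ι → ℝ) (S : Finset ι) (h0 : ∀ w ∈ S, 0 ≤ q w)
    (h1 : ∀ w ∈ S, q w ≤ 1) (f : Finset ι → Finset ι → ℝ)
    (hf : ∀ w A A', f A A' + f (insert w A) (insert w A') ≤ f A (insert w A') + f (insert w A) A')
    (hf1 : ∀ w A A', f A A' ≤ f A (insert w A'))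
    (hf2 : ∀ w A A', f (insert w A) A' ≤ f A A') :
    Ex q S (fun A => Real.exp (f A A)) ≤ Ex q S (fun A' => Ex q S (fun A => Real.exp (f A A'))) := by
  induction S using Finset.induction_on generalizing f with
  | empty => simp [Ex_empty]
  | insert w S hw ih =>
    have k0 : ∀ w ∈ S, 0 ≤ q w := fun x hx => h0 x (mem_insert_of_mem hx)
    have k1 : ∀ w ∈ S, q w ≤ 1 := fun x hx => h1 x (mem_insert_of_mem hx)
    have ih1 := ih k0 k1 f hf hf1 hf2
    have ih2 := ih k0 k1 (fun A A' => f (insert w A) (insert w A'))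
      (fun x A A' => by
        simp only [Finset.insert_comm w x]; exact hf x _ _)
      (fun x A A' => by simp only [Finset.insert_comm w x]; exact hf1 x _ _)
      (fun x A A' => by simp only [Finset.insert_comm w x]; exact hf2 x _ _)
    have hq0 := h0 w (mem_insert_self _ _)
    have hq1 := h1 w (mem_insert_self _ _)
    simp only [Ex_insert q S w hw, Ex_add, Ex_mul]
    set F00 := Ex q S (fun A' => Ex q S (fun A => Real.exp (f A A')))
    set F11 := Ex q S (fun A' => Ex q S (fun A => Real.exp (f (insert w A) (insert w A'))))
    set F01 := Ex q S (fun A' => Ex q S (fun A => Real.exp (f A (insert w A'))))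
    set F10 := Ex q S (fun A' => Ex q S (fun A => Real.exp (f (insert w A) A')))
    have h4 : F00 + F11 ≤ F01 + F10 := by
      simp only [F00, F11, F01, F10, ← Ex_add]
      refine Ex_mono q S _ _ k0 k1 fun A' _ => Ex_mono q S _ _ k0 k1 fun A _ => ?_
      exact exp_four (hf w A A') (hf1 w A A') (hf2 w A _)
    have h6 : 0 ≤ q w * (1 - q w) := mul_nonneg hq0 (by linarith)
    nlinarith [mul_le_mul_of_nonneg_left ih1 (sub_nonneg.2 hq1), mul_le_mul_of_nonneg_left ih2 hq0,
      mul_le_mul_of_nonneg_left h4 h6]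

/-- Markov with exponentials. -/
lemma Ex_markov {ι : Type*} (q : ι → ℝ) (S : Finset ι) (h0 : ∀ w ∈ S, 0 ≤ q w)
    (h1 : ∀ w ∈ S, q w ≤ 1) (E : Finset ι → Prop) (f : Finset ι → ℝ) (m t : ℝ)
    (hE : ∀ A ⊆ S, E A → m + t ≤ f A)
    (hf : Ex q S (fun A => Real.exp (f A)) ≤ Real.exp m) :
    Ex q S (fun A => ind (E A)) ≤ Real.exp (-t) := by
  have := Ex_mono q S (fun A => ind (E A)) (fun A => Real.exp (-(m + t)) * Real.exp (f A)) h0 h1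
    fun A hA => by
      by_cases h : E A
      · rw [ind_true h, ← Real.exp_add]
        exact Real.one_le_exp (by linarith [hE A hA h])
      · rw [ind_false h]; positivity
  rw [Ex_mul] at this
  refine this.trans ((mul_le_mul_of_nonneg_left hf (Real.exp_pos _).le).trans ?_)
  rw [← Real.exp_add]; apply Real.exp_le_exp.2; linarith


def Nb {C : Type} [Fintype C] (H : SimpleGraph C) (c : C) : Finset C := univ.filter fun c' => H.Adj c c'
def Ls {V C : Type} [Fintype C] (o : C → V) (v : V) : Finset C := univ.filter fun c => o c = v
def sm {C : Type} [Fintype C] (H : SimpleGraph C) (r : C → ℝ) (c : C) : ℝ := ∑ c' ∈ Nb H c, r c'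

lemma mem_Nb {C : Type} [Fintype C] {H : SimpleGraph C} {c c' : C} : c' ∈ Nb H c ↔ H.Adj c c' := by
  simp [Nb]
lemma mem_Ls {V C : Type} [Fintype C] {o : C → V} {v : V} {c : C} : c ∈ Ls o v ↔ o c = v := by
  simp [Ls]

structure Env {V C : Type} [Fintype V] [Fintype C] (o : C → V) (H : SimpleGraph C)
    (ℓ D k : ℝ) : Prop where
  mat : ∀ c c1 c2, H.Adj c c1 → H.Adj c c2 → o c1 = o c2 → c1 = c2
  own : ∀ c c', H.Adj c c' → o c ≠ o c'
  lst : ∀ v, ((Ls o v).card : ℝ) = ℓ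
  deg : ∀ c, ((Nb H c).card : ℝ) ≤ D
  l1 : 1 ≤ ℓ
  lD : ℓ ≤ D
  spa : ∀ c, ∑ c' ∈ Nb H c, ((Nb H c ∩ Nb H c').card : ℝ) ≤ 2 * k

lemma sm_nonneg {C : Type} [Fintype C] (H : SimpleGraph C) (r : C → ℝ) (h : ∀ c, 0 ≤ r c) (c : C) :
    0 ≤ sm H r c := Finset.sum_nonneg fun _ _ => h _

lemma sum_subsing {C : Type*} (s : Finset C) (f : C → ℝ) (B : ℝ) (hB : 0 ≤ B)
    (hf : ∀ c ∈ s, f c ≤ B) (hs : ∀ a ∈ s, ∀ b ∈ s, a = b) : ∑ c ∈ s, f c ≤ B := by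
  rcases s.eq_empty_or_nonempty with h | ⟨a, ha⟩
  · simp [h, hB]
  · have : s = {a} := by
      ext x; simp only [mem_singleton]; exact ⟨fun hx => hs x hx a ha, fun h => h ▸ ha⟩
    rw [this, sum_singleton]; exact hf a ha

lemma one_sub_exp {q β : ℝ} (hq0 : 0 ≤ q) (hβ0 : 0 ≤ β) (hβ1 : β ≤ 1) (hq : 6 * q ≤ β) :
    Real.exp (-((1 + 2 * β) * q)) ≤ 1 - (1 + β) * q := by
  set u := (1 + β) * q with hu
  have hu1 : u ≤ 1 / 2 := by nlinarith
  have h2 : 0 < 1 - u := by linarith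
  have h3 : u / (1 - u) ≤ (1 + 2 * β) * q := by
    rw [div_le_iff₀ h2, hu]
    have : 0 ≤ q * (β - (1 + 2 * β) * (1 + β) * q) := by
      apply mul_nonneg hq0
      nlinarith [mul_nonneg hβ0 hq0, mul_nonneg hβ0 (mul_nonneg hβ0 hq0)]
    nlinarith
  have h4 : Real.exp (-(u / (1 - u))) ≤ 1 - u := by
    rw [Real.exp_neg, inv_le_comm₀ (Real.exp_pos _) h2]
    have := Real.add_one_le_exp (u / (1 - u))
    have h5 : (1 - u)⁻¹ = u / (1 - u) + 1 := by field_simp; ring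
    rw [h5]; exact this
  exact (Real.exp_le_exp.2 (by linarith)).trans h4

/-- standing assumptions on the truncated weights -/
structure Wt {V C : Type} [Fintype V] [Fintype C] (o : C → V) (H : SimpleGraph C)
    (r : C → ℝ) (η β ph Λ e P : ℝ) : Prop where
  r0 : ∀ c, 0 ≤ r c
  aph : ∀ c, r c * Real.exp (η * sm H r c) ≤ ph
  rs : ∀ c, r c ≠ 0 → η * sm H r c ≤ Λ
  he : ∀ v, ∑ c ∈ Ls o v, r c * sm H r c ≤ e
  hP : ∀ v, ∑ c ∈ Ls o v, r c ≤ P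
  η0 : 0 < η
  η1 : η ≤ 1
  β0 : 0 < β
  β1 : β ≤ 1
  ph0 : 0 < ph
  ηβ : 6 * (η * ph) ≤ β
  Λ0 : 0 < Λ
  βΛ : 2 * (β * Λ) ≤ 1
  e0 : 0 ≤ e
  P0 : 0 ≤ P

section
variable {V C : Type} [Fintype V] [Fintype C] {o : C → V} {H : SimpleGraph C} {ℓ D k : ℝ}
  {r : C → ℝ} {η β ph Λ e P : ℝ}

def spt (r : C → ℝ) : Finset C := univ.filter fun c => r c ≠ 0

lemma mem_spt {c : C} : c ∈ spt r ↔ r c ≠ 0 := by simp [spt]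

lemma Wt.rph (w : Wt o H r η β ph Λ e P) (c : C) : r c ≤ ph := by
  refine le_trans ?_ (w.aph c)
  have := Real.one_le_exp (mul_nonneg w.η0.le (sm_nonneg H r w.r0 c))
  nlinarith [w.r0 c]

lemma Wt.q0 (w : Wt o H r η β ph Λ e P) (c : C) : 0 ≤ η * r c := mul_nonneg w.η0.le (w.r0 c)
lemma Wt.q6 (w : Wt o H r η β ph Λ e P) (c : C) : 6 * (η * r c) ≤ β :=
  le_trans (by have := w.rph c; have := w.η0; gcongr) w.ηβ
lemma Wt.q1 (w : Wt o H r η β ph Λ e P) (c : C) : η * r c ≤ 1 := by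
  linarith [w.q6 c, w.β1, w.q0 c]

lemma sum_sup (N : Finset C) (f : C → ℝ) (hf : ∀ c, r c = 0 → f c = 0) :
    ∑ w ∈ spt r with w ∈ N, f w = ∑ w ∈ N, f w := by
  have : (spt r).filter (· ∈ N) = N.filter (fun w => r w ≠ 0) := by
    ext x; simp [spt, and_comm]
  rw [this]
  refine Finset.sum_filter_of_ne fun c _ h h2 => h (hf c h2)

/-- L1 -/
lemma L1 (E : Env o H ℓ D k) (w : Wt o H r η β ph Λ e P) (v : V) (g : C → ℝ)
    (hg : ∀ c, r c ≠ 0 → 0 ≤ g c ∧ g c ≤ 1) (t : ℝ) :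
    Ex (fun c => η * r c) (spt r) (fun A => ind (∑ c ∈ Ls o v,
      (r c * Real.exp (η * sm H r c)) * g c * ind (Disjoint A (Nb H c)) ≤
        ∑ c ∈ Ls o v, r c * g c - 2 * β * η * e - t)) ≤ Real.exp (-(β / ph * t)) := by
  have hβ := w.β0
  have hph := w.ph0
  have hη := w.η0
  set lam := β / ph with hlam
  have hl : 0 < lam := div_pos hβ hph
  set a : C → ℝ := fun c => r c * Real.exp (η * sm H r c) with ha
  have ha0 : ∀ c, 0 ≤ a c := fun c => mul_nonneg (w.r0 c) (Real.exp_pos _).le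
  have hag0 : ∀ c, 0 ≤ a c * g c := fun c => by
    by_cases h : r c = 0
    · simp [ha, h]
    · exact mul_nonneg (ha0 c) (hg c h).1
  have hag1 : ∀ c, a c * g c ≤ ph := fun c => by
    by_cases h : r c = 0
    · simp [ha, h, hph.le]
    · have := w.aph c; have := (hg c h).2; have := (hg c h).1; have := ha0 c
      exact (mul_le_of_le_one_right (ha0 c) (hg c h).2).trans (w.aph c)
  have M := MGF_neg (fun c => η * r c) (spt r) β hβ.le w.β1 (fun c _ => w.q0 c)
    (fun c _ => by nlinarith [w.q6 c, w.q0 c, w.β1]) (Ls o v) (Nb H) (fun c => lam * (a c * g c))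
    (fun c _ => mul_nonneg hl.le (hag0 c)) (fun x _ => by
      rw [← Finset.mul_sum]
      have : ∑ c ∈ Ls o v with x ∈ Nb H c, a c * g c ≤ ph := by
        refine sum_subsing _ _ _ hph.le (fun c _ => hag1 c) ?_
        intro c hc c' hc'
        simp only [mem_filter, mem_Ls, mem_Nb] at hc hc'
        exact E.mat x c c' hc.2.symm hc'.2.symm (hc.1.trans hc'.1.symm)
      calc lam * _ ≤ lam * ph := by gcongr
        _ = β := by rw [hlam]; field_simp)
  refine Ex_markov _ _ (fun c _ => w.q0 c) (fun c _ => w.q1 c) _ _ _ _ ?_ M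
  intro A hA hE
  have key : ∑ c ∈ Ls o v, r c * g c - 2 * β * η * e ≤ 
      ∑ c ∈ Ls o v, a c * g c * ∏ x ∈ spt r with x ∈ Nb H c, (1 - (1 + β) * (η * r x)) := by
    have h1 : ∀ c ∈ Ls o v, r c * g c - 2 * β * η * (r c * sm H r c) ≤
        a c * g c * ∏ x ∈ spt r with x ∈ Nb H c, (1 - (1 + β) * (η * r x)) := by
      intro c _
      by_cases h : r c = 0
      · simp [ha, h]
      have h2 : Real.exp (-((1 + 2 * β) * (η * sm H r c))) ≤
          ∏ x ∈ spt r with x ∈ Nb H c, (1 - (1 + β) * (η * r x)) := by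
        have : -((1 + 2 * β) * (η * sm H r c)) =
            ∑ x ∈ spt r with x ∈ Nb H c, -((1 + 2 * β) * (η * r x)) := by
          rw [sum_sup _ _ (fun c hc => by simp [hc]), sm, Finset.sum_neg_distrib, Finset.mul_sum,
            Finset.mul_sum]
        rw [this, Real.exp_sum]
        exact Finset.prod_le_prod (fun _ _ => (Real.exp_pos _).le) fun x _ =>
          one_sub_exp (w.q0 x) hβ.le w.β1 (w.q6 x)
      refine le_trans ?_ (mul_le_mul_of_nonneg_left h2 (hag0 c))
      have h3 : a c * g c * Real.exp (-((1 + 2 * β) * (η * sm H r c))) =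
          r c * g c * Real.exp (-(2 * β * (η * sm H r c))) := by
        have : Real.exp (-(2 * β * (η * sm H r c))) =
            Real.exp (η * sm H r c) * Real.exp (-((1 + 2 * β) * (η * sm H r c))) := by
          rw [← Real.exp_add]; ring_nf
        rw [this, ha]; ring
      rw [h3]
      have h4 := Real.add_one_le_exp (-(2 * β * (η * sm H r c)))
      have h5 := hg c h
      have h6 := w.r0 c
      have h7 := sm_nonneg H r w.r0 c
      have h8 : 0 ≤ 2 * β * (η * sm H r c) := by positivity
      have h9 : r c * g c * (1 - 2 * β * (η * sm H r c)) ≤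
        r c * g c * Real.exp (-(2 * β * (η * sm H r c))) :=
        mul_le_mul_of_nonneg_left (by linarith) (mul_nonneg h6 h5.1)
      refine le_trans ?_ h9
      have h10 : r c * g c ≤ r c := mul_le_of_le_one_right h6 h5.2
      nlinarith [mul_le_mul_of_nonneg_right h10 h8]
    have h2 := Finset.sum_le_sum h1
    rw [Finset.sum_sub_distrib, ← Finset.mul_sum] at h2
    have := w.he v
    have h3 : 2 * β * η * ∑ c ∈ Ls o v, r c * sm H r c ≤ 2 * β * η * e := by gcongr
    linarith
  have e1 : ∀ F : C → ℝ, ∑ c ∈ Ls o v, lam * (a c * g c) * F c = lam * ∑ c ∈ Ls o v, a c * g c * F c := by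
    intro F; rw [Finset.mul_sum]; exact Finset.sum_congr rfl fun _ _ => by ring
  rw [e1, e1]
  nlinarith [mul_le_mul_of_nonneg_left key hl.le, mul_le_mul_of_nonneg_left hE hl.le]

lemma exp_le_one_add_two {x : ℝ} (h0 : 0 ≤ x) (h1 : x ≤ 1) : Real.exp x ≤ 1 + 2 * x := by
  have := exp_quad h0 h1; nlinarith

/-- L3 -/
lemma L3 (E : Env o H ℓ D k) (w : Wt o H r η β ph Λ e P) (v : V) (t : ℝ) :
    Ex (fun c => η * r c) (spt r) (fun A => ind (P + 2 * β * η * e + t ≤ ∑ c ∈ Ls o v,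
      (r c * Real.exp (η * sm H r c)) * ind (Disjoint A (Nb H c)))) ≤ Real.exp (-(β / ph * t)) := by
  have hβ := w.β0
  have hph := w.ph0
  have hη := w.η0
  set lam := β / ph with hlam
  have hl : 0 < lam := div_pos hβ hph
  set a : C → ℝ := fun c => r c * Real.exp (η * sm H r c) with ha
  have ha0 : ∀ c, 0 ≤ a c := fun c => mul_nonneg (w.r0 c) (Real.exp_pos _).le
  have M := MGF_pos (fun c => η * r c) (spt r) β w.β1 (fun c _ => w.q0 c)
    (fun c _ => w.q1 c) (Ls o v) (Nb H) (fun c => lam * a c)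
    (fun c _ => mul_nonneg hl.le (ha0 c)) (fun x _ => by
      rw [← Finset.mul_sum]
      have : ∑ c ∈ Ls o v with x ∈ Nb H c, a c ≤ ph := by
        refine sum_subsing _ _ _ hph.le (fun c _ => w.aph c) ?_
        intro c hc c' hc'
        simp only [mem_filter, mem_Ls, mem_Nb] at hc hc'
        exact E.mat x c c' hc.2.symm hc'.2.symm (hc.1.trans hc'.1.symm)
      calc lam * _ ≤ lam * ph := by gcongr
        _ = β := by rw [hlam]; field_simp
        _ ≤ 2 * β := by linarith)
  refine Ex_markov _ _ (fun c _ => w.q0 c) (fun c _ => w.q1 c) _ _ _ _ ?_ M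
  intro A hA hE
  have key : ∑ c ∈ Ls o v, a c * Real.exp (-((1 - β) * ∑ x ∈ spt r with x ∈ Nb H c, η * r x))
      ≤ P + 2 * β * η * e := by
    have h1 : ∀ c ∈ Ls o v, a c * Real.exp (-((1 - β) * ∑ x ∈ spt r with x ∈ Nb H c, η * r x)) ≤
        r c + 2 * β * η * (r c * sm H r c) := by
      intro c _
      by_cases h : r c = 0
      · simp [ha, h]
      rw [sum_sup _ _ (fun c hc => by simp [hc]), ← Finset.mul_sum]
      change a c * Real.exp (-((1 - β) * (η * sm H r c))) ≤ _
      have h3 : a c * Real.exp (-((1 - β) * (η * sm H r c))) =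
          r c * Real.exp (β * (η * sm H r c)) := by
        rw [ha]; dsimp only; rw [mul_assoc, ← Real.exp_add]; ring_nf
      rw [h3]
      have h6 := w.r0 c
      have h7 := sm_nonneg H r w.r0 c
      have h8 := w.rs c h
      have h4 := exp_le_one_add_two (x := β * (η * sm H r c)) (by positivity) (by nlinarith [w.βΛ, w.Λ0])
      nlinarith
    have h2 := Finset.sum_le_sum h1
    rw [Finset.sum_add_distrib, ← Finset.mul_sum] at h2
    have := w.he v
    have h3 : 2 * β * η * ∑ c ∈ Ls o v, r c * sm H r c ≤ 2 * β * η * e := by gcongr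
    linarith [w.hP v]
  have e1 : ∀ F : C → ℝ, ∑ c ∈ Ls o v, lam * a c * F c = lam * ∑ c ∈ Ls o v, a c * F c := by
    intro F; rw [Finset.mul_sum]; exact Finset.sum_congr rfl fun _ _ => by ring
  rw [e1, e1]
  nlinarith [mul_le_mul_of_nonneg_left key hl.le, mul_le_mul_of_nonneg_left hE hl.le]
end


section
variable {V C : Type} [Fintype V] [Fintype C] {o : C → V} {H : SimpleGraph C} {ℓ D k : ℝ}
  {r : C → ℝ} {η β ph Λ e P : ℝ}

def Jp (o : C → V) (H : SimpleGraph C) (v : V) : Finset (C × C) :=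
  univ.filter fun j => o j.1 = v ∧ H.Adj j.1 j.2

def alive (o : C → V) (H : SimpleGraph C) (u : V) (A : Finset C) : Finset C :=
  (Ls o u).filter fun c => Disjoint A (Nb H c)

def NJ (o : C → V) (H : SimpleGraph C) (A : Finset C) (j : C × C) : Finset C :=
  Nb H j.1 ∪ Nb H j.2 ∪ alive o H (o j.2) A

lemma mem_Jp {v : V} {j : C × C} : j ∈ Jp o H v ↔ o j.1 = v ∧ H.Adj j.1 j.2 := by simp [Jp]

lemma sumJ (v : V) (F : C → C → ℝ) :
    ∑ j ∈ Jp o H v, F j.1 j.2 = ∑ c ∈ Ls o v, ∑ c' ∈ Nb H c, F c c' := by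
  unfold Jp Ls Nb
  rw [Finset.sum_filter, Fintype.sum_prod_type, Finset.sum_filter]
  refine Finset.sum_congr rfl fun c _ => ?_
  by_cases h : o c = v
  · simp only [h, true_and, if_true]; rw [Finset.sum_filter]
  · simp [h]

lemma alive_mono (u : V) {A B : Finset C} (h : A ⊆ B) : alive o H u B ⊆ alive o H u A := by
  intro c hc
  simp only [alive, mem_filter] at hc ⊢
  exact ⟨hc.1, Finset.disjoint_of_subset_left h hc.2⟩

lemma NJ_mono {A B : Finset C} (h : A ⊆ B) (j : C × C) : NJ o H B j ⊆ NJ o H A j :=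
  Finset.union_subset_union_right (alive_mono _ h)

lemma dec_sub (j : C × C) (w : C) (A A' : Finset C) :
    ind (Disjoint A (NJ o H A' j)) + ind (Disjoint (insert w A) (NJ o H (insert w A') j)) ≤
    ind (Disjoint A (NJ o H (insert w A') j)) + ind (Disjoint (insert w A) (NJ o H A' j)) := by
  have h1 : Disjoint A (NJ o H A' j) → Disjoint A (NJ o H (insert w A') j) :=
    fun h => Finset.disjoint_of_subset_right (NJ_mono (Finset.subset_insert _ _) j) h
  have h2 : Disjoint (insert w A) (NJ o H (insert w A') j) → Disjoint A (NJ o H (insert w A') j) :=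
    fun h => Finset.disjoint_of_subset_left (Finset.subset_insert _ _) h
  have h3 : Disjoint A (NJ o H A' j) → Disjoint (insert w A) (NJ o H (insert w A') j) →
      Disjoint (insert w A) (NJ o H A' j) := by
    intro a b
    rw [Finset.disjoint_insert_left] at b ⊢
    refine ⟨fun hw => b.1 ?_, a⟩
    simp only [NJ, mem_union, alive, mem_filter] at hw ⊢
    rcases hw with hw | hw
    · exact Or.inl hw
    · refine Or.inr ⟨hw.1, ?_⟩
      rw [Finset.disjoint_insert_left]
      exact ⟨by simp [mem_Nb], hw.2⟩
  by_cases a : Disjoint A (NJ o H A' j)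
  · by_cases b : Disjoint (insert w A) (NJ o H (insert w A') j)
    · rw [ind_true a, ind_true b, ind_true (h1 a), ind_true (h3 a b)]
    · rw [ind_true a, ind_false b, ind_true (h1 a)]
      linarith [ind_nonneg (Disjoint (insert w A) (NJ o H A' j))]
  · rw [ind_false a]
    have := ind_mono h2
    linarith [ind_nonneg (Disjoint (insert w A) (NJ o H A' j))]

lemma loadJ (E : Env o H ℓ D k) (v : V) (A' : Finset C) (x : C) (b : C × C → ℝ) (B : ℝ) (hB : 0 ≤ B)
    (hb : ∀ j, b j ≤ B) :
    ∑ j ∈ Jp o H v with x ∈ NJ o H A' j, b j ≤ 3 * D * B := by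
  set A1 := (Jp o H v).filter fun j => x ∈ Nb H j.1
  set A2 := (Jp o H v).filter fun j => x ∈ Nb H j.2
  set A3 := (Jp o H v).filter fun j => o j.2 = o x
  have hsub : (Jp o H v).filter (fun j => x ∈ NJ o H A' j) ⊆ A1 ∪ A2 ∪ A3 := by
    intro j hj
    simp only [A1, A2, A3, mem_union, mem_filter, NJ, alive, mem_Ls] at hj ⊢
    rcases hj with ⟨h, (h1 | h1) | h1⟩
    · exact Or.inl (Or.inl ⟨h, h1⟩)
    · exact Or.inl (Or.inr ⟨h, h1⟩)
    · exact Or.inr ⟨h, h1.1.symm⟩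
  have c1 : (A1.card : ℝ) ≤ D := by
    rcases A1.eq_empty_or_nonempty with h | ⟨j0, hj0⟩
    · rw [h]; simp; linarith [E.l1, E.lD]
    · refine le_trans ?_ (E.deg j0.1)
      have hj : ∀ j ∈ A1, j.1 = j0.1 := by
        intro j hj
        simp only [A1, mem_filter, mem_Jp, mem_Nb] at hj hj0
        exact E.mat x _ _ hj.2.symm hj0.2.symm (hj.1.1.trans hj0.1.1.symm)
      norm_cast
      refine Finset.card_le_card_of_injOn (fun j => j.2) (fun j hj1 => ?_) ?_
      · have h2 := hj j hj1
        have h3 : j ∈ A1 := hj1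
        simp only [A1, mem_filter, mem_Jp, mem_Nb] at h3
        show j.2 ∈ (Nb H j0.1 : Set C)
        rw [Finset.mem_coe, mem_Nb, ← h2]; exact h3.1.2
      · intro j hj1 j' hj2 h
        exact Prod.ext ((hj j hj1).trans (hj j' hj2).symm) h
  have c2 : (A2.card : ℝ) ≤ D := by
    refine le_trans ?_ (E.deg x)
    norm_cast
    refine Finset.card_le_card_of_injOn (fun j => j.2) (fun j hj1 => ?_) ?_
    · have h3 : j ∈ A2 := hj1
      simp only [A2, mem_filter, mem_Jp, mem_Nb] at h3
      show j.2 ∈ (Nb H x : Set C)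
      rw [Finset.mem_coe, mem_Nb]; exact h3.2.symm
    · intro j hj1 j' hj2 h
      have h3 : j ∈ A2 := hj1
      have h4 : j' ∈ A2 := hj2
      simp only [A2, mem_filter, mem_Jp, mem_Nb] at h3 h4
      simp only at h
      refine Prod.ext (E.mat j.2 _ _ h3.1.2.symm ?_ (h3.1.1.trans h4.1.1.symm)) h
      rw [h]; exact h4.1.2.symm
  have c3 : (A3.card : ℝ) ≤ D := by
    refine le_trans ?_ (le_trans (E.lst v).le E.lD)
    norm_cast
    refine Finset.card_le_card_of_injOn (fun j => j.1) (fun j hj1 => ?_) ?_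
    · have h3 : j ∈ A3 := hj1
      simp only [A3, mem_filter, mem_Jp, mem_Nb] at h3
      show j.1 ∈ (Ls o v : Set C)
      rw [Finset.mem_coe, mem_Ls]; exact h3.1.1
    · intro j hj1 j' hj2 h
      have h3 : j ∈ A3 := hj1
      have h4 : j' ∈ A3 := hj2
      simp only [A3, mem_filter, mem_Jp, mem_Nb] at h3 h4
      simp only at h
      refine Prod.ext h (E.mat j.1 _ _ h3.1.2 ?_ (h3.2.trans h4.2.symm))
      rw [h]; exact h4.1.2
  have hc : (((Jp o H v).filter (fun j => x ∈ NJ o H A' j)).card : ℝ) ≤ 3 * D := by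
    have h1 : ((Jp o H v).filter (fun j => x ∈ NJ o H A' j)).card ≤ A1.card + A2.card + A3.card :=
      (Finset.card_le_card hsub).trans ((Finset.card_union_le _ _).trans
        (Nat.add_le_add_right (Finset.card_union_le _ _) _))
    have h2 : (((Jp o H v).filter (fun j => x ∈ NJ o H A' j)).card : ℝ) ≤ A1.card + A2.card + A3.card := by
      exact_mod_cast h1
    linarith
  have := Finset.sum_le_card_nsmul ((Jp o H v).filter (fun j => x ∈ NJ o H A' j)) b B (fun j _ => hb j)
  rw [nsmul_eq_mul] at this
  exact this.trans (mul_le_mul_of_nonneg_right hc hB)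

def rho (o : C → V) (H : SimpleGraph C) (r : C → ℝ) (w : C) (u : V) : ℝ :=
  ∑ c ∈ Nb H w with o c = u, r c

lemma rho_nonneg (h : ∀ c, 0 ≤ r c) (w : C) (u : V) : 0 ≤ rho o H r w u :=
  Finset.sum_nonneg fun _ _ => h _

/-- (c): lower bound for the total probability in `NJ`. -/
lemma QJ (E : Env o H ℓ D k) (h0 : ∀ c, 0 ≤ r c) (A' : Finset C) (c c' : C) (hcc : H.Adj c c') :
    ∑ x ∈ Nb H c ∪ Nb H c', r x + ∑ x ∈ (alive o H (o c') A').erase c', r x ≤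
      ∑ x ∈ NJ o H A' (c, c'), r x := by
  rw [← Finset.sum_union]
  · refine Finset.sum_le_sum_of_subset_of_nonneg ?_ fun _ _ _ => h0 _
    exact Finset.union_subset_union_right (Finset.erase_subset _ _)
  · rw [Finset.disjoint_left]
    intro x hx hx2
    simp only [mem_union, mem_Nb, mem_erase, alive, mem_filter, mem_Ls] at hx hx2
    rcases hx with h | h
    · exact hx2.1 (E.mat c x c' h hcc hx2.2.1)
    · exact E.own c' x h hx2.2.1.symm

lemma alive_ge (h0 : ∀ c, 0 ≤ r c) (hph : ∀ c, r c ≤ ph) (A' : Finset C) (c' : C) :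
    ∑ x ∈ Ls o (o c'), r x - ∑ w ∈ A', rho o H r w (o c') - ph ≤
      ∑ x ∈ (alive o H (o c') A').erase c', r x := by
  have hsub : Ls o (o c') ⊆ ((alive o H (o c') A').erase c') ∪ {c'} ∪
      A'.biUnion (fun w => (Nb H w).filter fun c => o c = o c') := by
    intro x hx
    simp only [mem_union, mem_erase, alive, mem_filter, mem_singleton, mem_biUnion, mem_Nb]
    rw [mem_Ls] at hx
    by_cases h1 : x = c'
    · simp [h1]
    by_cases h2 : Disjoint A' (Nb H x)
    · left; left; exact ⟨h1, mem_Ls.2 hx, h2⟩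
    · right
      rw [Finset.not_disjoint_iff] at h2
      obtain ⟨w, hw, hw2⟩ := h2
      exact ⟨w, hw, (mem_Nb.1 hw2).symm, hx⟩
  have h1 : ∑ x ∈ Ls o (o c'), r x ≤ ∑ x ∈ ((alive o H (o c') A').erase c') ∪ {c'} ∪
      A'.biUnion (fun w => (Nb H w).filter fun c => o c = o c'), r x :=
    Finset.sum_le_sum_of_subset_of_nonneg hsub fun _ _ _ => h0 _
  have hu : ∀ s t : Finset C, ∑ x ∈ s ∪ t, r x ≤ ∑ x ∈ s, r x + ∑ x ∈ t, r x := by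
    intro s t
    rw [← Finset.sum_union_inter]
    linarith [Finset.sum_nonneg (s := s ∩ t) (f := r) fun x _ => h0 x]
  have hbi : ∀ A : Finset C, ∑ x ∈ A.biUnion (fun w => (Nb H w).filter fun c => o c = o c'), r x ≤
      ∑ w ∈ A, rho o H r w (o c') := by
    intro A
    induction A using Finset.induction_on with
    | empty => simp
    | insert w A hw ih =>
      rw [Finset.biUnion_insert, Finset.sum_insert hw]
      exact (hu _ _).trans (add_le_add le_rfl ih)
  have hbi := hbi A'
  have h2 := hu (((alive o H (o c') A').erase c') ∪ {c'}) (A'.biUnion (fun w => (Nb H w).filter fun c => o c = o c'))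
  have h3 := hu ((alive o H (o c') A').erase c') {c'}
  rw [Finset.sum_singleton] at h3
  linarith [hph c']
end


section
variable {V C : Type} [Fintype V] [Fintype C] {o : C → V} {H : SimpleGraph C} {ℓ D k : ℝ}
  {r : C → ℝ} {η β ph Λ e P : ℝ}

def aw (H : SimpleGraph C) (r : C → ℝ) (η : ℝ) (c : C) : ℝ := r c * Real.exp (η * sm H r c)

def BJ (H : SimpleGraph C) (r : C → ℝ) (η β : ℝ) (j : C × C) : ℝ :=
  aw H r η j.1 * aw H r η j.2 * Real.exp (-((1 - β) * (η * ∑ x ∈ Nb H j.1 ∪ Nb H j.2, r x)))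

lemma Wt.a0 (w : Wt o H r η β ph Λ e P) (c : C) : 0 ≤ aw H r η c :=
  mul_nonneg (w.r0 c) (Real.exp_pos _).le
lemma Wt.aph' (w : Wt o H r η β ph Λ e P) (c : C) : aw H r η c ≤ ph := w.aph c

lemma Wt.BJ0 (w : Wt o H r η β ph Λ e P) (j : C × C) : 0 ≤ BJ H r η β j :=
  mul_nonneg (mul_nonneg (w.a0 _) (w.a0 _)) (Real.exp_pos _).le

lemma Wt.ab_le (w : Wt o H r η β ph Λ e P) (j : C × C) : aw H r η j.1 * aw H r η j.2 ≤ ph ^ 2 := by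
  rw [sq]; exact mul_le_mul (w.aph' _) (w.aph' _) (w.a0 _) w.ph0.le

lemma Wt.BJ_le (w : Wt o H r η β ph Λ e P) (j : C × C) : BJ H r η β j ≤ ph ^ 2 := by
  refine le_trans ?_ (w.ab_le j)
  refine mul_le_of_le_one_right (mul_nonneg (w.a0 _) (w.a0 _)) (Real.exp_le_one_iff.2 ?_)
  have := w.β1
  have := Finset.sum_nonneg (s := Nb H j.1 ∪ Nb H j.2) (f := r) fun x _ => w.r0 x
  have : 0 ≤ (1 - β) * (η * ∑ x ∈ Nb H j.1 ∪ Nb H j.2, r x) :=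
    mul_nonneg (by linarith) (mul_nonneg w.η0.le this)
  linarith

lemma Wt.BJ_le2 (w : Wt o H r η β ph Λ e P) (c c' : C) :
    BJ H r η β (c, c') ≤
      (1 + 4 * (β * Λ)) * (r c * (r c' + η * ph ^ 2 * ((Nb H c ∩ Nb H c').card : ℝ))) := by
  have hη := w.η0
  have hβ := w.β0
  have hΛ := w.Λ0
  have hph := w.ph0
  have hG : 0 ≤ 1 + 4 * (β * Λ) := by positivity
  have hrc := w.r0 c
  have hrc' := w.r0 c'
  have hR : 0 ≤ (1 + 4 * (β * Λ)) * (r c * (r c' + η * ph ^ 2 * ((Nb H c ∩ Nb H c').card : ℝ))) := by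
    positivity
  by_cases h1 : r c = 0
  · simp [BJ, aw, h1]
  by_cases h2 : r c' = 0
  · refine le_trans (le_of_eq ?_) hR
    simp [BJ, aw, h2]
  set x := η * ∑ y ∈ Nb H c ∩ Nb H c', r y with hx
  have hx0 : 0 ≤ x := mul_nonneg hη.le (Finset.sum_nonneg fun y _ => w.r0 y)
  have hx1 : x ≤ η * ph * ((Nb H c ∩ Nb H c').card : ℝ) := by
    rw [hx, mul_assoc]
    refine mul_le_mul_of_nonneg_left ?_ hη.le
    have := Finset.sum_le_card_nsmul (Nb H c ∩ Nb H c') r ph (fun y _ => w.rph y)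
    rw [nsmul_eq_mul] at this; linarith
  have hx2 : x ≤ η * sm H r c' := by
    rw [hx]
    refine mul_le_mul_of_nonneg_left ?_ hη.le
    exact Finset.sum_le_sum_of_subset_of_nonneg Finset.inter_subset_right fun y _ _ => w.r0 y
  have hQ : η * ∑ y ∈ Nb H c ∪ Nb H c', r y = η * sm H r c + η * sm H r c' - x := by
    rw [hx, sm, sm, ← mul_add, ← Finset.sum_union_inter]; ring
  have hs := w.rs c h1
  have hs' := w.rs c' h2
  have e1 : BJ H r η β (c, c') = r c * r c' *
      Real.exp (β * (η * sm H r c + η * sm H r c') + (1 - β) * x) := by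
    unfold BJ aw
    simp only
    rw [hQ]
    have : Real.exp (β * (η * sm H r c + η * sm H r c') + (1 - β) * x) =
      Real.exp (η * sm H r c) * Real.exp (η * sm H r c') *
      Real.exp (-((1 - β) * (η * sm H r c + η * sm H r c' - x))) := by
      rw [← Real.exp_add, ← Real.exp_add]; ring_nf
    rw [this]; ring
  have e2 : Real.exp (β * (η * sm H r c + η * sm H r c') + (1 - β) * x) ≤
      (1 + 4 * (β * Λ)) * Real.exp x := by
    have a1 : Real.exp (β * (η * sm H r c + η * sm H r c') + (1 - β) * x) ≤
        Real.exp (2 * (β * Λ) + x) := Real.exp_le_exp.2 (by nlinarith)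
    have a2 := exp_le_one_add_two (x := 2 * (β * Λ)) (by positivity) w.βΛ
    rw [Real.exp_add (2 * (β * Λ))] at a1
    have := Real.exp_pos x
    nlinarith
  have e3 : r c' * Real.exp x ≤ r c' + η * ph ^ 2 * ((Nb H c ∩ Nb H c').card : ℝ) := by
    have a1 : Real.exp x - 1 ≤ x * Real.exp x := by
      have := Real.add_one_le_exp (-x)
      have h3 : Real.exp (-x) * Real.exp x = 1 := by rw [← Real.exp_add]; simp
      nlinarith [Real.exp_pos x]
    have a2 : r c' * Real.exp x ≤ ph := by
      refine le_trans ?_ (w.aph c')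
      exact mul_le_mul_of_nonneg_left (Real.exp_le_exp.2 hx2) hrc'
    have a3 : r c' * Real.exp x ≤ r c' + x * ph := by nlinarith
    have a4 : x * ph ≤ η * ph * ((Nb H c ∩ Nb H c').card : ℝ) * ph := by gcongr
    nlinarith
  rw [e1]
  calc _ ≤ r c * r c' * ((1 + 4 * (β * Λ)) * Real.exp x) := by gcongr
    _ = (1 + 4 * (β * Λ)) * (r c * (r c' * Real.exp x)) := by ring
    _ ≤ _ := by gcongr

/-- total of `BJ` -/
lemma Wt.BJ_sum (w : Wt o H r η β ph Λ e P) (E : Env o H ℓ D k) (v : V) :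
    ∑ j ∈ Jp o H v, BJ H r η β j ≤ (1 + 4 * (β * Λ)) * (e + 2 * k * η * ph ^ 2 * P) := by
  have hη := w.η0
  have hβ := w.β0
  have hΛ := w.Λ0
  have hph := w.ph0
  have h1 := sumJ (o := o) (H := H) v (fun c c' => BJ H r η β (c, c'))
  simp only [Prod.mk.eta] at h1
  rw [h1]
  calc _ ≤ ∑ c ∈ Ls o v, ∑ c' ∈ Nb H c,
        (1 + 4 * (β * Λ)) * (r c * (r c' + η * ph ^ 2 * ((Nb H c ∩ Nb H c').card : ℝ))) :=
        Finset.sum_le_sum fun c _ => Finset.sum_le_sum fun c' _ => w.BJ_le2 c c'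
    _ = ∑ c ∈ Ls o v, (1 + 4 * (β * Λ)) * (r c * sm H r c + r c * (η * ph ^ 2 *
          ∑ c' ∈ Nb H c, ((Nb H c ∩ Nb H c').card : ℝ))) := by
        refine Finset.sum_congr rfl fun c _ => ?_
        rw [← Finset.mul_sum, ← Finset.mul_sum, Finset.sum_add_distrib, ← Finset.mul_sum, sm, mul_add]
    _ ≤ ∑ c ∈ Ls o v, (1 + 4 * (β * Λ)) * (r c * sm H r c + r c * (η * ph ^ 2 * (2 * k))) := by
        refine Finset.sum_le_sum fun c _ => ?_
        have := E.spa c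
        have := w.r0 c
        gcongr
    _ = (1 + 4 * (β * Λ)) * (∑ c ∈ Ls o v, r c * sm H r c + (∑ c ∈ Ls o v, r c) * (η * ph ^ 2 * (2 * k))) := by
        rw [← Finset.mul_sum, Finset.sum_add_distrib, ← Finset.sum_mul]
    _ ≤ (1 + 4 * (β * Λ)) * (e + P * (η * ph ^ 2 * (2 * k))) := by
        have h3 := w.he v
        have h4 := w.hP v
        have hk : 0 ≤ 2 * k ∨ Ls o v = ∅ := by
          rcases (Ls o v).eq_empty_or_nonempty with h | ⟨c, hc⟩
          · exact Or.inr h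
          · exact Or.inl (le_trans (Finset.sum_nonneg fun _ _ => by positivity) (E.spa c))
        rcases hk with hk | hk
        · gcongr
        · have := E.lst v
          rw [hk] at this
          have := E.l1
          simp at *
          linarith
    _ = _ := by ring

lemma Wt.term_le (w : Wt o H r η β ph Λ e P) (E : Env o H ℓ D k) (ψ1 : ℝ) (hψ0 : 0 ≤ ψ1) (hψ1 : ψ1 ≤ 1)
    (hψ : ∀ c, r c ≠ 0 → ψ1 ≤ ∑ x ∈ Ls o (o c), r x) (A' : Finset C) (c c' : C) (hcc : H.Adj c c') :
    aw H r η c * aw H r η c' * Real.exp (-((1 - β) * ∑ x ∈ spt r with x ∈ NJ o H A' (c, c'), η * r x))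
      ≤ BJ H r η β (c, c') * ((1 - η * ψ1 + β * η + η ^ 2 + η * ph) + η * ∑ x ∈ A', rho o H r x (o c')) := by
  have hη := w.η0
  have hβ := w.β0
  have hβ1 := w.β1
  have hη1 := w.η1
  have hph := w.ph0
  by_cases h0 : r c' = 0
  · simp [BJ, aw, h0]
  rw [sum_sup _ _ (fun c hc => by simp [hc]), ← Finset.mul_sum]
  have hQ := QJ E w.r0 A' c c' hcc
  have hal := alive_ge (o := o) (H := H) w.r0 w.rph A' c'
  have hψc := hψ c' h0
  set m := ∑ x ∈ (alive o H (o c') A').erase c', r x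
  have hm : 0 ≤ m := Finset.sum_nonneg fun x _ => w.r0 x
  set y := ∑ x ∈ A', rho o H r x (o c')
  have hy : 0 ≤ y := Finset.sum_nonneg fun x _ => rho_nonneg w.r0 _ _
  set ρ := (1 - β) * η with hρ
  have hρ0 : 0 ≤ ρ := mul_nonneg (by linarith) hη.le
  have hρη : ρ ≤ η := by nlinarith
  have h1 : Real.exp (-((1 - β) * (η * ∑ x ∈ NJ o H A' (c, c'), r x))) ≤
      Real.exp (-((1 - β) * (η * ∑ x ∈ Nb H c ∪ Nb H c', r x))) * Real.exp (-(ρ * m)) := by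
    rw [← Real.exp_add]
    apply Real.exp_le_exp.2
    rw [hρ]
    nlinarith [mul_le_mul_of_nonneg_left hQ hρ0]
  have h2 : Real.exp (-(ρ * m)) ≤ (1 - η * ψ1 + β * η + η ^ 2 + η * ph) + η * y := by
    have hρψ := exp_neg_quad (y := ρ * ψ1) (mul_nonneg hρ0 hψ0)
    have hsq : (ρ * ψ1) ^ 2 ≤ η ^ 2 := by
      have : ρ * ψ1 ≤ η := by nlinarith
      have h3 : 0 ≤ ρ * ψ1 := mul_nonneg hρ0 hψ0
      nlinarith
    have h4 : 1 - ρ * ψ1 + (ρ * ψ1) ^ 2 / 2 ≤ 1 - η * ψ1 + β * η + η ^ 2 := by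
      have : η * ψ1 - ρ * ψ1 ≤ β * η := by
        rw [hρ]; nlinarith [mul_nonneg hβ.le hη.le, mul_le_mul_of_nonneg_left hψ1 (mul_nonneg hβ.le hη.le)]
      nlinarith [sq_nonneg (ρ * ψ1)]
    have h5 : Real.exp (-(ρ * m)) ≤ Real.exp (-(ρ * ψ1)) + η * (y + ph) := by
      rcases le_total ψ1 m with h | h
      · have : Real.exp (-(ρ * m)) ≤ Real.exp (-(ρ * ψ1)) := Real.exp_le_exp.2 (by nlinarith)
        have : 0 ≤ η * (y + ph) := by positivity
        linarith
      · have a1 := Real.add_one_le_exp (-(ρ * (ψ1 - m)))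
        have a2 : Real.exp (-(ρ * ψ1)) = Real.exp (-(ρ * m)) * Real.exp (-(ρ * (ψ1 - m))) := by
          rw [← Real.exp_add]; ring_nf
        have a3 : Real.exp (-(ρ * m)) ≤ 1 := Real.exp_le_one_iff.2 (by nlinarith)
        have a4 := Real.exp_pos (-(ρ * m))
        have a5 : ρ * (ψ1 - m) ≤ η * (y + ph) := by
          have : ψ1 - m ≤ y + ph := by linarith
          exact mul_le_mul hρη this (by linarith) hη.le
        have a6 : 0 ≤ ρ * (ψ1 - m) := mul_nonneg hρ0 (by linarith)
        nlinarith
    nlinarith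
  have h3 : 0 ≤ aw H r η c * aw H r η c' := mul_nonneg (w.a0 _) (w.a0 _)
  calc _ ≤ aw H r η c * aw H r η c' * (Real.exp (-((1 - β) * (η * ∑ x ∈ Nb H c ∪ Nb H c', r x))) *
        Real.exp (-(ρ * m))) := by gcongr
    _ = BJ H r η β (c, c') * Real.exp (-(ρ * m)) := by unfold BJ; ring
    _ ≤ _ := mul_le_mul_of_nonneg_left h2 (w.BJ0 _)

def Zv (o : C → V) (H : SimpleGraph C) (r : C → ℝ) (η : ℝ) (v : V) (A : Finset C) : ℝ :=
  ∑ j ∈ Jp o H v, aw H r η j.1 * aw H r η j.2 * ind (Disjoint A (NJ o H A j))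

lemma L2 (E : Env o H ℓ D k) (w : Wt o H r η β ph Λ e P) (v : V) (ψ1 : ℝ) (hψ0 : 0 ≤ ψ1) (hψ1 : ψ1 ≤ 1)
    (hψ : ∀ c, r c ≠ 0 → ψ1 ≤ ∑ x ∈ Ls o (o c), r x) (t : ℝ) :
    Ex (fun c => η * r c) (spt r) (fun A => ind
      (((1 + 4 * (β * Λ)) * (e + 2 * k * η * ph ^ 2 * P)) *
        (1 - η * ψ1 + β * η + η ^ 2 + η * ph + 2 * η ^ 2 * e) + t ≤ Zv o H r η v A)) ≤
      Real.exp (-(2 * β / (3 * D * ph ^ 2) * t)) := by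
  have hη := w.η0
  have hβ := w.β0
  have hβ1 := w.β1
  have hη1 := w.η1
  have hph := w.ph0
  have hΛ := w.Λ0
  have he := w.e0
  have hD : 0 < D := by linarith [E.l1, E.lD]
  set lam := 2 * β / (3 * D * ph ^ 2) with hlam
  have hl : 0 < lam := by positivity
  set κ0 := 1 - η * ψ1 + β * η + η ^ 2 + η * ph with hκ0
  have hκ : 0 ≤ κ0 := by
    have : η * ψ1 ≤ 1 := by nlinarith
    have : 0 ≤ β * η + η ^ 2 + η * ph := by positivity
    linarith
  set q : C → ℝ := fun c => η * r c with hq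
  have q0 : ∀ c ∈ spt r, 0 ≤ q c := fun c _ => w.q0 c
  have q1 : ∀ c ∈ spt r, q c ≤ 1 := fun c _ => w.q1 c
  set b : C × C → ℝ := fun j => lam * (aw H r η j.1 * aw H r η j.2) with hb
  have hb0 : ∀ j, 0 ≤ b j := fun j => mul_nonneg hl.le (mul_nonneg (w.a0 _) (w.a0 _))
  set f : Finset C → Finset C → ℝ := fun A A' => ∑ j ∈ Jp o H v, b j * ind (Disjoint A (NJ o H A' j)) with hf
  have hdec := decouple q (spt r) q0 q1 f
    (fun x A A' => by
      simp only [hf, ← Finset.sum_add_distrib, ← mul_add]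
      exact Finset.sum_le_sum fun j _ => mul_le_mul_of_nonneg_left (dec_sub j x A A') (hb0 j))
    (fun x A A' => Finset.sum_le_sum fun j _ => mul_le_mul_of_nonneg_left (ind_mono fun h =>
      Finset.disjoint_of_subset_right (NJ_mono (Finset.subset_insert _ _) j) h) (hb0 j))
    (fun x A A' => Finset.sum_le_sum fun j _ => mul_le_mul_of_nonneg_left (ind_mono fun h =>
      Finset.disjoint_of_subset_left (Finset.subset_insert _ _) h) (hb0 j))
  set Bt := ∑ j ∈ Jp o H v, BJ H r η β j with hBt
  have hBt0 : 0 ≤ Bt := Finset.sum_nonneg fun j _ => w.BJ0 j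
  set g : C → ℝ := fun x => lam * (η * ∑ j ∈ Jp o H v, BJ H r η β j * rho o H r x (o j.2)) with hg
  have hg0 : ∀ x, 0 ≤ g x := fun x => mul_nonneg hl.le (mul_nonneg hη.le (Finset.sum_nonneg fun j _ =>
    mul_nonneg (w.BJ0 j) (rho_nonneg w.r0 _ _)))
  have hin : ∀ A' : Finset C, Ex q (spt r) (fun A => Real.exp (f A A')) ≤
      Real.exp (lam * (κ0 * Bt)) * Real.exp (∑ x ∈ A', g x) := by
    intro A'
    have M := MGF_pos q (spt r) β hβ1 q0 q1 (Jp o H v) (NJ o H A') b (fun j _ => hb0 j) (fun x _ => by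
      have := loadJ E v A' x b (lam * ph ^ 2) (by positivity)
        (fun j => mul_le_mul_of_nonneg_left (w.ab_le j) hl.le)
      refine this.trans (le_of_eq ?_)
      rw [hlam]; field_simp)
    refine M.trans ?_
    rw [← Real.exp_add]
    apply Real.exp_le_exp.2
    have h1 : ∀ j ∈ Jp o H v, b j * Real.exp (-((1 - β) * ∑ x ∈ spt r with x ∈ NJ o H A' j, q x)) ≤
        lam * (BJ H r η β j * (κ0 + η * ∑ x ∈ A', rho o H r x (o j.2))) := by
      intro j hj
      have := w.term_le E ψ1 hψ0 hψ1 hψ A' j.1 j.2 (mem_Jp.1 hj).2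
      simp only [Prod.mk.eta] at this
      rw [hb]; simp only; rw [mul_assoc]
      exact mul_le_mul_of_nonneg_left this hl.le
    refine (Finset.sum_le_sum h1).trans (le_of_eq ?_)
    rw [← Finset.mul_sum]
    simp only [mul_add, Finset.sum_add_distrib, hg]
    rw [hBt]
    congr 1
    · rw [← Finset.sum_mul]; ring
    · rw [← Finset.mul_sum, ← Finset.mul_sum, Finset.sum_comm]
      congr 1
      rw [Finset.mul_sum]
      refine Finset.sum_congr rfl fun j _ => ?_
      rw [← Finset.mul_sum]; ring
  have hg1 : ∀ x ∈ spt r, g x ≤ 1 := by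
    intro x hx
    have hsx := w.rs x (mem_spt.1 hx)
    have h1 : ∑ j ∈ Jp o H v, BJ H r η β j * rho o H r x (o j.2) ≤ ℓ * (ph ^ 2 * sm H r x) := by
      calc _ ≤ ∑ j ∈ Jp o H v, ph ^ 2 * rho o H r x (o j.2) :=
            Finset.sum_le_sum fun j _ => mul_le_mul_of_nonneg_right (w.BJ_le j) (rho_nonneg w.r0 _ _)
        _ = ∑ c ∈ Ls o v, ∑ c' ∈ Nb H c, ph ^ 2 * rho o H r x (o c') :=
            sumJ (o := o) (H := H) v (fun c c' => ph ^ 2 * rho o H r x (o c'))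
        _ ≤ ∑ c ∈ Ls o v, ph ^ 2 * sm H r x := by
            refine Finset.sum_le_sum fun c _ => ?_
            rw [← Finset.mul_sum]
            refine mul_le_mul_of_nonneg_left ?_ (by positivity)
            unfold rho sm
            simp only [Finset.sum_filter]
            rw [Finset.sum_comm]
            refine Finset.sum_le_sum fun y _ => ?_
            rw [← Finset.sum_filter]
            refine sum_subsing _ _ _ (w.r0 y) (fun _ _ => le_rfl) ?_
            intro a ha a' ha'
            simp only [mem_filter, mem_Nb] at ha ha'
            exact E.mat c a a' ha.1 ha'.1 (ha.2.symm.trans ha'.2)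
        _ = ℓ * (ph ^ 2 * sm H r x) := by
            rw [Finset.sum_const, nsmul_eq_mul, E.lst v]
    have h2 : g x ≤ lam * (D * (ph ^ 2 * Λ)) := by
      refine mul_le_mul_of_nonneg_left ?_ hl.le
      have h3 : η * ∑ j ∈ Jp o H v, BJ H r η β j * rho o H r x (o j.2) ≤ η * (ℓ * (ph ^ 2 * sm H r x)) :=
        mul_le_mul_of_nonneg_left h1 hη.le
      have hℓ := E.l1
      have hℓD := E.lD
      calc _ ≤ η * (ℓ * (ph ^ 2 * sm H r x)) := h3
        _ = ℓ * (ph ^ 2 * (η * sm H r x)) := by ring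
        _ ≤ D * (ph ^ 2 * Λ) := by
          have := mul_nonneg hη.le (sm_nonneg H r w.r0 x)
          gcongr
    refine h2.trans ?_
    have : lam * (D * (ph ^ 2 * Λ)) = 2 * (β * Λ) / 3 := by
      rw [hlam]; field_simp
    rw [this]; linarith [w.βΛ]
  have hlin := MGF_lin q (spt r) q0 q1 g (fun x _ => hg0 x) hg1
  have hqg : ∑ x ∈ spt r, q x * g x ≤ lam * (η ^ 2 * e * Bt) := by
    calc _ ≤ ∑ x, q x * g x := Finset.sum_le_sum_of_subset_of_nonneg (Finset.subset_univ _)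
          fun x _ _ => mul_nonneg (w.q0 x) (hg0 x)
      _ = lam * (η ^ 2 * ∑ j ∈ Jp o H v, BJ H r η β j * ∑ x, r x * rho o H r x (o j.2)) := by
          simp only [hq, hg, Finset.mul_sum]
          rw [Finset.sum_comm]
          refine Finset.sum_congr rfl fun j _ => Finset.sum_congr rfl fun x _ => ?_
          ring
      _ ≤ lam * (η ^ 2 * ∑ j ∈ Jp o H v, BJ H r η β j * e) := by
          refine mul_le_mul_of_nonneg_left (mul_le_mul_of_nonneg_left (Finset.sum_le_sum fun j _ =>
            mul_le_mul_of_nonneg_left ?_ (w.BJ0 j)) (by positivity)) hl.le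
          refine le_trans (le_of_eq ?_) (w.he (o j.2))
          unfold rho sm Nb Ls
          simp only [Finset.sum_filter, Finset.mul_sum]
          rw [Finset.sum_comm]
          refine Finset.sum_congr rfl fun y _ => ?_
          by_cases h : o y = o j.2
          · simp only [h, if_true]
            refine Finset.sum_congr rfl fun x _ => ?_
            simp only [H.adj_comm x y]
            split_ifs <;> ring
          · simp [h]
      _ = _ := by rw [← Finset.sum_mul]; ring
  have htot : Ex q (spt r) (fun A => Real.exp (f A A)) ≤
      Real.exp (lam * (κ0 + 2 * η ^ 2 * e) * Bt) := by
    refine hdec.trans ((Ex_mono q (spt r) _ _ q0 q1 fun A' _ => hin A').trans ?_)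
    rw [Ex_mul]
    refine (mul_le_mul_of_nonneg_left hlin (Real.exp_pos _).le).trans ?_
    rw [← Real.exp_add]
    apply Real.exp_le_exp.2
    nlinarith
  refine Ex_markov q (spt r) q0 q1 _ _ _ (lam * t) ?_ htot
  intro A hA hE
  have hfZ : f A A = lam * Zv o H r η v A := by
    simp only [hf, Zv, hb]
    rw [Finset.mul_sum]; exact Finset.sum_congr rfl fun j _ => by ring
  rw [hfZ]
  have hBs := w.BJ_sum E v
  have h1 : (κ0 + 2 * η ^ 2 * e) * Bt + t ≤ Zv o H r η v A := by
    refine le_trans ?_ hE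
    have : 0 ≤ κ0 + 2 * η ^ 2 * e := by positivity
    nlinarith [mul_le_mul_of_nonneg_left hBs this]
  nlinarith [mul_le_mul_of_nonneg_left h1 hl.le]
end


section
variable {V C : Type} [Fintype V] [Fintype C] {o : C → V} {H : SimpleGraph C} {ℓ D k : ℝ}
  {r : C → ℝ} {η β ph Λ e P : ℝ}

def Rn (o : C → V) (H : SimpleGraph C) (v : V) : Finset V :=
  insert v (((Ls o v).biUnion (Nb H)).image o)

def scv (o : C → V) (H : SimpleGraph C) (v : V) : Finset C :=
  univ.filter fun w => ∃ u ∈ Rn o H v, o w ∈ Rn o H u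

lemma mem_Rn {v u : V} : u ∈ Rn o H v ↔ u = v ∨ ∃ c c', o c = v ∧ H.Adj c c' ∧ o c' = u := by
  simp only [Rn, mem_insert, mem_image, mem_biUnion, mem_Ls, mem_Nb]
  constructor
  · rintro (h | ⟨c', ⟨c, h1, h2⟩, h3⟩)
    · exact Or.inl h
    · exact Or.inr ⟨c, c', h1, h2, h3⟩
  · rintro (h | ⟨c, c', h1, h2, h3⟩)
    · exact Or.inl h
    · exact Or.inr ⟨c', ⟨c, h1, h2⟩, h3⟩

lemma Rn_symm {v u : V} (h : u ∈ Rn o H v) : v ∈ Rn o H u := by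
  rw [mem_Rn] at h ⊢
  rcases h with h | ⟨c, c', h1, h2, h3⟩
  · exact Or.inl h.symm
  · exact Or.inr ⟨c', c, h3, h2.symm, h1⟩

lemma Rn_self (v : V) : v ∈ Rn o H v := mem_Rn.2 (Or.inl rfl)
lemma Rn_adj {c c' : C} (h : H.Adj c c') : o c' ∈ Rn o H (o c) := mem_Rn.2 (Or.inr ⟨c, c', rfl, h, rfl⟩)

lemma Rn_card (E : Env o H ℓ D k) (v : V) : ((Rn o H v).card : ℝ) ≤ ℓ * D + 1 := by
  have h1 : (Rn o H v).card ≤ (∑ c ∈ Ls o v, (Nb H c).card) + 1 :=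
    (Finset.card_insert_le _ _).trans (Nat.add_le_add_right
      (Finset.card_image_le.trans Finset.card_biUnion_le) _)
  have h2 : ((∑ c ∈ Ls o v, (Nb H c).card : ℕ) : ℝ) ≤ ℓ * D := by
    push_cast
    have := Finset.sum_le_card_nsmul (Ls o v) (fun c => ((Nb H c).card : ℝ)) D (fun c _ => E.deg c)
    rwa [nsmul_eq_mul, E.lst v] at this
  have h3 : ((Rn o H v).card : ℝ) ≤ ((∑ c ∈ Ls o v, (Nb H c).card : ℕ) : ℝ) + 1 := by exact_mod_cast h1
  linarith

def Gam (o : C → V) (H : SimpleGraph C) (v : V) : Finset V :=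
  (Rn o H v).biUnion fun u => (Rn o H u).biUnion fun x => (Rn o H x).biUnion fun y => Rn o H y

lemma Gam_card (E : Env o H ℓ D k) (v : V) : ((Gam o H v).card : ℝ) ≤ (ℓ * D + 1) ^ 4 := by
  have hnn : 0 ≤ ℓ * D + 1 := by
    have := Rn_card E v
    exact le_trans (by positivity) this
  set m := ⌊ℓ * D + 1⌋₊
  have hm : (m : ℝ) ≤ ℓ * D + 1 := Nat.floor_le hnn
  have hR : ∀ u, (Rn o H u).card ≤ m := fun u => Nat.le_floor (Rn_card E u)
  have h1 : (Gam o H v).card ≤ m * (m * (m * m)) := by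
    refine (Finset.card_biUnion_le_card_mul _ _ (m * (m * m)) fun u _ => ?_).trans
      (Nat.mul_le_mul_right _ (hR v))
    refine (Finset.card_biUnion_le_card_mul _ _ (m * m) fun u _ => ?_).trans
      (Nat.mul_le_mul_right _ (hR _))
    refine (Finset.card_biUnion_le_card_mul _ _ m fun u _ => hR _).trans
      (Nat.mul_le_mul_right _ (hR _))
  calc ((Gam o H v).card : ℝ) ≤ ((m * (m * (m * m)) : ℕ) : ℝ) := by exact_mod_cast h1
    _ = (m : ℝ) ^ 4 := by push_cast; ring
    _ ≤ _ := by gcongr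

lemma Gam_disj (v v' : V) (h : v' ∉ Gam o H v) : Disjoint (scv o H v) (scv o H v') := by
  rw [Finset.disjoint_left]
  intro w hw hw'
  simp only [scv, mem_filter, mem_univ, true_and] at hw hw'
  obtain ⟨u, hu, hu2⟩ := hw
  obtain ⟨u', hu', hu2'⟩ := hw'
  apply h
  simp only [Gam, mem_biUnion]
  exact ⟨u, hu, o w, hu2, u', Rn_symm hu2', Rn_symm hu'⟩

lemma Gam_self (v : V) : v ∈ Gam o H v := by
  simp only [Gam, mem_biUnion]
  exact ⟨v, Rn_self v, v, Rn_self v, v, Rn_self v, Rn_self v⟩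

lemma disj_loc {A N S : Finset C} (h : N ⊆ S) : Disjoint A N ↔ Disjoint (A ∩ S) N := by
  constructor
  · intro h1; exact Finset.disjoint_of_subset_left Finset.inter_subset_left h1
  · intro h1
    rw [Finset.disjoint_left] at h1 ⊢
    intro x hx hN
    exact h1 (Finset.mem_inter.2 ⟨hx, h hN⟩) hN

lemma sc_Nb {v : V} {c : C} (hc : o c ∈ Rn o H v) : Nb H c ⊆ scv o H v := by
  intro w hw
  simp only [scv, mem_filter, mem_univ, true_and]
  exact ⟨o c, hc, Rn_adj (mem_Nb.1 hw)⟩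

lemma alive_loc (v : V) {u : V} (hu : u ∈ Rn o H v) (A : Finset C) :
    alive o H u A = alive o H u (A ∩ scv o H v) := by
  unfold alive
  refine Finset.filter_congr fun c hc => ?_
  have : o c = u := mem_Ls.1 hc
  exact disj_loc (sc_Nb (this ▸ hu))

lemma NJ_loc (v : V) (A : Finset C) {j : C × C} (hj : j ∈ Jp o H v) :
    NJ o H A j = NJ o H (A ∩ scv o H v) j := by
  have h := mem_Jp.1 hj
  unfold NJ
  rw [alive_loc v (h.1 ▸ Rn_adj h.2) A]

lemma NJ_sub (v : V) (A : Finset C) {j : C × C} (hj : j ∈ Jp o H v) : NJ o H A j ⊆ scv o H v := by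
  have h := mem_Jp.1 hj
  have h2 : o j.2 ∈ Rn o H v := h.1 ▸ Rn_adj h.2
  unfold NJ
  refine Finset.union_subset (Finset.union_subset (sc_Nb ?_) (sc_Nb h2)) ?_
  · rw [h.1]; exact Rn_self v
  · intro w hw
    simp only [alive, mem_filter, mem_Ls] at hw
    simp only [scv, mem_filter, mem_univ, true_and]
    exact ⟨o j.2, h2, hw.1 ▸ Rn_self _⟩

lemma Zv_loc (v : V) (A : Finset C) : Zv o H r η v A = Zv o H r η v (A ∩ scv o H v) := by
  unfold Zv
  refine Finset.sum_congr rfl fun j hj => ?_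
  rw [← NJ_loc v A hj]
  congr 2
  exact propext (disj_loc (NJ_sub v A hj))

lemma Nb_loc (v : V) (A : Finset C) (F : C → ℝ) : ∑ c ∈ Ls o v, F c * ind (Disjoint A (Nb H c)) =
    ∑ c ∈ Ls o v, F c * ind (Disjoint (A ∩ scv o H v) (Nb H c)) := by
  refine Finset.sum_congr rfl fun c hc => ?_
  congr 2
  refine propext (disj_loc (sc_Nb ?_))
  rw [mem_Ls.1 hc]; exact Rn_self v

def hh (ℓ Λ x : ℝ) : ℝ := 1 - Real.log (x * ℓ) / Λ

structure NInv (o : C → V) (H : SimpleGraph C) (ℓ ph Λ : ℝ) (W : Finset V) (p : C → ℝ) (ψ e P : ℝ) : Prop where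
  p0 : ∀ c, 0 ≤ p c
  lo : ∀ c, p c ≠ 0 → 1 / ℓ ≤ p c
  hi : ∀ c, p c ≤ ph
  inW : ∀ c, p c ≠ 0 → o c ∈ W
  psi : ∀ v ∈ W, ψ ≤ ∑ c ∈ Ls o v, p c * hh ℓ Λ (p c)
  he : ∀ v, ∑ c ∈ Ls o v, p c * sm H p c ≤ e
  hP : ∀ v, ∑ c ∈ Ls o v, p c ≤ P

def Col (o : C → V) (H : SimpleGraph C) (W : Finset V) (p : C → ℝ) : Prop :=
  ∃ φ : V → C, (∀ v ∈ W, o (φ v) = v ∧ p (φ v) ≠ 0) ∧ ∀ u ∈ W, ∀ w ∈ W, ¬ H.Adj (φ u) (φ w)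

lemma ind_or3 (a b c : Prop) : ind (a ∨ b ∨ c) ≤ ind a + ind b + ind c := by
  have := ind_nonneg a; have := ind_nonneg b; have := ind_nonneg c
  by_cases ha : a
  · rw [ind_true ha]; linarith [ind_le_one (a ∨ b ∨ c)]
  by_cases hb : b
  · rw [ind_true hb]; linarith [ind_le_one (a ∨ b ∨ c)]
  by_cases hc : c
  · rw [ind_true hc]; linarith [ind_le_one (a ∨ b ∨ c)]
  · rw [ind_false (by tauto)]; linarith

/-- The nibble step. -/
lemma step (E : Env o H ℓ D k) (W : Finset V) (p : C → ℝ) (ψ t ζ : ℝ)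
    (I : NInv o H ℓ ph Λ W p ψ e P) (hΛ : ph * ℓ = Real.exp Λ) (hη0 : 0 < η) (hη1 : η ≤ 1)
    (hβ0 : 0 < β) (hβ1 : β ≤ 1) (hηβ : 6 * (η * ph) ≤ β) (hΛ0 : 0 < Λ) (hβΛ : 2 * (β * Λ) ≤ 1)
    (he0 : 0 ≤ e) (hP0 : 0 ≤ P) (hψ0 : 0 ≤ ψ - η * e / Λ) (hψ1 : ψ ≤ 1)
    (hζ1 : Real.exp (-(β / ph * t)) ≤ ζ) (hζ2 : Real.exp (-(2 * β / (3 * D * ph ^ 2) * t)) ≤ ζ)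
    (hζ : 12 * ζ * (ℓ * D + 1) ^ 4 ≤ 1) :
    ∃ (W' : Finset V) (p' : C → ℝ), NInv o H ℓ ph Λ W' p' (ψ - η * e / Λ - 2 * β * η * e - t)
      (((1 + 4 * (β * Λ)) * (e + 2 * k * η * ph ^ 2 * P)) *
        (1 - η * (ψ - η * e / Λ) + β * η + η ^ 2 + η * ph + 2 * η ^ 2 * e) + t)
      (P + 2 * β * η * e + t) ∧ (Col o H W' p' → Col o H W p) := by
  have hℓ : 0 < ℓ := by linarith [E.l1]
  have hph : 0 < ph := by
    have := Real.exp_pos Λ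
    rw [← hΛ] at this
    exact pos_of_mul_pos_left this hℓ.le
  set r : C → ℝ := fun c => if p c * Real.exp (η * sm H p c) ≤ ph then p c else 0 with hr
  have hr0 : ∀ c, 0 ≤ r c := fun c => by simp only [hr]; split_ifs; exacts [I.p0 c, le_rfl]
  have hrp : ∀ c, r c ≤ p c := fun c => by simp only [hr]; split_ifs; exacts [le_rfl, I.p0 c]
  have hsm : ∀ c, sm H r c ≤ sm H p c := fun c => Finset.sum_le_sum fun x _ => hrp x
  have hsm0 : ∀ c, 0 ≤ sm H r c := sm_nonneg H r hr0
  have hrne : ∀ c, r c ≠ 0 → r c = p c ∧ p c ≠ 0 ∧ p c * Real.exp (η * sm H p c) ≤ ph := by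
    intro c hc
    simp only [hr] at hc ⊢
    split_ifs at hc ⊢ with h
    · exact ⟨rfl, hc, h⟩
    · exact absurd rfl hc
  have haph : ∀ c, aw H r η c ≤ ph := by
    intro c
    by_cases h : r c = 0
    · simp [aw, h, hph.le]
    · obtain ⟨h1, h2, h3⟩ := hrne c h
      refine le_trans ?_ h3
      unfold aw; rw [h1]
      refine mul_le_mul_of_nonneg_left (Real.exp_le_exp.2 ?_) (I.p0 c)
      exact mul_le_mul_of_nonneg_left (hsm c) hη0.le
  have hpl : ∀ c, p c ≠ 0 → 1 ≤ p c * ℓ := fun c hc => by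
    have := I.lo c hc
    rwa [div_le_iff₀ hℓ] at this
  have hral : ∀ c, r c ≠ 0 → 1 ≤ aw H r η c * ℓ := by
    intro c hc
    obtain ⟨h1, h2, h3⟩ := hrne c hc
    have h4 := hpl c h2
    rw [← h1] at h4
    refine h4.trans (mul_le_mul_of_nonneg_right ?_ hℓ.le)
    exact le_mul_of_one_le_right (hr0 c) (Real.one_le_exp (mul_nonneg hη0.le (hsm0 c)))
  have w : Wt o H r η β ph Λ e P :=
    { r0 := hr0
      aph := haph
      rs := by
        intro c hc
        have h1 := hrne c hc
        have h2 := haph c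
        have h3 := hpl c h1.2.1
        rw [← h1.1] at h3
        rw [← Real.exp_le_exp, ← hΛ]
        calc Real.exp (η * sm H r c) ≤ (r c * ℓ) * Real.exp (η * sm H r c) :=
              le_mul_of_one_le_left (Real.exp_pos _).le h3
          _ = aw H r η c * ℓ := by unfold aw; ring
          _ ≤ ph * ℓ := by gcongr
      he := fun v => le_trans (Finset.sum_le_sum fun c _ => mul_le_mul (hrp c) (hsm c) (hsm0 c) (I.p0 c)) (I.he v)
      hP := fun v => le_trans (Finset.sum_le_sum fun c _ => hrp c) (I.hP v)
      η0 := hη0, η1 := hη1, β0 := hβ0, β1 := hβ1, ph0 := hph, ηβ := hηβ, Λ0 := hΛ0, βΛ := hβΛ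
      e0 := he0, P0 := hP0 }
  set g : C → ℝ := fun c => hh ℓ Λ (aw H r η c) with hg
  have hg01 : ∀ c, r c ≠ 0 → 0 ≤ g c ∧ g c ≤ 1 := by
    intro c hc
    have h1 := hral c hc
    simp only [hg, hh]
    constructor
    · have : Real.log (aw H r η c * ℓ) ≤ Λ := by
        rw [← Real.log_exp Λ, ← hΛ]
        exact Real.log_le_log (by linarith) (mul_le_mul_of_nonneg_right (haph c) hℓ.le)
      have : Real.log (aw H r η c * ℓ) / Λ ≤ 1 := by rw [div_le_one hΛ0]; exact this
      linarith
    · have : 0 ≤ Real.log (aw H r η c * ℓ) / Λ := div_nonneg (Real.log_nonneg h1) hΛ0.le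
      linarith
  have hgψ : ∀ v ∈ W, ψ - η * e / Λ ≤ ∑ c ∈ Ls o v, r c * g c := by
    intro v hv
    have h1 : ∀ c ∈ Ls o v, p c * hh ℓ Λ (p c) - η / Λ * (p c * sm H p c) ≤ r c * g c := by
      intro c _
      by_cases hpc : p c = 0
      · have : r c = 0 := by simp only [hr, hpc]; simp
        simp [hpc, this]
      have hpp : 0 < p c := lt_of_le_of_ne (I.p0 c) (Ne.symm hpc)
      have hppl : 0 < p c * ℓ := mul_pos hpp hℓ
      by_cases hl : p c * Real.exp (η * sm H p c) ≤ ph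
      · have hrc : r c = p c := by simp only [hr, hl, if_true]
        simp only [hg, hh, aw]
        rw [hrc]
        have : Real.log (p c * Real.exp (η * sm H r c) * ℓ) = Real.log (p c * ℓ) + η * sm H r c := by
          rw [mul_right_comm, Real.log_mul hppl.ne' (Real.exp_pos _).ne', Real.log_exp]
        rw [this]
        have h3 : η / Λ * sm H r c ≤ η / Λ * sm H p c := mul_le_mul_of_nonneg_left (hsm c) (by positivity)
        have h4 : (Real.log (p c * ℓ) + η * sm H r c) / Λ = Real.log (p c * ℓ) / Λ + η / Λ * sm H r c := by
          ring
        rw [h4]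
        nlinarith [mul_le_mul_of_nonneg_left h3 hpp.le]
      · have hrc : r c = 0 := by simp only [hr, hl, if_false]
        rw [hrc, zero_mul]
        push Not at hl
        have h2 : Λ ≤ Real.log (p c * ℓ) + η * sm H p c := by
          rw [← Real.log_exp (η * sm H p c), ← Real.log_mul hppl.ne' (Real.exp_pos _).ne',
            ← Real.log_exp Λ, ← hΛ]
          apply Real.log_le_log (mul_pos hph hℓ)
          calc ph * ℓ ≤ (p c * Real.exp (η * sm H p c)) * ℓ := by gcongr
            _ = _ := by ring
        have h3 : hh ℓ Λ (p c) ≤ η / Λ * sm H p c := by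
          unfold hh
          have : 1 ≤ (Real.log (p c * ℓ) + η * sm H p c) / Λ := by rw [le_div_iff₀ hΛ0]; linarith
          have h4 : (Real.log (p c * ℓ) + η * sm H p c) / Λ = Real.log (p c * ℓ) / Λ + η / Λ * sm H p c := by
            ring
          linarith
        nlinarith [mul_le_mul_of_nonneg_left h3 hpp.le]
    have h2 := Finset.sum_le_sum h1
    rw [Finset.sum_sub_distrib, ← Finset.mul_sum] at h2
    have h3 := I.psi v hv
    have h4 : η / Λ * ∑ c ∈ Ls o v, p c * sm H p c ≤ η / Λ * e := mul_le_mul_of_nonneg_left (I.he v) (by positivity)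
    have h5 : η * e / Λ = η / Λ * e := by ring
    linarith
  have hψc : ∀ c, r c ≠ 0 → ψ - η * e / Λ ≤ ∑ x ∈ Ls o (o c), r x := by
    intro c hc
    refine (hgψ (o c) (I.inW c (hrne c hc).2.1)).trans (Finset.sum_le_sum fun x _ => ?_)
    by_cases h : r x = 0
    · simp [h]
    · exact mul_le_of_le_one_right (hr0 x) (hg01 x h).2
  have hψle : ψ - η * e / Λ ≤ 1 := by
    have : 0 ≤ η * e / Λ := by positivity
    linarith
  set e' := (((1 + 4 * (β * Λ)) * (e + 2 * k * η * ph ^ 2 * P)) *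
        (1 - η * (ψ - η * e / Λ) + β * η + η ^ 2 + η * ph + 2 * η ^ 2 * e) + t) with he'
  have p1 := fun v => L1 E w v g hg01 t
  have p2 := fun v => L2 E w v (ψ - η * e / Λ) hψ0 hψle hψc t
  have p3 := fun v => L3 E w v t
  set q : C → ℝ := fun c => η * r c with hq
  have q0 : ∀ c ∈ spt r, 0 ≤ q c := fun c _ => w.q0 c
  have q1 : ∀ c ∈ spt r, q c ≤ 1 := fun c _ => w.q1 c
  let Ev : V → Finset C → Prop := fun v A =>
    (∑ c ∈ Ls o v, (r c * Real.exp (η * sm H r c)) * g c * ind (Disjoint A (Nb H c)) ≤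
        ∑ c ∈ Ls o v, r c * g c - 2 * β * η * e - t) ∨
    (P + 2 * β * η * e + t ≤ ∑ c ∈ Ls o v, (r c * Real.exp (η * sm H r c)) * ind (Disjoint A (Nb H c))) ∨
    (e' ≤ Zv o H r η v A)
  have hEvP : ∀ v, Ex q (spt r) (fun A => ind (Ev v A)) ≤ 3 * ζ := by
    intro v
    refine (Ex_mono q (spt r) _ _ q0 q1 fun A _ => ind_or3 _ _ _).trans ?_
    rw [Ex_add, Ex_add]
    linarith [p1 v, p2 v, p3 v]
  obtain ⟨A, hAS, hA⟩ := LLL q (spt r) q0 q1 Ev (scv o H)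
    (fun v A => by
      simp only [Ev]
      rw [Zv_loc v A, Nb_loc v A (fun c => (r c * Real.exp (η * sm H r c)) * g c),
        Nb_loc v A (fun c => (r c * Real.exp (η * sm H r c)))])
    (Gam o H) (fun v v' h => Gam_disj v v' h) Gam_self (fun v => by
      have h1 := Finset.sum_le_card_nsmul (Gam o H v) (fun j => Ex q (spt r) (fun A => ind (Ev j A)))
        (3 * ζ) (fun j _ => hEvP j)
      rw [nsmul_eq_mul] at h1
      have hζ0 : 0 ≤ ζ := (Real.exp_pos _).le.trans hζ1
      have h2 : ((Gam o H v).card : ℝ) * (3 * ζ) ≤ (ℓ * D + 1) ^ 4 * (3 * ζ) :=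
        mul_le_mul_of_nonneg_right (Gam_card E v) (by positivity)
      linarith)
  -- new state
  let U : V → Prop := fun u => Disjoint A (alive o H u A)
  set W' := W.filter U with hW'
  set p' : C → ℝ := fun c => aw H r η c * (ind (Disjoint A (Nb H c)) * ind (U (o c))) with hp'
  have hind : ∀ c, 0 ≤ ind (Disjoint A (Nb H c)) * ind (U (o c)) := fun c =>
    mul_nonneg (ind_nonneg _) (ind_nonneg _)
  have hind1 : ∀ c, ind (Disjoint A (Nb H c)) * ind (U (o c)) ≤ 1 := fun c =>
    mul_le_one₀ (ind_le_one _) (ind_nonneg _) (ind_le_one _)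
  have hp'ne : ∀ c, p' c ≠ 0 → r c ≠ 0 ∧ Disjoint A (Nb H c) ∧ U (o c) ∧ p' c = aw H r η c := by
    intro c hc
    have a1 : r c ≠ 0 := fun h => hc (by simp [hp', aw, h])
    have a2 : Disjoint A (Nb H c) := by
      by_contra h; exact hc (by simp only [hp']; rw [ind_false h]; simp)
    have a3 : U (o c) := by
      by_contra h; exact hc (by simp only [hp']; rw [ind_false h]; simp)
    refine ⟨a1, a2, a3, ?_⟩
    simp only [hp']; rw [ind_true a2, ind_true a3]; simp
  refine ⟨W', p', ?_, ?_⟩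
  · refine ⟨?_, ?_, ?_, ?_, ?_, ?_, ?_⟩
    · exact fun c => mul_nonneg (w.a0 c) (hind c)
    · intro c hc
      obtain ⟨a1, _, _, a4⟩ := hp'ne c hc
      rw [a4, div_le_iff₀ hℓ]; exact hral c a1
    · exact fun c => (mul_le_of_le_one_right (w.a0 c) (hind1 c)).trans (haph c)
    · intro c hc
      obtain ⟨a1, _, a3, _⟩ := hp'ne c hc
      exact mem_filter.2 ⟨I.inW c (hrne c a1).2.1, a3⟩
    · intro v hv
      obtain ⟨hvW, hvU⟩ := mem_filter.1 hv
      have h1 : ¬ _ := fun h => hA v (Or.inl h)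
      push Not at h1
      have h2 : ∑ c ∈ Ls o v, p' c * hh ℓ Λ (p' c) =
          ∑ c ∈ Ls o v, r c * Real.exp (η * sm H r c) * g c * ind (Disjoint A (Nb H c)) := by
        refine Finset.sum_congr rfl fun c hc => ?_
        have hov : o c = v := mem_Ls.1 hc
        by_cases hX : Disjoint A (Nb H c)
        · have : p' c = aw H r η c := by
            simp only [hp']; rw [hov, ind_true hX, ind_true hvU]; simp
          rw [this, ind_true hX]; simp only [hg, aw]; ring
        · have : p' c = 0 := by simp only [hp']; rw [ind_false hX]; simp
          rw [this, ind_false hX]; simp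
      rw [h2]
      linarith [hgψ v hvW]
    · intro v
      have h1 : ¬ _ := fun h => hA v (Or.inr (Or.inr h))
      push Not at h1
      refine le_trans ?_ h1.le
      have h2 : ∑ c ∈ Ls o v, p' c * sm H p' c = ∑ j ∈ Jp o H v, p' j.1 * p' j.2 := by
        rw [sumJ (o := o) (H := H) v (fun c c' => p' c * p' c')]
        refine Finset.sum_congr rfl fun c _ => ?_
        rw [sm, Finset.mul_sum]
      rw [h2, Zv]
      refine Finset.sum_le_sum fun j _ => ?_
      have hp'0 : ∀ c, 0 ≤ p' c := fun c => mul_nonneg (w.a0 c) (hind c)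
      by_cases hz : p' j.1 * p' j.2 = 0
      · rw [hz]; exact mul_nonneg (mul_nonneg (w.a0 _) (w.a0 _)) (ind_nonneg _)
      · obtain ⟨b1, b2, b3, b4⟩ := hp'ne j.1 (left_ne_zero_of_mul hz)
        obtain ⟨c1, c2, c3, c4⟩ := hp'ne j.2 (right_ne_zero_of_mul hz)
        have : Disjoint A (NJ o H A j) := by
          unfold NJ
          rw [Finset.disjoint_union_right, Finset.disjoint_union_right]
          exact ⟨⟨b2, c2⟩, c3⟩
        rw [ind_true this, b4, c4, mul_one]
    · intro v
      have h1 : ¬ _ := fun h => hA v (Or.inr (Or.inl h))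
      push Not at h1
      refine le_trans (Finset.sum_le_sum fun c _ => ?_) h1.le
      simp only [hp', aw]
      rw [← mul_assoc]
      exact mul_le_of_le_one_right (mul_nonneg (w.a0 c) (ind_nonneg _)) (ind_le_one _)
  · rintro ⟨φ, hφ1, hφ2⟩
    have hch : ∀ v, v ∈ W → v ∉ W' → ∃ c, c ∈ A ∧ c ∈ alive o H v A := by
      intro v hv hv'
      have : ¬ U v := fun h => hv' (mem_filter.2 ⟨hv, h⟩)
      simp only [U] at this
      rw [Finset.not_disjoint_iff] at this
      exact this
    rcases isEmpty_or_nonempty V with hV | hV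
    · exact ⟨φ, fun v => hV.elim v, fun v => hV.elim v⟩
    have hC : Nonempty C := ⟨φ (Classical.arbitrary V)⟩
    choose! ch hch1 hch2 using hch
    have hkey : ∀ v ∈ W, Disjoint A (Nb H (if v ∈ W' then φ v else ch v)) := by
      intro v hv
      split_ifs with h
      · exact (hp'ne _ (hφ1 v h).2).2.1
      · exact (mem_filter.1 (hch2 v hv h)).2
    refine ⟨fun v => if v ∈ W' then φ v else ch v, ?_, ?_⟩
    · intro v hv
      by_cases h : v ∈ W'
      · simp only [h, if_true]
        refine ⟨(hφ1 v h).1, ?_⟩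
        exact (hrne _ (hp'ne _ (hφ1 v h).2).1).2.1
      · simp only [h, if_false]
        refine ⟨mem_Ls.1 (mem_filter.1 (hch2 v hv h)).1, ?_⟩
        exact (hrne _ (mem_spt.1 (hAS (hch1 v hv h)))).2.1
    · intro u hu x hx hadj
      by_cases hx' : x ∈ W'
      · by_cases hu' : u ∈ W'
        · simp only [hx', hu', if_true] at hadj
          exact hφ2 u hu' x hx' hadj
        · have h1 := hkey x hx
          simp only [hu', if_false] at hadj
          exact Finset.disjoint_left.1 h1 (hch1 u hu hu') (mem_Nb.2 hadj.symm)
      · have h1 := hkey u hu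
        simp only [hx', if_false] at hadj
        exact Finset.disjoint_left.1 h1 (hch1 x hx hx') (mem_Nb.2 hadj)
end


lemma Ex_disj {ι : Type*} (q : ι → ℝ) (S T : Finset ι)
    (h0 : ∀ w ∈ S, 0 ≤ q w) (h1 : ∀ w ∈ S, q w ≤ 1) :
    Ex q S (fun A => ind (Disjoint A T)) ≤ Real.exp (-∑ w ∈ S with w ∈ T, q w) := by
  induction S using Finset.induction_on with
  | empty => simp [Ex_empty, ind_true]
  | insert w S hw ih =>
    have ih := ih (fun x hx => h0 x (mem_insert_of_mem hx)) (fun x hx => h1 x (mem_insert_of_mem hx))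
    have hq0 := h0 w (mem_insert_self _ _)
    have hq1 := h1 w (mem_insert_self _ _)
    rw [Ex_insert _ _ _ hw]
    simp only [ind_insert]
    rw [Ex_mul, Finset.filter_insert]
    by_cases h : w ∈ T
    · simp only [h, if_true, zero_mul, mul_zero, add_zero]
      rw [Finset.sum_insert (by simp [hw]), neg_add, Real.exp_add]
      have := Real.add_one_le_exp (-q w)
      exact mul_le_mul (by linarith) ih (Ex_nonneg _ _ _ (fun x hx => h0 x (mem_insert_of_mem hx))
        (fun x hx => h1 x (mem_insert_of_mem hx)) fun A _ => ind_nonneg _) (Real.exp_pos _).le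
    · simp only [h, if_false, one_mul]
      linarith

lemma Ex_mem {ι : Type*} (q : ι → ℝ) (S : Finset ι) (c : ι)
    (h0 : ∀ w, 0 ≤ q w) (h1 : ∀ w, q w ≤ 1) :
    Ex q S (fun A => ind (c ∈ A)) ≤ q c := by
  have key : ∀ S : Finset ι, c ∉ S → Ex q S (fun A => ind (c ∈ A)) ≤ 0 := by
    intro S hc
    refine le_trans (Ex_mono q S _ (fun _ => 0) (fun w _ => h0 w) (fun w _ => h1 w) ?_) (by rw [Ex_const])
    intro A hA
    rw [ind_false fun h => hc (hA h)]
  by_cases hc : c ∈ S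
  · rw [← Finset.insert_erase hc, Ex_insert _ _ _ (Finset.notMem_erase _ _)]
    have k1 := key (S.erase c) (Finset.notMem_erase _ _)
    have k2 : Ex q (S.erase c) (fun A => ind (c ∈ insert c A)) ≤ 1 :=
      le_trans (Ex_mono q _ _ (fun _ => 1) (fun w _ => h0 w) (fun w _ => h1 w) fun A _ => ind_le_one _)
        (by rw [Ex_const])
    nlinarith [h0 c, h1 c]
  · exact (key S hc).trans (h0 c)

lemma ind_and (P Q : Prop) : ind (P ∧ Q) = ind P * ind Q := by
  unfold ind; by_cases P <;> by_cases Q <;> simp [*]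

lemma Ex_mem2 {ι : Type*} (q : ι → ℝ) (S : Finset ι) (c c' : ι) (hcc : c ≠ c')
    (h0 : ∀ w, 0 ≤ q w) (h1 : ∀ w, q w ≤ 1) :
    Ex q S (fun A => ind (c ∈ A ∧ c' ∈ A)) ≤ q c * q c' := by
  simp only [ind_and]
  rw [Ex_indep q S {c} {c'} (by simpa using hcc) (fun A => ind (c ∈ A)) (fun A => ind (c' ∈ A))
    (fun A => by simp) (fun A => by simp)]
  exact mul_le_mul (Ex_mem q S c h0 h1) (Ex_mem q S c' h0 h1)
    (Ex_nonneg q S _ (fun w _ => h0 w) (fun w _ => h1 w) fun A _ => ind_nonneg _) (h0 c)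

section
variable {V C : Type} [Fintype V] [Fintype C] {o : C → V} {H : SimpleGraph C} {ℓ D k : ℝ}
  {ph Λ e P : ℝ}

def ow (o : C → V) : V ⊕ (C × C) → Finset V
  | Sum.inl v => {v}
  | Sum.inr j => {o j.1, o j.2}

lemma finalLLL (E : Env o H ℓ D k) (W : Finset V) (p : C → ℝ) (ψ : ℝ)
    (I : NInv o H ℓ ph Λ W p ψ e P) (hΛ0 : 0 < Λ) (hψ : 0 < ψ) (he : 288 * e ≤ ψ ^ 2)
    (hph : 3 * ph ≤ ψ) : Col o H W p := by
  have hℓ : 0 < ℓ := by linarith [E.l1]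
  set x := 3 / ψ with hx
  have hx0 : 0 < x := by positivity
  have hq0 : ∀ c, 0 ≤ x * p c := fun c => mul_nonneg hx0.le (I.p0 c)
  have hq1 : ∀ c, x * p c ≤ 1 := by
    intro c
    rw [hx, div_mul_eq_mul_div, div_le_one hψ]
    linarith [I.hi c]
  have hxe : x ^ 2 * e ≤ 1 / 32 := by
    rw [hx, div_pow, div_mul_eq_mul_div, div_le_iff₀ (by positivity)]; linarith
  have hsum : ∀ v ∈ W, ψ ≤ ∑ c ∈ Ls o v, p c := by
    intro v hv
    refine (I.psi v hv).trans (Finset.sum_le_sum fun c _ => ?_)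
    by_cases h : p c = 0
    · simp [h]
    · refine mul_le_of_le_one_right (I.p0 c) ?_
      unfold hh
      have h1 := I.lo c h
      rw [div_le_iff₀ hℓ] at h1
      have := div_nonneg (Real.log_nonneg h1) hΛ0.le
      linarith
  let Ev : V ⊕ (C × C) → Finset C → Prop := fun i A => match i with
    | Sum.inl v => v ∈ W ∧ Disjoint A (Ls o v)
    | Sum.inr j => H.Adj j.1 j.2 ∧ j.1 ∈ A ∧ j.2 ∈ A
  let sc : V ⊕ (C × C) → Finset C := fun i => univ.filter fun c => o c ∈ ow o i
  let F : V → Finset (V ⊕ (C × C)) := fun v => univ.filter fun i => v ∈ ow o i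
  let Γ : V ⊕ (C × C) → Finset (V ⊕ (C × C)) := fun i => (ow o i).biUnion F
  let pr : V ⊕ (C × C) → ℝ := fun j => Ex (fun c => x * p c) (spt p) (fun A => ind (Ev j A))
  have hpr0 : ∀ j, 0 ≤ pr j := fun j => Ex_nonneg _ _ _ (fun w _ => hq0 w) (fun w _ => hq1 w)
    fun A _ => ind_nonneg _
  have hprl : ∀ v, pr (Sum.inl v) ≤ 1 / 16 := by
    intro v
    by_cases hv : v ∈ W
    · have h1 : pr (Sum.inl v) = Ex (fun c => x * p c) (spt p) (fun A => ind (Disjoint A (Ls o v))) := by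
        simp only [pr, Ev, hv, true_and]
      rw [h1]
      refine (Ex_disj _ _ _ (fun w _ => hq0 w) (fun w _ => hq1 w)).trans ?_
      rw [sum_sup (Ls o v) (fun c => x * p c) (fun c hc => by simp [hc]), ← Finset.mul_sum]
      have h3 : 3 ≤ x * ∑ c ∈ Ls o v, p c := by
        have := mul_le_mul_of_nonneg_left (hsum v hv) hx0.le
        rwa [hx, div_mul_cancel₀ _ hψ.ne', ← hx] at this
      refine (Real.exp_le_exp.2 (neg_le_neg h3)).trans ?_
      rw [Real.exp_neg, inv_le_comm₀ (Real.exp_pos _) (by norm_num)]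
      have h4 : Real.exp 3 = Real.exp 1 ^ 3 := by rw [← Real.exp_nat_mul]; norm_num
      have h5 := Real.exp_one_gt_d9
      rw [h4]
      have : (2.7 : ℝ) ^ 3 ≤ Real.exp 1 ^ 3 := pow_le_pow_left₀ (by norm_num) (by linarith) 3
      norm_num at this ⊢
      linarith
    · have h1 : pr (Sum.inl v) = 0 := by
        simp only [pr, Ev, hv, false_and]
        rw [ind_false (by simp)]; exact Ex_const _ _ _
      rw [h1]; norm_num
  let g : C → C → ℝ := fun c c' => if H.Adj c c' then (x * p c) * (x * p c') else 0
  have hg0 : ∀ c c', 0 ≤ g c c' := fun c c' => by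
    simp only [g]; split_ifs; exacts [mul_nonneg (hq0 c) (hq0 c'), le_rfl]
  have hprr : ∀ c c', pr (Sum.inr (c, c')) ≤ g c c' := by
    intro c c'
    by_cases h : H.Adj c c'
    · simp only [pr, Ev, g, h, true_and, if_true]
      exact Ex_mem2 (fun c => x * p c) _ c c' h.ne hq0 hq1
    · simp only [pr, Ev, g, h, false_and, if_false]
      rw [ind_false (by simp)]; exact (Ex_const _ _ _).le
  have hgs : ∀ v, ∑ c, ∑ c', (if o c = v then g c c' else 0) ≤ 1 / 32 := by
    intro v
    have : ∑ c, ∑ c', (if o c = v then g c c' else 0) = x ^ 2 * ∑ c ∈ Ls o v, p c * sm H p c := by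
      simp only [Ls, Finset.sum_filter, Finset.mul_sum]
      refine Finset.sum_congr rfl fun c _ => ?_
      by_cases h : o c = v
      · simp only [h, if_true, sm, Nb, Finset.sum_filter, Finset.mul_sum, g]
        refine Finset.sum_congr rfl fun c' _ => ?_
        split_ifs <;> ring
      · simp [h]
    rw [this]
    exact (mul_le_mul_of_nonneg_left (I.he v) (by positivity)).trans hxe
  have hF : ∀ v, ∑ j ∈ F v, pr j ≤ 1 / 8 := by
    intro v
    simp only [F, Finset.sum_filter]
    rw [Fintype.sum_sum_type, Fintype.sum_prod_type]
    have h1 : ∑ u, (if v ∈ ow o (Sum.inl u) then pr (Sum.inl u) else 0) ≤ 1 / 16 := by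
      simp only [ow, mem_singleton]
      rw [Finset.sum_ite_eq]; simp only [mem_univ, if_true]; exact hprl v
    have h2 : ∑ c, ∑ c', (if v ∈ ow o (Sum.inr (c, c')) then pr (Sum.inr (c, c')) else 0) ≤
        ∑ c, ∑ c', (if o c = v then g c c' else 0) + ∑ c, ∑ c', (if o c = v then g c c' else 0) := by
      nth_rewrite 3 [Finset.sum_comm]
      rw [← Finset.sum_add_distrib]
      refine Finset.sum_le_sum fun c _ => ?_
      rw [← Finset.sum_add_distrib]
      refine Finset.sum_le_sum fun c' _ => ?_
      have hs : g c' c = g c c' := by simp only [g, H.adj_comm, mul_comm]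
      have := hprr c c'
      have := hg0 c c'
      simp only [ow, mem_insert, mem_singleton, hs]
      by_cases a : o c = v <;> by_cases b : o c' = v <;> simp [a, b, Ne.symm, eq_comm] <;>
        (try simp only [eq_comm] at a b) <;> grind
    linarith [hgs v]
  obtain ⟨A, hA, hEA⟩ := LLL (fun c => x * p c) (spt p) (fun w _ => hq0 w) (fun w _ => hq1 w) Ev sc
    (by
      rintro (v | ⟨c, c'⟩) A
      · simp only [Ev]
        refine and_congr_right fun _ => ?_
        have : A ∩ sc (Sum.inl v) = A ∩ Ls o v := by ext; simp [sc, ow, Ls]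
        rw [this, Finset.disjoint_iff_inter_eq_empty, Finset.disjoint_iff_inter_eq_empty,
          Finset.inter_assoc, Finset.inter_self]
      · simp only [Ev, sc, ow, mem_inter, mem_filter, mem_univ, true_and, mem_insert, mem_singleton,
          true_or, or_true, and_true])
    Γ
    (by
      intro i j hj
      rw [Finset.disjoint_left]
      intro c hc hc'
      exact hj (mem_biUnion.2 ⟨o c, (mem_filter.1 hc).2, mem_filter.2 ⟨mem_univ _, (mem_filter.1 hc').2⟩⟩))
    (by
      intro i
      have : (ow o i).Nonempty := by rcases i with v | j <;> simp [ow]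
      obtain ⟨v, hv⟩ := this
      exact mem_biUnion.2 ⟨v, hv, mem_filter.2 ⟨mem_univ _, hv⟩⟩)
    (by
      intro i
      have h1 : ∑ j ∈ Γ i, pr j ≤ ∑ v ∈ ow o i, ∑ j ∈ F v, pr j := by
        rw [← Finset.sum_finset_product' (((ow o i) ×ˢ univ).filter fun z => z.2 ∈ F z.1) (ow o i) F
          (by simp) (f := fun _ j => pr j)]
        have : Γ i = (((ow o i) ×ˢ univ).filter fun z => z.2 ∈ F z.1).image Prod.snd := by
          ext j; simp [Γ]
        rw [this]
        exact Finset.sum_image_le_of_nonneg (fun j _ => hpr0 j) |>.trans le_rfl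
      refine h1.trans ?_
      refine (Finset.sum_le_card_nsmul _ _ (1 / 8) fun v _ => hF v).trans ?_
      have : (ow o i).card ≤ 2 := by
        rcases i with v | j
        · simp [ow]
        · exact Finset.card_le_two
      rw [nsmul_eq_mul]
      have : ((ow o i).card : ℝ) ≤ 2 := by exact_mod_cast this
      linarith)
  have hch : ∀ v, v ∈ W → ∃ c, c ∈ A ∧ c ∈ Ls o v := by
    intro v hv
    have := hEA (Sum.inl v)
    simp only [Ev, hv, true_and] at this
    exact Finset.not_disjoint_iff.1 this
  by_cases hC : Nonempty C
  · choose! φ h1 h2 using hch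
    refine ⟨φ, fun v hv => ⟨mem_Ls.1 (h2 v hv), mem_spt.1 (hA (h1 v hv))⟩, fun u hu w hw hadj => ?_⟩
    exact hEA (Sum.inr (φ u, φ w)) ⟨hadj, h1 u hu, h1 w hw⟩
  · have hV : IsEmpty V := by
      by_contra hV
      rw [not_isEmpty_iff] at hV
      obtain ⟨v⟩ := hV
      have h1 := E.lst v
      have h2 : Ls o v = ∅ := by
        ext c; exact (hC ⟨c⟩).elim
      rw [h2] at h1
      simp at h1
      linarith
    exact ⟨fun v => hV.elim v, fun v => hV.elim v, fun v => hV.elim v⟩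
end

section
variable {V C : Type} [Fintype V] [Fintype C] {o : C → V} {H : SimpleGraph C} {ℓ D k : ℝ}
  {η β ph Λ e P : ℝ}

lemma NInv.mono {W : Finset V} {p : C → ℝ} {ψ ψ' e' P' : ℝ} (I : NInv o H ℓ ph Λ W p ψ e P)
    (h1 : ψ' ≤ ψ) (h2 : e ≤ e') (h3 : P ≤ P') : NInv o H ℓ ph Λ W p ψ' e' P' :=
  ⟨I.p0, I.lo, I.hi, I.inW, fun v hv => h1.trans (I.psi v hv), fun v => (I.he v).trans h2,
    fun v => (I.hP v).trans h3⟩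

lemma estep {ψ t σ : ℝ} (hη0 : 0 < η) (hη1 : η ≤ 1) (hβ0 : 0 < β)
    (hΛ0 : 0 < Λ) (hβΛ : 2 * (β * Λ) ≤ 1) (hk : 0 ≤ k) (hph : 0 ≤ ph) (he0 : 0 ≤ e) (heΛ : e ≤ Λ)
    (hP2 : P ≤ 2) (hψ0 : 0 ≤ ψ) (hψ1 : ψ ≤ 1)
    (hd : 2 * η ^ 2 + β * η + η * ph + 2 * η ^ 2 * Λ ≤ 1)
    (hσ : Λ * (2 * η ^ 2 + β * η + η * ph + 2 * η ^ 2 * Λ) + 8 * β * Λ ^ 2 + 24 * k * η * ph ^ 2 + t ≤ σ) :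
    ((1 + 4 * (β * Λ)) * (e + 2 * k * η * ph ^ 2 * P)) *
        (1 - η * (ψ - η * e / Λ) + β * η + η ^ 2 + η * ph + 2 * η ^ 2 * e) + t ≤ e - η * ψ * e + σ := by
  set y := e / Λ with hy
  have hy0 : 0 ≤ y := by positivity
  have hy1 : y ≤ 1 := by rw [hy, div_le_one hΛ0]; exact heΛ
  have e1 : η * e / Λ = η * y := by rw [hy]; ring
  rw [e1]
  set d := 2 * η ^ 2 + β * η + η * ph + 2 * η ^ 2 * Λ with hdd
  set G := 1 - η * (ψ - η * y) + β * η + η ^ 2 + η * ph + 2 * η ^ 2 * e with hG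
  have hη2 : 0 < η ^ 2 := by positivity
  have hG1 : G ≤ 1 - η * ψ + d := by
    have : η ^ 2 * y ≤ η ^ 2 := mul_le_of_le_one_right hη2.le hy1
    have : η ^ 2 * e ≤ η ^ 2 * Λ := mul_le_mul_of_nonneg_left heΛ hη2.le
    rw [hG, hdd]; linarith
  have hηψ : η * ψ ≤ 1 := mul_le_one₀ hη1 hψ0 hψ1
  have hηψ0 : 0 ≤ η * ψ := by positivity
  have hG0 : 0 ≤ G := by
    have h1 : 0 ≤ η * (η * y) := by positivity
    have h2 : 0 ≤ β * η := by positivity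
    have h3 : 0 ≤ η * ph := by positivity
    have h4 : 0 ≤ 2 * η ^ 2 * e := by positivity
    rw [hG]; linarith [sq_nonneg η]
  have hd0 : 0 ≤ d := by rw [hdd]; positivity
  set K := k * η * ph ^ 2 with hK
  have hK0 : 0 ≤ K := by positivity
  have hE1 : (1 + 4 * (β * Λ)) * (e + 2 * k * η * ph ^ 2 * P) ≤ e + (4 * β * Λ ^ 2 + 12 * K) := by
    have h1 : 2 * k * η * ph ^ 2 * P ≤ 4 * K := by
      have : 2 * k * η * ph ^ 2 * P = 2 * K * P := by rw [hK]; ring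
      rw [this]; linarith [mul_le_mul_of_nonneg_left hP2 hK0]
    have h2 : 0 ≤ β * Λ := by positivity
    have h3 : β * Λ * e ≤ β * Λ * Λ := mul_le_mul_of_nonneg_left heΛ h2
    have h4 : (1 + 4 * (β * Λ)) * (e + 2 * k * η * ph ^ 2 * P) ≤ (1 + 4 * (β * Λ)) * (e + 4 * K) := by
      apply mul_le_mul_of_nonneg_left <;> linarith
    have h5 : β * Λ * K ≤ 1 / 2 * K := mul_le_mul_of_nonneg_right (by linarith) hK0
    linarith
  set r := 4 * β * Λ ^ 2 + 12 * K with hr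
  have hr0 : 0 ≤ r := by rw [hr]; positivity
  have h1 : ((1 + 4 * (β * Λ)) * (e + 2 * k * η * ph ^ 2 * P)) * G ≤ (e + r) * G :=
    mul_le_mul_of_nonneg_right hE1 hG0
  have h2 : e * G ≤ e * (1 - η * ψ + d) := mul_le_mul_of_nonneg_left hG1 he0
  have h3 : r * G ≤ r * 2 := mul_le_mul_of_nonneg_left (by linarith) hr0
  have h4 : e * d ≤ Λ * d := mul_le_mul_of_nonneg_right heΛ hd0
  have h5 : 2 * r = 8 * β * Λ ^ 2 + 24 * k * η * ph ^ 2 := by rw [hr, hK]; ring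
  linarith

set_option maxHeartbeats 800000 in
theorem nibble (E : Env o H ℓ D k) (hk : 0 ≤ k) (t ζ ψs σ τ : ℝ) (T : ℕ)
    (hΛ : ph * ℓ = Real.exp Λ) (hη0 : 0 < η) (hη1 : η ≤ 1)
    (hβ0 : 0 < β) (hβ1 : β ≤ 1) (hηβ : 6 * (η * ph) ≤ β) (hΛ0 : 0 < Λ) (hβΛ : 2 * (β * Λ) ≤ 1)
    (hζ1 : Real.exp (-(β / ph * t)) ≤ ζ) (hζ2 : Real.exp (-(2 * β / (3 * D * ph ^ 2) * t)) ≤ ζ)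
    (hζ : 12 * ζ * (ℓ * D + 1) ^ 4 ≤ 1) (ht : 0 ≤ t) (hψs : 0 < ψs)
    (hD : D / ℓ ≤ Λ / 2 * (1 - 2 * ψs ^ 2))
    (hd : 2 * η ^ 2 + β * η + η * ph + 2 * η ^ 2 * Λ ≤ 1)
    (hσ : Λ * (2 * η ^ 2 + β * η + η * ph + 2 * η ^ 2 * Λ) + 8 * β * Λ ^ 2 + 24 * k * η * ph ^ 2 + t ≤ σ)
    (hτ : 2 * β * η * Λ + t ≤ τ) (hT1 : T * (σ + Λ * τ) ≤ Λ * ψs ^ 2 / 2) (hT2 : T * τ ≤ 1)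
    (hτ2 : τ ≤ ψs / 2) (hT3 : Λ * Real.exp (-(η * ψs * T)) ≤ ψs ^ 2 / 576)
    (hT4 : T * σ ≤ ψs ^ 2 / 576) (hph3 : 3 * ph ≤ ψs) : Col o H univ (fun _ => 1 / ℓ) := by
  have hℓ : 0 < ℓ := by linarith [E.l1]
  have hph : 0 < ph := by
    have := Real.exp_pos Λ
    rw [← hΛ] at this
    exact pos_of_mul_pos_left this hℓ.le
  have hτ0 : 0 ≤ τ := le_trans (by positivity) hτ
  have hσ0 : 0 ≤ σ := le_trans (by positivity) hσ
  have hD1 : 1 ≤ D / ℓ := by rw [le_div_iff₀ hℓ]; linarith [E.lD]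
  have hψs1 : ψs < 1 := by
    by_contra h
    push Not at h
    have : 1 ≤ ψs ^ 2 := by nlinarith only [h]
    nlinarith only [this, hD, hD1, hΛ0]
  have key : ∀ i : ℕ, i ≤ T → ∃ (W : Finset V) (p : C → ℝ) (ψ e P : ℝ), NInv o H ℓ ph Λ W p ψ e P ∧
      (Col o H W p → Col o H univ (fun _ => 1 / ℓ)) ∧ 0 ≤ P ∧ P ≤ 1 + i * τ ∧ 0 ≤ ψ ∧ ψ ≤ 1 ∧ 0 ≤ e ∧
      e ≤ Λ * (1 - η * ψs) ^ i + i * σ ∧ Λ * ψs ^ 2 - i * (σ + Λ * τ) ≤ Λ * ψ ^ 2 / 2 - e := by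
    intro i
    induction i with
    | zero =>
      intro _
      refine ⟨univ, fun _ => 1 / ℓ, 1, D / ℓ, 1, ⟨fun c => by positivity, fun c _ => le_rfl, fun c => ?_,
        fun c _ => mem_univ _, fun v _ => ?_, fun v => ?_, fun v => ?_⟩, id, zero_le_one, by simp,
        zero_le_one, le_rfl, by linarith, ?_, ?_⟩
      · rw [div_le_iff₀ hℓ, hΛ]; exact Real.one_le_exp hΛ0.le
      · rw [Finset.sum_const, nsmul_eq_mul, E.lst v, hh]
        simp [hℓ.ne']
      · have : ∀ c ∈ Ls o v, 1 / ℓ * sm H (fun _ => 1 / ℓ) c ≤ 1 / ℓ * (D / ℓ) := by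
          intro c _
          refine mul_le_mul_of_nonneg_left ?_ (by positivity)
          rw [sm, Finset.sum_const, nsmul_eq_mul, mul_one_div]
          gcongr
          exact E.deg c
        refine (Finset.sum_le_sum this).trans ?_
        rw [Finset.sum_const, nsmul_eq_mul, E.lst v]
        apply le_of_eq; field_simp
      · rw [Finset.sum_const, nsmul_eq_mul, E.lst v]
        apply le_of_eq; field_simp
      · simp; nlinarith only [sq_nonneg ψs, hD, hΛ0]
      · simp; linarith
    | succ i ih =>
      intro hi
      obtain ⟨W, p, ψ, e, P, I, hcol, hP0, hP1, hψ0, hψ1, he0, he1, hinv⟩ := ih (by omega)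
      have hiT : (i : ℝ) ≤ T := by exact_mod_cast (by omega : i ≤ T)
      have hP2 : P ≤ 2 := by linarith [mul_le_mul_of_nonneg_right hiT hτ0]
      have hiσ : (i : ℝ) * (σ + Λ * τ) ≤ Λ * ψs ^ 2 / 2 :=
        (mul_le_mul_of_nonneg_right hiT (by positivity)).trans hT1
      have hψe : Λ * ψs ^ 2 / 2 + e ≤ Λ * ψ ^ 2 / 2 := by linarith
      have hψψs : ψs ≤ ψ := by
        have : Λ * ψs ^ 2 ≤ Λ * ψ ^ 2 := by linarith
        have := le_of_mul_le_mul_left this hΛ0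
        exact le_of_sq_le_sq this hψ0
      have heΛ : e / Λ ≤ ψ / 2 := by
        rw [div_le_iff₀ hΛ0]
        have : 0 ≤ Λ * ψs ^ 2 := by positivity
        have h2 : Λ * ψ ^ 2 ≤ Λ * ψ := by
          apply mul_le_mul_of_nonneg_left _ hΛ0.le; nlinarith only [hψ0, hψ1]
        linarith
      have heΛ' : e ≤ Λ := by rw [div_le_iff₀ hΛ0] at heΛ; nlinarith only [heΛ, hψ1, hΛ0]
      have hye : η * e / Λ = η * (e / Λ) := by ring
      have hy0 : 0 ≤ e / Λ := by positivity
      have hyη : η * (e / Λ) ≤ ψ / 2 := (mul_le_of_le_one_left hy0 hη1).trans heΛ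
      obtain ⟨W', p', I', hcol'⟩ := step E W p ψ t ζ I hΛ hη0 hη1 hβ0 hβ1 hηβ hΛ0 hβΛ he0 hP0
        (by rw [hye]; linarith) hψ1 hζ1 hζ2 hζ
      have hβe : 2 * β * η * e ≤ 2 * β * η * Λ := mul_le_mul_of_nonneg_left heΛ' (by positivity)
      refine ⟨W', p', ψ - η * e / Λ - τ, e - η * ψ * e + σ, P + τ, I'.mono (by linarith)
        (estep hη0 hη1 hβ0 hΛ0 hβΛ hk hph.le he0 heΛ' hP2 hψ0 hψ1 hd hσ) (by linarith), hcol ∘ hcol',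
        by linarith, by push_cast; linarith, ?_, ?_, ?_, ?_, ?_⟩
      · rw [hye]; linarith
      · rw [hye]; linarith [mul_nonneg hη0.le hy0]
      · have : η * ψ ≤ 1 := mul_le_one₀ hη1 hψ0 hψ1
        linarith [mul_le_mul_of_nonneg_right this he0]
      · have h1 : e - η * ψ * e ≤ e * (1 - η * ψs) := by
          have : η * ψs * e ≤ η * ψ * e := by gcongr
          linarith
        have h2 : 0 ≤ 1 - η * ψs := by linarith [mul_le_one₀ hη1 hψs.le hψs1.le]
        have h3 : e * (1 - η * ψs) ≤ (Λ * (1 - η * ψs) ^ i + i * σ) * (1 - η * ψs) :=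
          mul_le_mul_of_nonneg_right he1 h2
        have h4 : i * σ * (1 - η * ψs) ≤ i * σ := by
          apply mul_le_of_le_one_right (by positivity)
          have : 0 ≤ η * ψs := by positivity
          linarith
        push_cast
        rw [pow_succ]
        linarith
      · have h1 : Λ * (η * e / Λ) = η * e := by field_simp
        have h2 : ψ * τ ≤ τ := mul_le_of_le_one_left hτ0 hψ1
        have h3 : Λ * (ψ * τ) ≤ Λ * τ := mul_le_mul_of_nonneg_left h2 hΛ0.le
        have h4 : Λ * (ψ - η * e / Λ - τ) ^ 2 / 2 =
          Λ * ψ ^ 2 / 2 - ψ * (Λ * (η * e / Λ)) - Λ * (ψ * τ) + Λ * (η * e / Λ + τ) ^ 2 / 2 := by ring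
        have h5 : 0 ≤ Λ * (η * e / Λ + τ) ^ 2 / 2 := by positivity
        rw [h4, h1]
        push_cast
        linarith
  obtain ⟨W, p, ψ, e, P, I, hcol, hP0, hP1, hψ0, hψ1, he0, he1, hinv⟩ := key T le_rfl
  have hψψs : ψs ≤ ψ := by
    have : Λ * ψs ^ 2 ≤ Λ * ψ ^ 2 := by linarith
    have := le_of_mul_le_mul_left this hΛ0
    exact le_of_sq_le_sq this hψ0
  refine hcol (finalLLL E W p ψ I hΛ0 (by linarith) ?_ (by linarith))
  have h2 : 0 ≤ 1 - η * ψs := by linarith [mul_le_one₀ hη1 hψs.le hψs1.le]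
  have h1 : (1 - η * ψs) ^ T ≤ Real.exp (-(η * ψs * T)) := by
    have h3 : 1 - η * ψs ≤ Real.exp (-(η * ψs)) := by linarith [Real.add_one_le_exp (-(η * ψs))]
    refine (pow_le_pow_left₀ h2 h3 T).trans ?_
    rw [← Real.exp_nat_mul]
    apply le_of_eq; congr 1; ring
  have h4 := mul_le_mul_of_nonneg_left h1 hΛ0.le
  have h5 : ψs ^ 2 ≤ ψ ^ 2 := by gcongr
  linarith
end


lemma ev_pow_exp (n : ℕ) (b c : ℝ) (hb : 0 < b) (hc : 0 < c) :
    ∀ᶠ M : ℝ in Filter.atTop, M ^ n * Real.exp (-(b * M)) ≤ c := by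
  have h := (Real.tendsto_pow_mul_exp_neg_atTop_nhds_zero n).comp
    (Filter.tendsto_id.const_mul_atTop hb : Filter.Tendsto (fun M : ℝ => b * M) Filter.atTop Filter.atTop)
  have h2 : ∀ᶠ M : ℝ in Filter.atTop, (b * M) ^ n * Real.exp (-(b * M)) < b ^ n * c :=
    h.eventually (gt_mem_nhds (by positivity))
  filter_upwards [h2] with M hM
  rw [mul_pow, mul_assoc] at hM
  exact (lt_of_mul_lt_mul_left hM (by positivity)).le

set_option maxHeartbeats 1000000 in
lemma theorem2 (a : ℝ) (ha0 : 0 < a) (ha1 : a < 1) : ∃ M0 : ℝ, ∀ M, M0 ≤ M →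
    ∀ (V C : Type) [Fintype V] [Fintype C] (o : C → V) (H : SimpleGraph C) (ℓ D k : ℝ),
      Env o H ℓ D k → 1 ≤ k → Real.sqrt k * Real.exp M ≤ 2 * ℓ → D / ℓ ≤ M / 4 * (1 - a) →
      Col o H univ (fun _ => 1 / ℓ) := by
  set b := a / 2 with hb
  set κ := b / 8 with hκ
  set ψs := Real.sqrt a / 2 with hψs
  have hsa : 0 < Real.sqrt a := Real.sqrt_pos.2 ha0
  have hsa1 : Real.sqrt a ≤ 1 := Real.sqrt_le_one.2 ha1.le
  have hψ0 : 0 < ψs := by positivity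
  have hψ2 : ψs ^ 2 = a / 4 := by rw [hψs, div_pow, Real.sq_sqrt ha0.le]; norm_num
  have hψ1 : ψs ≤ 1 / 2 := by linarith
  have hκ0 : 0 < κ := by positivity
  have h1 := ev_pow_exp 4 κ (ψs ^ 2 / 40000) hκ0 (by positivity)
  have h2 := ev_pow_exp 1 ψs (ψs ^ 2 / 576) hψ0 (by positivity)
  obtain ⟨M0, hM0⟩ := Filter.eventually_atTop.1 (h1.and h2)
  refine ⟨max M0 4, fun M hM V C _ _ o H ℓ D k E hk hℓM hD => ?_⟩
  obtain ⟨c1, c2⟩ := hM0 M (le_trans (le_max_left _ _) hM)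
  have hM4 : 4 ≤ M := le_trans (le_max_right _ _) hM
  clear hM0 h1 h2
  set η := Real.exp (-(κ * M)) with hη
  have hη0 : 0 < η := Real.exp_pos _
  have hℓ : 1 ≤ ℓ := E.l1
  have hℓ0 : 0 < ℓ := by linarith
  set Λ := M / 2 * (1 - b) with hΛ
  set ph := Real.exp Λ / ℓ with hph
  have hph0 : 0 < ph := by positivity
  have hsk : 1 ≤ Real.sqrt k := Real.one_le_sqrt.2 hk
  have hℓe : Real.exp M ≤ 2 * ℓ := le_trans (le_mul_of_one_le_left (Real.exp_pos _).le hsk) hℓM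
  have hΛM : Λ ≤ M / 2 := by rw [hΛ, hb]; nlinarith
  have hΛ4 : M / 4 ≤ Λ := by rw [hΛ, hb]; nlinarith
  have hψsq : ψs ^ 2 ≤ 1 / 4 := by rw [hψ2]; linarith
  have hM4' : 256 ≤ M ^ 4 := by
    have := pow_le_pow_left₀ (by norm_num) hM4 4; norm_num at this; exact this
  have hη1 : η ≤ 1 / 1000 := by
    by_contra h; push Not at h
    have : 256 * (1 / 1000) ≤ M ^ 4 * η := mul_le_mul hM4' h.le (by norm_num) (by positivity)
    linarith
  have e2 : 2 ≤ Real.exp (M / 4) := by linarith [Real.add_one_le_exp (M / 4)]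
  have hη4 : η ^ 4 = Real.exp (-(4 * κ * M)) := by
    rw [hη, ← Real.exp_nat_mul]; congr 1; push_cast; ring
  have hη4' : Real.exp (-(M / 4)) ≤ η ^ 4 := by
    rw [hη4]; apply Real.exp_le_exp.2
    rw [hκ, hb]; nlinarith
  have hphη : ph ≤ η ^ 4 := by
    refine le_trans ?_ hη4'
    rw [hph, div_le_iff₀ hℓ0]
    have h1 : Real.exp (-(M / 4)) * Real.exp M ≤ Real.exp (-(M / 4)) * (2 * ℓ) :=
      mul_le_mul_of_nonneg_left hℓe (Real.exp_pos _).le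
    have h3 : Real.exp (M / 2) * Real.exp (M / 4) = Real.exp (-(M / 4)) * Real.exp M := by
      rw [← Real.exp_add, ← Real.exp_add]; congr 1; ring
    have h4 : Real.exp (M / 2) * 2 ≤ Real.exp (M / 2) * Real.exp (M / 4) :=
      mul_le_mul_of_nonneg_left e2 (Real.exp_pos _).le
    have h5 : Real.exp Λ ≤ Real.exp (M / 2) := Real.exp_le_exp.2 hΛM
    linarith
  have hkph : k * ph ^ 2 ≤ η ^ 4 := by
    refine le_trans ?_ hη4'
    rw [hph, div_pow, ← mul_div_assoc, div_le_iff₀ (by positivity)]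
    have h1 : k * Real.exp M ^ 2 ≤ 4 * ℓ ^ 2 := by
      have := pow_le_pow_left₀ (by positivity) hℓM 2
      rw [mul_pow, mul_pow, Real.sq_sqrt (by linarith)] at this
      linarith
    have h2 : Real.exp Λ ^ 2 ≤ Real.exp M := by
      rw [← Real.exp_nat_mul]; apply Real.exp_le_exp.2; push_cast; linarith
    have h3 : Real.exp M * 4 ≤ Real.exp (-(M / 4)) * Real.exp M ^ 2 := by
      have : Real.exp (-(M / 4)) * Real.exp M ^ 2 = Real.exp M * (Real.exp (M / 4) ^ 3) := by
        rw [← Real.exp_nat_mul, ← Real.exp_nat_mul, ← Real.exp_add, ← Real.exp_add]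
        congr 1; push_cast; ring
      rw [this]
      apply mul_le_mul_of_nonneg_left _ (Real.exp_pos _).le
      have := pow_le_pow_left₀ (by norm_num) e2 3
      linarith
    have h4 : k * Real.exp Λ ^ 2 * 4 ≤ Real.exp (-(M / 4)) * (k * Real.exp M ^ 2) := by
      calc k * Real.exp Λ ^ 2 * 4 ≤ k * (Real.exp M * 4) := by nlinarith
        _ ≤ k * (Real.exp (-(M / 4)) * Real.exp M ^ 2) := by gcongr
        _ = _ := by ring
    have h5 := mul_le_mul_of_nonneg_left h1 (Real.exp_pos (-(M / 4))).le
    linarith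
  have hM0 : 0 < M := by linarith
  have hM24 : M ^ 2 ≤ M ^ 4 := pow_le_pow_right₀ (by linarith) (by norm_num)
  have hM12 : M ≤ M ^ 2 := by nlinarith only [hM4]
  have hM34 : M ^ 3 ≤ M ^ 4 := pow_le_pow_right₀ (by linarith) (by norm_num)
  have q2 : M ^ 2 * η ≤ ψs ^ 2 / 40000 := (mul_le_mul_of_nonneg_right hM24 hη0.le).trans c1
  have q1 : M * η ≤ ψs ^ 2 / 40000 := (mul_le_mul_of_nonneg_right hM12 hη0.le).trans q2
  have q3 : M ^ 3 * η ≤ ψs ^ 2 / 40000 := (mul_le_mul_of_nonneg_right hM34 hη0.le).trans c1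
  have hηη : η ^ 2 ≤ η := by nlinarith only [hη0, hη1]
  have hη42 : η ^ 4 ≤ η ^ 2 := pow_le_pow_of_le_one hη0.le (by linarith) (by norm_num)
  have hη21 : η ^ 2 ≤ 1 / 1000 * η := by nlinarith only [hη0, hη1]
  have hη2p : 0 < η ^ 2 := by positivity
  have hMη2 : M * η ^ 2 ≤ M * η := mul_le_mul_of_nonneg_left hηη hM0.le
  have hηph : η * ph ≤ η ^ 2 := by
    calc η * ph ≤ 1 * ph := mul_le_mul_of_nonneg_right (by linarith) hph0.le
      _ ≤ η ^ 2 := by linarith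
  have hd1 : 2 * η ^ 2 + η ^ 2 * η + η * ph + 2 * η ^ 2 * Λ ≤ 2 * M * η ^ 2 := by
    have h1 : η ^ 2 * η ≤ η ^ 2 := mul_le_of_le_one_right hη2p.le (by linarith)
    have h2 : η ^ 2 * Λ ≤ η ^ 2 * (M / 2) := mul_le_mul_of_nonneg_left hΛM hη2p.le
    have h3 : η ^ 2 * 4 ≤ η ^ 2 * M := mul_le_mul_of_nonneg_left hM4 hη2p.le
    linarith
  have hΛ0 : 0 < Λ := by linarith
  have hD0 : 0 < D := by linarith [E.lD]
  have hDM : D ≤ M / 4 * ℓ := by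
    rw [div_le_iff₀ hℓ0] at hD
    have : M / 4 * (1 - a) * ℓ ≤ M / 4 * 1 * ℓ := by gcongr; linarith
    linarith
  set z := ℓ * Real.exp (-M) with hz
  have hz0 : 1 / 2 ≤ z := by
    have : Real.exp M * Real.exp (-M) ≤ 2 * ℓ * Real.exp (-M) :=
      mul_le_mul_of_nonneg_right hℓe (Real.exp_pos _).le
    rw [← Real.exp_add, add_neg_cancel, Real.exp_zero] at this
    linarith
  have hzℓ : ℓ = z * Real.exp M := by
    rw [hz, mul_assoc, ← Real.exp_add, neg_add_cancel, Real.exp_zero, mul_one]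
  set Y := ℓ * η ^ 4 / (Real.exp Λ ^ 2 * M) with hY
  have hexpΛ : 1 ≤ Real.exp Λ := Real.one_le_exp hΛ0.le
  have hYz : 50 * M * z ≤ Y := by
    have h1 : Real.exp Λ ^ 2 * Real.exp (b * M) = Real.exp M := by
      rw [← Real.exp_nat_mul, ← Real.exp_add]; congr 1; rw [hΛ]; push_cast; ring
    have h2 : η ^ 4 * η ^ 4 * Real.exp (b * M) = 1 := by
      rw [hη4, ← Real.exp_add, ← Real.exp_add, Real.exp_eq_one_iff, hκ]; ring
    have h3 : Y * (η ^ 4 * M) = z := by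
      rw [hY, hz, Real.exp_neg, ← h1]
      have h4 : Real.exp (b * M) = 1 / (η ^ 4 * η ^ 4) := by
        rw [eq_div_iff (by positivity)]; linarith
      rw [h4]; field_simp
    have h4 : (50 * M * z) * (η ^ 4 * M) ≤ z := by
      have h5 : η ^ 4 ≤ η := hη42.trans hηη
      have h6 : M ^ 2 * η ^ 4 ≤ M ^ 2 * η := mul_le_mul_of_nonneg_left h5 (by positivity)
      have h7 : M ^ 2 * η ^ 4 ≤ 1 / 50 := by linarith
      calc (50 * M * z) * (η ^ 4 * M) = 50 * z * (M ^ 2 * η ^ 4) := by ring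
        _ ≤ 50 * z * (1 / 50) := mul_le_mul_of_nonneg_left h7 (by linarith)
        _ = z := by ring
    rw [← h3] at h4
    have h8 := le_of_mul_le_mul_right h4 (by positivity)
    rwa [h3] at h8
  have hζ1 : Y ≤ η ^ 2 / ph * η ^ 2 := by
    have : η ^ 2 / ph * η ^ 2 = ℓ * η ^ 4 / Real.exp Λ := by rw [hph]; field_simp
    rw [this, hY]
    apply div_le_div_of_nonneg_left (by positivity) (by positivity)
    nlinarith only [hexpΛ, hM4, mul_le_mul hexpΛ hexpΛ zero_le_one (by linarith)]
  have hζ2 : Y ≤ 2 * η ^ 2 / (3 * D * ph ^ 2) * η ^ 2 := by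
    have : 2 * η ^ 2 / (3 * D * ph ^ 2) * η ^ 2 = ℓ * η ^ 4 / (Real.exp Λ ^ 2 * (3 * D / (2 * ℓ))) := by
      rw [hph]; field_simp
    rw [this, hY]
    apply div_le_div_of_nonneg_left (by positivity) (by positivity)
    apply mul_le_mul_of_nonneg_left _ (by positivity)
    rw [div_le_iff₀ (by positivity)]
    nlinarith only [hDM, hM0, hℓ0, mul_pos hM0 hℓ0]
  have hζ3 : 12 * Real.exp (-Y) * (ℓ * D + 1) ^ 4 ≤ 1 := by
    have h1 : ℓ * D + 1 ≤ M * ℓ ^ 2 := by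
      have : ℓ * D ≤ ℓ * (M / 4 * ℓ) := mul_le_mul_of_nonneg_left hDM hℓ0.le
      have h2 : 1 ≤ ℓ ^ 2 := one_le_pow₀ hℓ
      nlinarith only [this, h2, hM4]
    have h2 : M ≤ Real.exp M := by linarith [Real.add_one_le_exp M]
    have h3 : ℓ ≤ Real.exp (z + M) := by
      rw [hzℓ, Real.exp_add]
      exact mul_le_mul_of_nonneg_right (by linarith [Real.add_one_le_exp z]) (Real.exp_pos _).le
    have h4 : (12 : ℝ) ≤ Real.exp 3 := by
      have h4 : Real.exp 3 = Real.exp 1 ^ 3 := by rw [← Real.exp_nat_mul]; norm_num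
      have h5 := Real.exp_one_gt_d9
      rw [h4]
      have : (2.7 : ℝ) ^ 3 ≤ Real.exp 1 ^ 3 := pow_le_pow_left₀ (by norm_num) (by linarith) 3
      norm_num at this
      linarith
    have h5 : M * ℓ ^ 2 ≤ Real.exp (3 * M + 2 * z) := by
      have : Real.exp (3 * M + 2 * z) = Real.exp M * Real.exp (z + M) ^ 2 := by
        rw [← Real.exp_nat_mul, ← Real.exp_add]; congr 1; push_cast; ring
      rw [this]
      gcongr
    have h6 : (ℓ * D + 1) ^ 4 ≤ Real.exp (12 * M + 8 * z) := by
      have : Real.exp (12 * M + 8 * z) = Real.exp (3 * M + 2 * z) ^ 4 := by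
        rw [← Real.exp_nat_mul]; congr 1; push_cast; ring
      rw [this]
      exact pow_le_pow_left₀ (by positivity) (h1.trans h5) 4
    calc 12 * Real.exp (-Y) * (ℓ * D + 1) ^ 4 ≤ Real.exp 3 * Real.exp (-Y) * Real.exp (12 * M + 8 * z) := by
          gcongr
      _ = Real.exp (3 - Y + (12 * M + 8 * z)) := by rw [← Real.exp_add, ← Real.exp_add]; congr 1
      _ ≤ 1 := by
          rw [← Real.exp_zero]; apply Real.exp_le_exp.2
          nlinarith only [hYz, hz0, hM4, mul_le_mul_of_nonneg_left hz0 hM0.le]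
  set T := ⌈M ^ 2 / η⌉₊ with hT
  have hTl : M ^ 2 ≤ T * η := by
    have := Nat.le_ceil (M ^ 2 / η)
    rwa [div_le_iff₀ hη0] at this
  have hTu : T * η ≤ 2 * M ^ 2 := by
    have := (Nat.ceil_lt_add_one (by positivity : 0 ≤ M ^ 2 / η)).le
    have h2 : (T : ℝ) * η ≤ (M ^ 2 / η + 1) * η := mul_le_mul_of_nonneg_right this hη0.le
    rw [add_mul, div_mul_cancel₀ _ hη0.ne'] at h2
    linarith
  have hTη2 : ∀ y : ℝ, 0 ≤ y → T * (y * η ^ 2) ≤ 2 * M ^ 2 * y * η := by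
    intro y hy
    calc T * (y * η ^ 2) = (T * η) * (y * η) := by ring
      _ ≤ (2 * M ^ 2) * (y * η) := mul_le_mul_of_nonneg_right hTu (by positivity)
      _ = _ := by ring
  have hψψ : ψs ^ 2 ≤ ψs := by nlinarith only [hψ0, hψ1]
  refine nibble (η := η) (β := η ^ 2) (ph := ph) (Λ := Λ) E (by linarith) (η ^ 2) (Real.exp (-Y)) ψs
    (30 * M ^ 2 * η ^ 2) (2 * M * η ^ 2) T (by rw [hph]; field_simp) hη0 (by linarith) hη2p
    (by linarith) ?_ hΛ0 ?_ (Real.exp_le_exp.2 (neg_le_neg hζ1)) (Real.exp_le_exp.2 (neg_le_neg hζ2))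
    hζ3 hη2p.le hψ0 ?_ ?_ ?_ ?_ ?_ ?_ ?_ ?_ ?_ ?_
  · have : η * ph ≤ η * η ^ 4 := mul_le_mul_of_nonneg_left hphη hη0.le
    have h2 : η * η ^ 4 ≤ η * η ^ 2 := mul_le_mul_of_nonneg_left hη42 hη0.le
    have h3 : η * η ^ 2 ≤ 1 / 1000 * η ^ 2 := mul_le_mul_of_nonneg_right hη1 hη2p.le
    linarith
  · have : η ^ 2 * Λ ≤ η ^ 2 * (M / 2) := mul_le_mul_of_nonneg_left hΛM hη2p.le
    linarith
  · refine hD.trans ?_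
    rw [hψ2, hΛ, hb]; nlinarith [mul_nonneg hM0.le (sq_nonneg a)]
  · linarith
  · have h1 : Λ * (2 * η ^ 2 + η ^ 2 * η + η * ph + 2 * η ^ 2 * Λ) ≤ M / 2 * (2 * M * η ^ 2) :=
      mul_le_mul hΛM hd1 (by positivity) (by positivity)
    have h2 : Λ ^ 2 ≤ (M / 2) ^ 2 := pow_le_pow_left₀ hΛ0.le hΛM 2
    have h3 := mul_le_mul_of_nonneg_left h2 hη2p.le
    have h4 : k * ph ^ 2 * η ≤ η ^ 2 * 1 := mul_le_mul (hkph.trans hη42) (by linarith) hη0.le hη2p.le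
    have h5 : 16 * η ^ 2 ≤ M ^ 2 * η ^ 2 := mul_le_mul_of_nonneg_right (by nlinarith only [hM4]) hη2p.le
    linarith
  · have h1 : η ^ 2 * η * Λ ≤ η ^ 2 * 1 * (M / 2) := by gcongr; linarith
    have h3 : η ^ 2 * 4 ≤ η ^ 2 * M := mul_le_mul_of_nonneg_left hM4 hη2p.le
    linarith
  · have h1 : 30 * M ^ 2 * η ^ 2 + Λ * (2 * M * η ^ 2) ≤ (31 * M ^ 2) * η ^ 2 := by
      have : Λ * (2 * M * η ^ 2) ≤ M / 2 * (2 * M * η ^ 2) := mul_le_mul_of_nonneg_right hΛM (by positivity)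
      linarith
    have h2 := hTη2 (31 * M ^ 2) (by positivity)
    have h3 : (T : ℝ) * (30 * M ^ 2 * η ^ 2 + Λ * (2 * M * η ^ 2)) ≤ T * ((31 * M ^ 2) * η ^ 2) :=
      mul_le_mul_of_nonneg_left h1 (Nat.cast_nonneg _)
    have h4 : ψs ^ 2 ≤ Λ * ψs ^ 2 := by
      apply le_mul_of_one_le_left (by positivity); linarith
    have h5 : 2 * M ^ 2 * (31 * M ^ 2) * η = 62 * (M ^ 4 * η) := by ring
    rw [h5] at h2
    linarith [sq_nonneg ψs]
  · have h2 := hTη2 (2 * M) (by positivity)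
    have h5 : 2 * M ^ 2 * (2 * M) * η = 4 * (M ^ 3 * η) := by ring
    rw [h5] at h2
    linarith
  · linarith
  · have h1 : Real.exp (-(η * ψs * T)) ≤ Real.exp (-(ψs * M)) := by
      apply Real.exp_le_exp.2
      have : ψs * M ≤ ψs * (T * η) := mul_le_mul_of_nonneg_left (hM12.trans hTl) hψ0.le
      linarith
    rw [pow_one] at c2
    calc Λ * Real.exp (-(η * ψs * T)) ≤ M * Real.exp (-(ψs * M)) := by gcongr; linarith
      _ ≤ _ := c2
  · have h2 := hTη2 (30 * M ^ 2) (by positivity)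
    have h5 : 2 * M ^ 2 * (30 * M ^ 2) * η = 60 * (M ^ 4 * η) := by ring
    rw [h5] at h2
    linarith [sq_nonneg ψs]
  · have : η ≤ M * η := le_mul_of_one_le_left hη0.le (by linarith)
    linarith


lemma choose_ratio (N s : ℕ) (hs : s ≤ N) : ∀ t : ℕ, t ≤ s →
    ((N - t).choose (s - t) : ℝ) ≤ (N.choose s : ℝ) * ((s : ℝ) / N) ^ t := by
  intro t
  induction t with
  | zero => simp
  | succ t ih =>
    intro ht
    have ih := ih (by omega)
    obtain ⟨a, ha⟩ : ∃ a, N - t = a + 1 := ⟨N - t - 1, by omega⟩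
    obtain ⟨b, hb⟩ : ∃ b, s - t = b + 1 := ⟨s - t - 1, by omega⟩
    have h1 : N - (t + 1) = a := by omega
    have h2 : s - (t + 1) = b := by omega
    rw [h1, h2]
    rw [ha, hb] at ih
    have h3 : ((a : ℝ) + 1) * (a.choose b : ℝ) = ((a + 1).choose (b + 1) : ℝ) * (b + 1) := by
      exact_mod_cast Nat.add_one_mul_choose_eq a b
    have hN : (0 : ℝ) < N := by exact_mod_cast (by omega : 0 < N)
    have h4 : (b + 1 : ℝ) * N ≤ s * (a + 1) := by
      have : (b + 1) * N ≤ s * (a + 1) := by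
        have hN' : N = a + 1 + t := by omega
        have hs' : s = b + 1 + t := by omega
        have : b ≤ a := by omega
        rw [hN', hs']; nlinarith
      exact_mod_cast this
    have h5 : (a.choose b : ℝ) ≤ ((a + 1).choose (b + 1) : ℝ) * (s / N) := by
      have : (a.choose b : ℝ) = ((a + 1).choose (b + 1) : ℝ) * ((b + 1) / (a + 1)) := by
        rw [← mul_div_assoc, ← h3]; field_simp
      rw [this]
      apply mul_le_mul_of_nonneg_left _ (Nat.cast_nonneg _)
      rw [div_le_div_iff₀ (by positivity) hN]; exact h4
    rw [pow_succ, ← mul_assoc]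
    exact h5.trans (mul_le_mul_of_nonneg_right ih (by positivity))

lemma cnt_sup {C : Type*} (L T : Finset C) (s : ℕ) (hs : s ≤ L.card) (hT : T ⊆ L) :
    (((L.powersetCard s).filter (fun S => T ⊆ S)).card : ℝ) ≤
      (L.card.choose s : ℝ) * ((s : ℝ) / L.card) ^ T.card := by
  by_cases ht : T.card ≤ s
  · refine le_trans ?_ (choose_ratio L.card s hs T.card ht)
    have h : ((L.powersetCard s).filter (fun S => T ⊆ S)).card ≤ ((L \ T).powersetCard (s - T.card)).card := by
      apply Finset.card_le_card_of_injOn (fun S => S \ T)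
      · intro S hS
        have hS' := mem_filter.1 hS
        have h1 := mem_powersetCard.1 hS'.1
        refine mem_powersetCard.2 ⟨sdiff_subset_sdiff h1.1 (Subset.refl _), ?_⟩
        rw [card_sdiff_of_subset hS'.2, h1.2]
      · intro S hS S' hS' h
        have h1 := (mem_filter.1 hS).2
        have h2 := (mem_filter.1 hS').2
        simp only at h
        rw [← sdiff_union_of_subset h1, h, sdiff_union_of_subset h2]
    rw [card_powersetCard, card_sdiff_of_subset hT] at h
    exact_mod_cast h
  · have : (L.powersetCard s).filter (fun S => T ⊆ S) = ∅ := by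
      apply filter_eq_empty_iff.2
      intro S hS h
      have := card_le_card h
      rw [(mem_powersetCard.1 hS).2] at this
      omega
    rw [this]; simp; positivity

lemma hyper {C : Type*} (L M : Finset C) (s : ℕ) (hs : s ≤ L.card) (y ρ : ℝ) (hy : 0 ≤ y)
    (hρ : (s : ℝ) / L.card ≤ ρ) :
    ∑ S ∈ L.powersetCard s, (1 + y) ^ (S ∩ M).card ≤
      ((L.powersetCard s).card : ℝ) * Real.exp (ρ * y * (M ∩ L).card) := by
  have hρ0 : 0 ≤ ρ := le_trans (by positivity) hρ
  have h1 : ∀ S ∈ L.powersetCard s, (1 + y) ^ (S ∩ M).card =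
      ∑ T ∈ (M ∩ L).powerset, if T ⊆ S then y ^ T.card else 0 := by
    intro S hS
    have hS := (mem_powersetCard.1 hS).1
    rw [← Finset.sum_filter]
    have : (M ∩ L).powerset.filter (fun T => T ⊆ S) = (S ∩ M).powerset := by
      ext T
      simp only [mem_filter, mem_powerset, subset_inter_iff]
      exact ⟨fun h => ⟨h.2, h.1.1⟩, fun h => ⟨⟨h.2, h.1.trans hS⟩, h.1⟩⟩
    rw [this, add_comm, ← Finset.sum_pow_mul_eq_add_pow]
    simp
  rw [Finset.sum_congr rfl h1, Finset.sum_comm]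
  have h2 : ∀ T ∈ (M ∩ L).powerset, ∑ S ∈ L.powersetCard s, (if T ⊆ S then y ^ T.card else 0) ≤
      (L.card.choose s : ℝ) * ((ρ * y) ^ T.card * 1 ^ ((M ∩ L).card - T.card)) := by
    intro T hT
    rw [← Finset.sum_filter, Finset.sum_const, nsmul_eq_mul, one_pow, mul_one, mul_pow, ← mul_assoc]
    apply mul_le_mul_of_nonneg_right _ (by positivity)
    refine (cnt_sup L T s hs ((mem_powerset.1 hT).trans inter_subset_right)).trans ?_
    gcongr
  refine (Finset.sum_le_sum h2).trans ?_
  rw [← Finset.mul_sum, Finset.sum_pow_mul_eq_add_pow, card_powersetCard]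
  apply mul_le_mul_of_nonneg_left _ (Nat.cast_nonneg _)
  have : ρ * y + 1 ≤ Real.exp (ρ * y) := Real.add_one_le_exp _
  refine (pow_le_pow_left₀ (by positivity) this _).trans ?_
  rw [← Real.exp_nat_mul]
  apply le_of_eq; congr 1; ring

section
variable {V C : Type} [Fintype V] [Fintype C] {o : C → V} {H : SimpleGraph C}

def degS (o : C → V) (H : SimpleGraph C) (σ : V → Finset C) (c : C) : ℕ :=
  ((Nb H c).filter (fun c' => c' ∈ σ (o c'))).card
def badS (o : C → V) (H : SimpleGraph C) (D : ℝ) (σ : V → Finset C) (v : V) : Finset C :=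
  (σ v).filter (fun c => D < degS o H σ c)
def Om (o : C → V) (s : ℕ) (v : V) : Finset (Finset C) := (Ls o v).powersetCard s

lemma edges_le (hm : ∀ c c1 c2, H.Adj c c1 → H.Adj c c2 → o c1 = o c2 → c1 = c2)
    (σ : V → Finset C) (v : V) (B : Finset C) (hB : B ⊆ Ls o v) :
    ∑ c ∈ B, degS o H σ c ≤ ∑ u, (σ u ∩ B.biUnion (Nb H)).card := by
  unfold degS
  rw [← Finset.card_biUnion]
  · refine le_trans (card_le_card ?_) (Finset.card_biUnion_le (s := univ))
    intro c' hc'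
    obtain ⟨c, hc, h⟩ := mem_biUnion.1 hc'
    have h := mem_filter.1 h
    exact mem_biUnion.2 ⟨o c', mem_univ _, mem_inter.2 ⟨h.2, mem_biUnion.2 ⟨c, hc, h.1⟩⟩⟩
  · intro a ha b hb hab
    rw [Function.onFun, Finset.disjoint_left]
    intro c h1 h2
    have h1 := mem_Nb.1 (mem_filter.1 h1).1
    have h2 := mem_Nb.1 (mem_filter.1 h2).1
    exact hab (hm c a b h1.symm h2.symm (by rw [mem_Ls.1 (hB ha), mem_Ls.1 (hB hb)]))

lemma fail_count (hm : ∀ c c1 c2, H.Adj c c1 → H.Adj c c2 → o c1 = o c2 → c1 = c2)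
    (ho : ∀ c c', H.Adj c c' → o c ≠ o c') (s m : ℕ) (d D ρ θ : ℝ)
    (hs : ∀ v, s ≤ (Ls o v).card) (hρ : ∀ v, (s : ℝ) / (Ls o v).card ≤ ρ) (hρ0 : 0 ≤ ρ)
    (hd : ∀ c, ((Nb H c).card : ℝ) ≤ d) (hθ : 0 ≤ θ) (v : V) :
    (((Fintype.piFinset (Om o s)).filter (fun σ => m ≤ (badS o H D σ v).card)).card : ℝ) ≤
      ((Fintype.piFinset (Om o s)).card : ℝ) * (2 ^ s *
        Real.exp (ρ * (Real.exp θ - 1) * (m * d) - θ * (m * D))) := by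
  set y := Real.exp θ - 1 with hy
  have hy0 : 0 ≤ y := by linarith [Real.one_le_exp hθ]
  have hy1 : 1 + y = Real.exp θ := by rw [hy]; ring
  let NB : Finset C → Finset C := fun B => B.biUnion (Nb H)
  let f : Finset C → V → Finset C → ℝ := fun B u S => (if u = v then ind (B ⊆ S) else 1) * (1 + y) ^ (S ∩ NB B).card
  have hf0 : ∀ B u S, 0 ≤ f B u S := by
    intro B u S
    simp only [f]
    apply mul_nonneg _ (by positivity)
    split_ifs; exacts [ind_nonneg _, zero_le_one]
  have hfp : ∀ (B : Finset C) (σ : V → Finset C), B ⊆ σ v → ∏ u, f B u (σ u) = Real.exp (θ * ∑ u, ((σ u ∩ NB B).card : ℝ)) := by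
    intro B σ h
    rw [Finset.mul_sum, Real.exp_sum]
    refine Finset.prod_congr rfl fun u _ => ?_
    have : (if u = v then ind (B ⊆ σ u) else 1) = 1 := by
      split_ifs with hu
      · rw [hu]; exact ind_true h
      · rfl
    simp only [f]
    rw [this, one_mul, hy1, ← Real.exp_nat_mul, mul_comm]
  have h1 : (((Fintype.piFinset (Om o s)).filter (fun σ => m ≤ (badS o H D σ v).card)).card : ℝ) ≤
      ∑ σ ∈ Fintype.piFinset (Om o s), ∑ B ∈ (Ls o v).powersetCard m,
        Real.exp (-(θ * (m * D))) * ∏ u, f B u (σ u) := by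
    rw [Finset.card_filter]
    push_cast
    refine Finset.sum_le_sum fun σ hσ => ?_
    have hσv := mem_powersetCard.1 (Fintype.mem_piFinset.1 hσ v)
    have hnn : ∀ B ∈ (Ls o v).powersetCard m, 0 ≤ Real.exp (-(θ * (m * D))) * ∏ u, f B u (σ u) :=
      fun B _ => mul_nonneg (Real.exp_pos _).le (Finset.prod_nonneg fun u _ => hf0 B u _)
    split_ifs with h
    · obtain ⟨B, hB1, hB2⟩ := Finset.exists_subset_card_eq h
      have hBσ : B ⊆ σ v := hB1.trans (filter_subset _ _)
      have hBL : B ⊆ Ls o v := hBσ.trans hσv.1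
      refine le_trans ?_ (Finset.single_le_sum hnn (mem_powersetCard.2 ⟨hBL, hB2⟩))
      rw [hfp B σ hBσ, ← Real.exp_add]
      apply Real.one_le_exp
      have e1 := edges_le hm σ v B hBL
      have e2 : (m : ℝ) * D ≤ ∑ c ∈ B, (degS o H σ c : ℝ) := by
        rw [← hB2, ← nsmul_eq_mul]
        exact Finset.card_nsmul_le_sum _ _ _ fun c hc => (mem_filter.1 (hB1 hc)).2.le
      have e3 : (∑ c ∈ B, (degS o H σ c : ℝ)) ≤ ∑ u, ((σ u ∩ NB B).card : ℝ) := by exact_mod_cast e1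
      have := mul_le_mul_of_nonneg_left (e2.trans e3) hθ
      linarith
    · exact Finset.sum_nonneg hnn
  refine h1.trans ?_
  rw [Finset.sum_comm]
  let cnt : Finset C → ℝ := fun B => ∑ S ∈ Om o s v, ind (B ⊆ S)
  let R : ℝ := ∏ u ∈ univ.erase v, ((Om o s u).card : ℝ)
  have hR0 : 0 ≤ R := Finset.prod_nonneg fun u _ => Nat.cast_nonneg _
  have hcnt0 : ∀ B, 0 ≤ cnt B := fun B => Finset.sum_nonneg fun S _ => ind_nonneg _
  have hcard : ((Fintype.piFinset (Om o s)).card : ℝ) = (Om o s v).card * R := by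
    rw [Fintype.card_piFinset, ← Finset.mul_prod_erase univ _ (mem_univ v)]
    push_cast; rfl
  have h2 : ∀ B ∈ (Ls o v).powersetCard m, ∑ σ ∈ Fintype.piFinset (Om o s),
      Real.exp (-(θ * (m * D))) * ∏ u, f B u (σ u) ≤
      Real.exp (-(θ * (m * D))) * ((cnt B * R) * Real.exp (ρ * y * (m * d))) := by
    intro B hB
    have hB := mem_powersetCard.1 hB
    rw [← Finset.mul_sum, ← Finset.prod_univ_sum]
    apply mul_le_mul_of_nonneg_left _ (Real.exp_pos _).le
    let g : V → ℝ := fun u => (if u = v then cnt B else ((Om o s u).card : ℝ))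
    have h3 : ∀ u, ∑ S ∈ Om o s u, f B u S ≤ g u * Real.exp (ρ * y * (NB B ∩ Ls o u).card) := by
      intro u
      by_cases hu : u = v
      · subst hu
        simp only [g, if_true]
        have : ∑ S ∈ Om o s u, f B u S = cnt B := by
          refine Finset.sum_congr rfl fun S hS => ?_
          have hS := (mem_powersetCard.1 hS).1
          have : S ∩ NB B = ∅ := by
            apply Finset.eq_empty_of_forall_notMem
            intro c hc
            have hc := mem_inter.1 hc
            obtain ⟨b, hb, h⟩ := mem_biUnion.1 hc.2
            exact ho b c (mem_Nb.1 h) (by rw [mem_Ls.1 (hB.1 hb), mem_Ls.1 (hS hc.1)])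
          simp [f, this]
        rw [this]
        apply le_mul_of_one_le_right (hcnt0 B)
        apply Real.one_le_exp; positivity
      · simp only [g, hu, if_false, f, one_mul]
        exact hyper (Ls o u) (NB B) s (hs u) y ρ hy0 (hρ u)
    refine (Finset.prod_le_prod (fun u _ => Finset.sum_nonneg fun S _ => hf0 B u S) fun u _ => h3 u).trans ?_
    rw [Finset.prod_mul_distrib]
    have h4 : ∏ u, g u = cnt B * R := by
      rw [← Finset.mul_prod_erase univ _ (mem_univ v)]
      simp only [g, if_true, R]
      congr 1
      refine Finset.prod_congr rfl fun u hu => ?_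
      simp [Finset.ne_of_mem_erase hu]
    rw [h4, ← Real.exp_sum]
    apply mul_le_mul_of_nonneg_left _ (mul_nonneg (hcnt0 B) hR0)
    apply Real.exp_le_exp.2
    rw [← Finset.mul_sum]
    apply mul_le_mul_of_nonneg_left _ (mul_nonneg hρ0 hy0)
    have h5 : ∑ u, (NB B ∩ Ls o u).card = (NB B).card := by
      rw [Finset.card_eq_sum_card_fiberwise (f := o) (t := univ) (fun _ _ => mem_univ _)]
      refine Finset.sum_congr rfl fun u _ => ?_
      congr 1; ext c; simp [mem_Ls]
    have h6 : ((NB B).card : ℝ) ≤ ∑ c ∈ B, ((Nb H c).card : ℝ) := by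
      exact_mod_cast Finset.card_biUnion_le
    have h7 : ∑ c ∈ B, ((Nb H c).card : ℝ) ≤ m * d := by
      rw [← hB.2, ← nsmul_eq_mul]
      exact Finset.sum_le_card_nsmul _ _ _ fun c _ => hd c
    have h8 : (∑ u, ((NB B ∩ Ls o u).card : ℝ)) = ((NB B).card : ℝ) := by exact_mod_cast h5
    linarith
  refine (Finset.sum_le_sum h2).trans ?_
  have h9 : ∑ B ∈ (Ls o v).powersetCard m, cnt B ≤ (Om o s v).card * 2 ^ s := by
    simp only [cnt]
    rw [Finset.sum_comm, ← nsmul_eq_mul]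
    refine Finset.sum_le_card_nsmul _ _ _ fun S hS => ?_
    have hS := mem_powersetCard.1 hS
    have : ∑ B ∈ (Ls o v).powersetCard m, ind (B ⊆ S) = (((Ls o v).powersetCard m).filter (fun B => B ⊆ S)).card := by
      rw [Finset.card_filter]; push_cast; refine Finset.sum_congr rfl fun B _ => ?_; unfold ind; congr
    rw [this]
    have h10 : (((Ls o v).powersetCard m).filter (fun B => B ⊆ S)).card ≤ S.powerset.card :=
      card_le_card fun B hB => mem_powerset.2 (mem_filter.1 hB).2
    rw [card_powerset, hS.2] at h10
    exact_mod_cast h10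
  rw [← Finset.mul_sum, ← Finset.sum_mul, ← Finset.sum_mul, hcard, sub_eq_add_neg, Real.exp_add]
  have := mul_le_mul_of_nonneg_right h9
    (mul_nonneg hR0 (mul_nonneg (Real.exp_pos (-(θ * (m * D)))).le (Real.exp_pos (ρ * y * (m * d))).le))
  linarith
end

lemma det {V C : Type} [Fintype V] [Fintype C] {o : C → V} {H : SimpleGraph C} (k D : ℝ) (ℓ : ℕ)
    (hm : ∀ c c1 c2, H.Adj c c1 → H.Adj c c2 → o c1 = o c2 → c1 = c2)
    (ho : ∀ c c', H.Adj c c' → o c ≠ o c') (hsp : LocallySparse H k)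
    (σ : V → Finset C) (hσ : ∀ v, σ v ⊆ Ls o v) (hℓ : ∀ v, ℓ ≤ (σ v \ badS o H D σ v).card)
    (hℓ1 : 1 ≤ ℓ) (hℓD : (ℓ : ℝ) ≤ D)
    (hth : ∀ (C₂ : Type) [Fintype C₂] (o₂ : C₂ → V) (H₂ : SimpleGraph C₂), Env o₂ H₂ ℓ D k →
      Col o₂ H₂ univ (fun _ => 1 / (ℓ : ℝ))) :
    ∃ φ : V → C, (∀ v, φ v ∈ σ v) ∧ ∀ u w, ¬ H.Adj (φ u) (φ w) := by
  have h := fun v => Finset.exists_subset_card_eq (hℓ v)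
  choose R hR1 hR2 using h
  have hRσ : ∀ v c, c ∈ R v → c ∈ σ v := fun v c hc => (mem_sdiff.1 (hR1 v hc)).1
  have hRo : ∀ v c, c ∈ R v → o c = v := fun v c hc => mem_Ls.1 (hσ v (hRσ v c hc))
  have hRd : ∀ v c, c ∈ R v → (degS o H σ c : ℝ) ≤ D := by
    intro v c hc
    have h1 := mem_sdiff.1 (hR1 v hc)
    by_contra h
    push Not at h
    exact h1.2 (mem_filter.2 ⟨h1.1, h⟩)
  let C₂ := {c : C // c ∈ R (o c)}
  let o₂ : C₂ → V := fun c => o c.1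
  let H₂ : SimpleGraph C₂ := H.comap Subtype.val
  have hA : ∀ a b : C₂, H₂.Adj a b ↔ H.Adj a.1 b.1 := fun a b => Iff.rfl
  have hE : Env o₂ H₂ ℓ D k := by
    refine ⟨fun c c1 c2 h1 h2 h3 => Subtype.ext (hm c.1 c1.1 c2.1 h1 h2 h3),
      fun c c' h => ho c.1 c'.1 h, fun v => ?_, fun c => ?_, by exact_mod_cast hℓ1, hℓD, fun c => ?_⟩
    · rw [← hR2 v]
      congr 1
      apply Finset.card_bij (fun c _ => c.1)
      · intro c hc
        have h0 : o₂ c = v := mem_Ls.1 hc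
        have h1 : o c.1 = v := h0
        have := c.2
        rwa [h1] at this
      · intro a _ b _ h; exact Subtype.ext h
      · intro c hc
        have h1 := hRo v c hc
        exact ⟨⟨c, by rw [h1]; exact hc⟩, mem_Ls.2 h1, rfl⟩
    · refine le_trans ?_ (hRd _ c.1 c.2)
      unfold degS
      have : (Nb H₂ c).card ≤ ((Nb H c.1).filter (fun c' => c' ∈ σ (o c'))).card := by
        apply Finset.card_le_card_of_injOn (fun c => c.1)
        · intro c' hc'
          have h0 : H₂.Adj c c' := mem_Nb.1 (mem_coe.1 hc')
          have h1 : H.Adj c.1 c'.1 := h0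
          exact mem_filter.2 ⟨mem_Nb.2 h1, hRσ _ _ c'.2⟩
        · intro a _ b _ h; exact Subtype.ext h
      exact_mod_cast this
    · refine le_trans ?_ (hsp c.1)
      have : ∑ c' ∈ Nb H₂ c, (Nb H₂ c ∩ Nb H₂ c').card ≤ pairsWithin H (H.neighborFinset c.1) := by
        rw [← Finset.card_sigma]
        unfold pairsWithin
        apply Finset.card_le_card_of_injOn (fun x => (x.1.1, x.2.1))
        · intro x hx
          have hx := mem_sigma.1 hx
          have h2 := mem_inter.1 hx.2
          have e1 : H₂.Adj c x.1 := mem_Nb.1 hx.1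
          have e2 : H₂.Adj c x.2 := mem_Nb.1 h2.1
          have e3 : H₂.Adj x.1 x.2 := mem_Nb.1 h2.2
          have f1 : H.Adj c.1 x.1.1 := e1
          have f2 : H.Adj c.1 x.2.1 := e2
          have f3 : H.Adj x.1.1 x.2.1 := e3
          refine mem_filter.2 ⟨mem_product.2 ⟨?_, ?_⟩, f3⟩
          · exact (SimpleGraph.mem_neighborFinset ..).2 f1
          · exact (SimpleGraph.mem_neighborFinset ..).2 f2
        · rintro ⟨a, b⟩ _ ⟨a', b'⟩ _ h
          simp only [Prod.mk.injEq] at h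
          have h1 := Subtype.ext h.1
          have h2 := Subtype.ext h.2
          subst h1; subst h2; rfl
      have h4 : ((∑ c' ∈ Nb H₂ c, (Nb H₂ c ∩ Nb H₂ c').card : ℕ) : ℝ) ≤ (pairsWithin H (H.neighborFinset c.1) : ℝ) := Nat.cast_le.2 this
      rw [Nat.cast_sum] at h4
      refine le_trans (le_of_eq (Finset.sum_congr rfl fun c' _ => ?_)) h4
      congr 2
      ext b
      simp only [mem_inter]
  obtain ⟨φ, h1, h2⟩ := hth C₂ o₂ H₂ hE
  refine ⟨fun v => (φ v).1, fun v => ?_, fun u w h => h2 u (mem_univ _) w (mem_univ _) h⟩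
  have h3 : o (φ v).1 = v := (h1 v (mem_univ _)).1
  have := (φ v).2
  rw [h3] at this
  exact hRσ _ _ this

lemma num_fail (K δ M d q : ℝ) (s m : ℕ) (hK : 0 < K) (hδ : 0 < δ) (hδ1 : δ ≤ 1) (hM : 32 * K / δ ^ 3 ≤ M)
    (hs : 1 ≤ s) (hd : 0 < d) (hq : q = 4 * K * d / M) (hm : δ * s ≤ m) :
    2 ^ s * Real.exp ((s / q) * (Real.exp (δ / 2) - 1) * (m * d) - (δ / 2) * (m * ((1 + δ) * s * d / q)))
      ≤ Real.exp (-(s : ℝ) ^ 2) := by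
  have hM0 : 0 < M := lt_of_lt_of_le (by positivity) hM
  have hs1 : (1 : ℝ) ≤ s := by exact_mod_cast hs
  have e : Real.exp (δ / 2) ≤ 1 + δ / 2 + (δ / 2) ^ 2 := exp_quad (by linarith) (by linarith)
  have h1 : (s / q) * (Real.exp (δ / 2) - 1) * (m * d) - (δ / 2) * (m * ((1 + δ) * s * d / q))
      = m * (s * M / (4 * K)) * (Real.exp (δ / 2) - 1 - δ / 2 * (1 + δ)) := by
    rw [hq]; field_simp
  rw [h1]
  have h2 : Real.exp (δ / 2) - 1 - δ / 2 * (1 + δ) ≤ - (δ ^ 2 / 4) := by nlinarith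
  have hμ : 8 * s / δ ^ 3 ≤ s * M / (4 * K) := by
    rw [div_le_iff₀ (by positivity)] at hM
    rw [div_le_div_iff₀ (by positivity) (by positivity)]
    nlinarith
  have h3 : 8 * (s : ℝ) ^ 2 / δ ^ 2 ≤ m * (s * M / (4 * K)) := by
    calc 8 * (s : ℝ) ^ 2 / δ ^ 2 = (δ * s) * (8 * s / δ ^ 3) := by field_simp
      _ ≤ _ := by gcongr
  have h4 : m * (s * M / (4 * K)) * (Real.exp (δ / 2) - 1 - δ / 2 * (1 + δ)) ≤ -(2 * (s : ℝ) ^ 2) := by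
    have a0 : 0 ≤ m * (s * M / (4 * K)) := by positivity
    have a1 := mul_le_mul_of_nonneg_left h2 a0
    have a2 : 8 * (s : ℝ) ^ 2 / δ ^ 2 * (δ ^ 2 / 4) ≤ m * (s * M / (4 * K)) * (δ ^ 2 / 4) := by gcongr
    have a3 : 8 * (s : ℝ) ^ 2 / δ ^ 2 * (δ ^ 2 / 4) = 2 * (s : ℝ) ^ 2 := by field_simp; norm_num
    linarith
  have h5 : (2 : ℝ) ^ s ≤ Real.exp ((s : ℝ) ^ 2) := by
    calc (2 : ℝ) ^ s ≤ (Real.exp 1) ^ s := by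
          gcongr
          have := Real.add_one_le_exp (1 : ℝ)
          linarith
      _ = Real.exp s := by rw [← Real.exp_nat_mul]; simp
      _ ≤ _ := Real.exp_le_exp.2 (by nlinarith)
  calc _ ≤ Real.exp ((s : ℝ) ^ 2) * Real.exp (-(2 * (s : ℝ) ^ 2)) := by gcongr
    _ = _ := by rw [← Real.exp_add]; congr 1; ring

lemma num_n (n s : ℕ) (hn : 1 ≤ n) (h : 2 * Real.sqrt (Real.log n) ≤ s) :
    n * Real.exp (-(s : ℝ) ^ 2) ≤ 1 / n := by
  have hn1 : (1 : ℝ) ≤ n := by exact_mod_cast hn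
  have hl := Real.log_nonneg hn1
  have h0 := Real.sqrt_nonneg (Real.log n)
  have h1 : 4 * Real.log n ≤ (s : ℝ) ^ 2 := by nlinarith [Real.sq_sqrt hl]
  have h2 : Real.exp (-(s : ℝ) ^ 2) ≤ Real.exp (-(Real.log n + Real.log n)) :=
    Real.exp_le_exp.2 (by linarith)
  rw [Real.exp_neg (Real.log n + Real.log n), Real.exp_add, Real.exp_log (by linarith)] at h2
  calc n * Real.exp (-(s : ℝ) ^ 2) ≤ n * ((n : ℝ) * n)⁻¹ := by gcongr
    _ = 1 / n := by field_simp

lemma pi_transfer {V C : Type} [Fintype V] (T : V → Finset (Finset C)) (P : (V → Finset C) → Prop)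
    [DecidablePred P]
    [DecidablePred fun σ : ((a : V) → a ∈ (Finset.univ : Finset V) → Finset C) => P (fun v => σ v (Finset.mem_univ v))] :
    ((Finset.univ.pi T).filter fun σ => P (fun v => σ v (Finset.mem_univ v))).card
      = ((Fintype.piFinset T).filter P).card := by
  apply Finset.card_bij (fun σ _ v => σ v (Finset.mem_univ v))
  · intro σ hσ
    simp only [mem_filter, Finset.mem_pi, Fintype.mem_piFinset] at hσ ⊢
    exact ⟨fun v => hσ.1 v (mem_univ v), hσ.2⟩
  · intro a _ b _ h
    funext v hv
    exact congrFun h v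
  · intro σ hσ
    simp only [mem_filter, Fintype.mem_piFinset] at hσ
    exact ⟨fun v _ => σ v, by simp only [mem_filter, Finset.mem_pi]; exact ⟨fun v _ => hσ.1 v, hσ.2⟩, rfl⟩

lemma good_count {V C : Type} [Fintype V] [Fintype C] (T : Finset (V → Finset C)) (P : (V → Finset C) → Prop)
    (F : V → (V → Finset C) → Prop) [DecidablePred P] [∀ v, DecidablePred (F v)] (β : ℝ) (hT : 0 < T.card)
    (hF : ∀ v, ((T.filter (F v)).card : ℝ) ≤ T.card * β)
    (hP : ∀ σ ∈ T, (∀ v, ¬ F v σ) → P σ) :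
    1 - Fintype.card V * β ≤ ((T.filter P).card : ℝ) / T.card := by
  have hT' : (0 : ℝ) < T.card := by exact_mod_cast hT
  rw [le_div_iff₀ hT']
  have h1 : T ⊆ T.filter P ∪ univ.biUnion (fun v => T.filter (F v)) := by
    intro σ hσ
    by_cases h : ∀ v, ¬ F v σ
    · exact mem_union_left _ (mem_filter.2 ⟨hσ, hP σ hσ h⟩)
    · push Not at h
      obtain ⟨v, hv⟩ := h
      exact mem_union_right _ (mem_biUnion.2 ⟨v, mem_univ v, mem_filter.2 ⟨hσ, hv⟩⟩)
  have h2 := (card_le_card h1).trans ((card_union_le _ _).trans (Nat.add_le_add_left card_biUnion_le _))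
  have h3 : (T.card : ℝ) ≤ (T.filter P).card + ∑ v, ((T.filter (F v)).card : ℝ) := by exact_mod_cast h2
  have h4 : ∑ v, ((T.filter (F v)).card : ℝ) ≤ Fintype.card V * (T.card * β) := by
    calc _ ≤ ∑ _v : V, (T.card * β : ℝ) := Finset.sum_le_sum fun v _ => hF v
      _ = _ := by simp
  nlinarith

lemma core (K δ M k : ℝ) (d n q s : ℕ) (hδ : 0 < δ) (hδ1 : δ ≤ 1 / 20) (hK : 1 + 20 * δ ≤ K)
    (hM1 : 32 * K / δ ^ 3 ≤ M) (hM2 : 8 * K ≤ M) (hd : 0 < d) (hk : 1 ≤ k) (hs : 1 ≤ s)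
    (hq : (q : ℝ) = 4 * K * d / M) (hsq : s ≤ q) (hsk : Real.sqrt k * Real.exp M ≤ s)
    (hsn : 2 * Real.sqrt (Real.log n) ≤ s)
    {V C : Type} [Fintype V] [Fintype C] {o : C → V} {H : SimpleGraph C}
    (hm : ∀ c c1 c2, H.Adj c c1 → H.Adj c c2 → o c1 = o c2 → c1 = c2)
    (ho : ∀ c c', H.Adj c c' → o c ≠ o c') (hsp : LocallySparse H k)
    (hL : ∀ v, q ≤ (Ls o v).card) (hn : Fintype.card V = n) (hdeg : ∀ c, (Nb H c).card ≤ d)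
    (hth : ∀ (C₂ : Type) [Fintype C₂] (o₂ : C₂ → V) (H₂ : SimpleGraph C₂) (ℓ D : ℝ), Env o₂ H₂ ℓ D k →
      1 ≤ k → Real.sqrt k * Real.exp M ≤ 2 * ℓ → D / ℓ ≤ M / 4 * (1 - δ) →
      Col o₂ H₂ univ (fun _ => 1 / (ℓ : ℝ))) :
    1 - 1 / (n : ℝ) ≤ (((Fintype.piFinset (Om o s)).filter
      (fun σ => ∃ φ : V → C, (∀ v, φ v ∈ σ v) ∧ (∀ v, φ v ∈ Ls o v) ∧ ∀ u w, ¬ H.Adj (φ u) (φ w))).card : ℝ)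
      / ((Fintype.piFinset (Om o s)).card : ℝ) := by
  have hK0 : 0 < K := by linarith
  have hM0 : 0 < M := by linarith
  have hd0 : (0 : ℝ) < d := by exact_mod_cast hd
  have hs1 : (1 : ℝ) ≤ s := by exact_mod_cast hs
  have hq0 : (0 : ℝ) < q := by rw [hq]; positivity
  set D : ℝ := (1 + δ) * s * d / q with hD
  set m : ℕ := ⌈δ * s⌉₊ with hmdef
  have hDM : D = (1 + δ) * s * M / (4 * K) := by rw [hD, hq]; field_simp
  have hT : 0 < (Fintype.piFinset (Om o s)).card := by
    rw [Finset.card_pos, Fintype.piFinset_nonempty]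
    intro v
    exact Finset.powersetCard_nonempty.2 (hsq.trans (hL v))
  rcases Nat.eq_zero_or_pos n with h0 | hn1
  · have hV : IsEmpty V := Fintype.card_eq_zero_iff.1 (hn.trans h0)
    have := good_count (Fintype.piFinset (Om o s))
      (fun σ => ∃ φ : V → C, (∀ v, φ v ∈ σ v) ∧ (∀ v, φ v ∈ Ls o v) ∧ ∀ u w, ¬ H.Adj (φ u) (φ w))
      (fun _ _ => True) 0 hT (fun v => hV.elim v)
      (fun σ _ _ => ⟨fun v => hV.elim v, fun v => hV.elim v, fun v => hV.elim v, fun v => hV.elim v⟩)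
    rw [h0]; simp
  have main := good_count (Fintype.piFinset (Om o s))
      (fun σ => ∃ φ : V → C, (∀ v, φ v ∈ σ v) ∧ (∀ v, φ v ∈ Ls o v) ∧ ∀ u w, ¬ H.Adj (φ u) (φ w))
      (fun v σ => m ≤ (badS o H D σ v).card) (Real.exp (-(s : ℝ) ^ 2)) hT ?_ ?_
  · rw [hn] at main
    have := num_n n s hn1 hsn
    linarith
  · intro v
    refine (fail_count hm ho s m d D (s / q) (δ / 2) (fun v => hsq.trans (hL v)) ?_ (by positivity) ?_
      (by positivity) v).trans ?_
    · intro v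
      have : (q : ℝ) ≤ (Ls o v).card := by exact_mod_cast hL v
      gcongr
    · intro c; exact_mod_cast hdeg c
    · have := num_fail K δ M d q s m hK0 hδ (by linarith) hM1 hs hd0 hq (Nat.le_ceil _)
      gcongr
  · intro σ hσ hbad
    have hσ' : ∀ v, σ v ⊆ Ls o v ∧ (σ v).card = s := fun v =>
      Finset.mem_powersetCard.1 (Fintype.mem_piFinset.1 hσ v)
    set ℓ : ℕ := ⌈(1 - δ) * s⌉₊ with hℓdef
    have hℓ0 : (1 - δ) * s ≤ ℓ := Nat.le_ceil _
    have hpos : 0 < (1 - δ) * s := mul_pos (by linarith) (by linarith)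
    have hℓ1 : 1 ≤ ℓ := Nat.one_le_iff_ne_zero.2 (Nat.pos_iff_ne_zero.1 (Nat.ceil_pos.2 hpos))
    have hℓs : ℓ ≤ s := Nat.ceil_le.2 (by nlinarith)
    have hℓs' : (ℓ : ℝ) ≤ s := by exact_mod_cast hℓs
    have hDs : (s : ℝ) ≤ D := by
      rw [hDM, le_div_iff₀ (by positivity)]
      have : (s : ℝ) * (4 * K) ≤ s * M := by gcongr; linarith
      nlinarith [mul_pos (mul_pos hδ (show (0:ℝ) < s by linarith)) hM0]
    have hℓpos : (0 : ℝ) < ℓ := by linarith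
    have g1 : ∀ v, ℓ ≤ (σ v \ badS o H D σ v).card := by
      intro v
      have h3 : (badS o H D σ v).card < m := not_le.1 (hbad v)
      have h4 : ((badS o H D σ v).card : ℝ) < δ * s := Nat.lt_ceil.1 h3
      have h5 : (σ v \ badS o H D σ v).card + (badS o H D σ v).card = (σ v).card :=
        Finset.card_sdiff_add_card_eq_card (Finset.filter_subset _ _)
      rw [(hσ' v).2] at h5
      have h6 : ((σ v \ badS o H D σ v).card : ℝ) + (badS o H D σ v).card = s := by exact_mod_cast h5
      exact Nat.ceil_le.2 (by linarith)
    have g2 : Real.sqrt k * Real.exp M ≤ 2 * (ℓ : ℝ) := by nlinarith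
    have g3 : D / (ℓ : ℝ) ≤ M / 4 * (1 - δ) := by
      rw [div_le_iff₀ hℓpos, hDM, div_le_iff₀ (by positivity)]
      have a1 : (1 + δ) ≤ (1 - δ) * (1 - δ) * K := by
        have : (1 - δ) * (1 - δ) * (1 + 20 * δ) ≤ (1 - δ) * (1 - δ) * K := by
          apply mul_le_mul_of_nonneg_left hK; nlinarith
        nlinarith [mul_pos hδ hδ, mul_pos (mul_pos hδ hδ) hδ]
      have a2 : (1 - δ) * (1 - δ) * K * (s * M) ≤ (1 - δ) * K * M * ℓ := by
        have : (1 - δ) * K * M * ((1 - δ) * s) ≤ (1 - δ) * K * M * ℓ := by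
          apply mul_le_mul_of_nonneg_left hℓ0
          have : 0 ≤ 1 - δ := by linarith
          positivity
        linarith
      have a3 : (1 + δ) * (s * M) ≤ (1 - δ) * (1 - δ) * K * (s * M) := by gcongr
      nlinarith
    obtain ⟨φ, h1, h2⟩ := det (o := o) (H := H) k D ℓ hm ho hsp σ (fun v => (hσ' v).1) g1 hℓ1
      (hℓs'.trans hDs) (fun C₂ _ o₂ H₂ hE => hth C₂ o₂ H₂ ℓ D hE hk g2 g3)
    exact ⟨φ, h1, fun v => (hσ' v).1 (h1 v), h2⟩

/-- Palette sparsification for correspondence coloring in the color–degree setting, with the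
local sparsity constraint placed on the cover graph `H`.  Probabilities are expressed by
counting outcomes of the uniform product sample space `Ω = Π_v {S ⊆ L(v) : |S| = s}`. -/
theorem stmt4 (ε γ : ℝ) (hε : 0 < ε) (hγ : γ ∈ Set.Ioo (0 : ℝ) 1) :
    ∃ C : ℝ, 0 < C ∧ ∀ α : ℝ, α ∈ Set.Ioo (0 : ℝ) 1 →
    ∃ d₀ : ℕ, ∀ d : ℕ, d₀ ≤ d → ∀ (n : ℕ) (k : ℝ) (q s : ℕ),
      1 ≤ k → k ≤ (d : ℝ) ^ (2 * α * γ) →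
      (q : ℝ) = 4 * (1 + γ + ε) * d / Real.log ((d : ℝ) ^ α / Real.sqrt k) →
      s ≤ q →
      (d : ℝ) ^ α + C * Real.sqrt (Real.log n) ≤ (s : ℝ) →
      ∀ (V C' : Type) [Fintype V] [Fintype C'] (G : SimpleGraph V) (H : SimpleGraph C')
        (L : V → Finset C'),
        IsCorrespondenceCover G H L →
        (∀ v : V, q ≤ (L v).card) →
        Fintype.card V = n →
        LocallySparse H k →
        (∀ c : C', H.degree c ≤ d) →
        1 - 1 / (n : ℝ) ≤
          (((Finset.univ.pi fun v : V => (L v).powersetCard s).filter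
                fun σ => ∃ φ : V → C',
                  (∀ v : V, φ v ∈ σ v (Finset.mem_univ v)) ∧
                  (∀ v : V, φ v ∈ L v) ∧
                  ∀ u w : V, ¬H.Adj (φ u) (φ w)).card : ℝ) /
            ((Finset.univ.pi fun v : V => (L v).powersetCard s).card : ℝ) := by
  obtain ⟨hγ0, hγ1⟩ := hγ
  refine ⟨2, by norm_num, ?_⟩
  rintro α ⟨hα0, hα1⟩
  set δ : ℝ := min ε 1 / 20 with hδdef
  have hδ : 0 < δ := by have := lt_min hε one_pos; positivity
  have hδ1 : δ ≤ 1 / 20 := by have := min_le_right ε 1; linarith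
  have hδε : 20 * δ ≤ ε := by have := min_le_left ε 1; linarith
  obtain ⟨M0, hM0⟩ := theorem2 δ hδ (by linarith)
  set K : ℝ := 1 + γ + ε with hKdef
  set B : ℝ := max M0 (max (32 * K / δ ^ 3) (8 * K)) with hB
  have hc : 0 < α * (1 - γ) := mul_pos hα0 (by linarith)
  refine ⟨⌈Real.exp (B / (α * (1 - γ)))⌉₊, ?_⟩
  intro d hd n k q s hk hkd hq hsq hs V C' _ _ G H L hcov hL hn hsp hdeg
  have hd1 : Real.exp (B / (α * (1 - γ))) ≤ d := (Nat.le_ceil _).trans (by exact_mod_cast hd)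
  have hd0 : (0 : ℝ) < d := (Real.exp_pos _).trans_le hd1
  have hlog : B ≤ α * (1 - γ) * Real.log d := by
    have := (Real.le_log_iff_exp_le hd0).2 hd1
    rw [div_le_iff₀ hc] at this
    linarith
  set M : ℝ := Real.log ((d : ℝ) ^ α / Real.sqrt k) with hM
  have hk0 : 0 < k := by linarith
  have hsk0 : 0 < Real.sqrt k := Real.sqrt_pos.2 hk0
  have hdα : 0 < (d : ℝ) ^ α := Real.rpow_pos_of_pos hd0 _
  have hMB : B ≤ M := by
    rw [hM, Real.log_div hdα.ne' hsk0.ne', Real.log_rpow hd0, Real.log_sqrt hk0.le]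
    have h1 := Real.log_le_log hk0 hkd
    rw [Real.log_rpow hd0] at h1
    linarith
  have hexp : Real.sqrt k * Real.exp M = (d : ℝ) ^ α := by
    rw [hM, Real.exp_log (by positivity)]; field_simp
  have hsq0 := Real.sqrt_nonneg (Real.log n)
  have hs0 : 1 ≤ s := by
    have : (0 : ℝ) < s := by linarith
    exact_mod_cast this
  choose o ho1 ho2 using hcov.partition
  have hLs : L = Ls o := by
    funext v; ext c
    rw [mem_Ls]
    exact ⟨fun h => (ho2 c v h).symm, fun h => h ▸ ho1 c⟩
  have hres := core K δ M k d n q s hδ hδ1 (by linarith)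
    ((le_max_left _ _).trans ((le_max_right _ _).trans hMB))
    ((le_max_right _ _).trans ((le_max_right _ _).trans hMB)) (by exact_mod_cast hd0) hk hs0 hq hsq
    (by linarith) (by linarith) (o := o) (H := H)
    (fun c c1 c2 h1 h2 h3 => hcov.matching (o c) (o c1) c (ho1 c) c1 (ho1 c1) c2 (h3 ▸ ho1 c2) h1 h2)
    (fun c c' h h' => hcov.indep (o c) c (ho1 c) c' (h' ▸ ho1 c') h) hsp
    (fun v => hLs ▸ hL v) hn ?_
    (fun C₂ _ o₂ H₂ ℓ D => hM0 M ((le_max_left _ _).trans hMB) V C₂ o₂ H₂ ℓ D k)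
  · rw [pi_transfer (fun v : V => (L v).powersetCard s) (fun σ => ∃ φ : V → C',
      (∀ v, φ v ∈ σ v) ∧ (∀ v, φ v ∈ L v) ∧ ∀ u w, ¬ H.Adj (φ u) (φ w))]
    have hc2 : (Finset.univ.pi fun v : V => (L v).powersetCard s).card
        = (Fintype.piFinset (Om o s)).card := by
      have := pi_transfer (fun v : V => (L v).powersetCard s) (fun _ => True)
      simp only [Finset.filter_true] at this
      rw [this, hLs]; rfl
    rw [hc2, hLs]
    exact hres
  · intro c
    refine le_trans (le_of_eq ?_) (hdeg c)
    rw [← SimpleGraph.card_neighborFinset_eq_degree]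
    congr 1
    ext b
    simp [mem_Nb]
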